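/- A graph property P is testable if and only if P is robust and its closure P̄ is a testable graphon property. -/

import Mathlib

open MeasureTheory Filter Topology
open scoped ENNReal

noncomputable section

/-- The unit interval `[0,1]` as a subset of `ℝ`. -/
def I01 : Set ℝ := Set.Icc 0 1

/-- `W₀`: symmetric measurable functions `[0,1]² → [0,1]`
(represented as functions `ℝ → ℝ → ℝ`, with the relevant values on `[0,1]²`). -/
def IsGraphon (W : ℝ → ℝ → ℝ) : Prop :=
  Measurable (Function.uncurry W) ∧ (∀ x y, W x y = W y x) ∧
    ∀ x y, W x y ∈ Set.Icc (0 : ℝ) 1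

/-- The `L¹` norm of a kernel on `[0,1]²`. -/
def l1Norm (W : ℝ → ℝ → ℝ) : ℝ :=
  ∫ x in I01, ∫ y in I01, |W x y|

/-- The cut norm of a kernel on `[0,1]²`. -/
def cutNorm (W : ℝ → ℝ → ℝ) : ℝ :=
  sSup { r : ℝ | ∃ S T : Set ℝ, MeasurableSet S ∧ MeasurableSet T ∧ S ⊆ I01 ∧ T ⊆ I01 ∧
    r = |∫ x in S, ∫ y in T, W x y| }

/-- An invertible measure preserving map of `[0,1]`. -/
structure InvMP where
  toFun : ℝ → ℝ
  invFun : ℝ → ℝ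
  maps : ∀ x ∈ I01, toFun x ∈ I01
  mapsInv : ∀ x ∈ I01, invFun x ∈ I01
  measurePreserving :
    MeasurePreserving toFun (volume.restrict I01) (volume.restrict I01)
  measurePreservingInv :
    MeasurePreserving invFun (volume.restrict I01) (volume.restrict I01)
  leftInv : ∀ x ∈ I01, invFun (toFun x) = x
  rightInv : ∀ x ∈ I01, toFun (invFun x) = x

/-- `δ_□`: the cut distance, infimum of the cut norm over invertible measure
preserving transformations of `[0,1]`. -/
def deltaCut (U W : ℝ → ℝ → ℝ) : ℝ :=
  ⨅ φ : InvMP, cutNorm (fun x y => U x y - W (φ.toFun x) (φ.toFun y))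

/-- `δ₁`: the `L¹` distance minimized over invertible measure preserving
transformations of `[0,1]`. -/
def delta1 (U W : ℝ → ℝ → ℝ) : ℝ :=
  ⨅ φ : InvMP, l1Norm (fun x y => U x y - W (φ.toFun x) (φ.toFun y))



/-- A graph property: for each `n`, a set of simple graphs on `Fin n`. -/
def GraphProp := ∀ n : ℕ, Set (SimpleGraph (Fin n))

/-- Invariance under isomorphism (isomorphic graphs necessarily have the same
number of vertices). -/
def IsGraphProperty (P : GraphProp) : Prop :=
  ∀ (n : ℕ) (G H : SimpleGraph (Fin n)), Nonempty (G ≃g H) → (G ∈ P n ↔ H ∈ P n)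

/-- The normalized edit distance between graphs on a common vertex set. -/
def graphD1 {n : ℕ} (G H : SimpleGraph (Fin n)) : ℝ :=
  (symmDiff G.edgeSet H.edgeSet).ncard / (n ^ 2 : ℝ)

/-- The edit distance from a graph to a graph property (∞ if the property
contains no graph on the same number of nodes). -/
def graphD1P {n : ℕ} (G : SimpleGraph (Fin n)) (P : GraphProp) : ℝ≥0∞ :=
  ⨅ (H : SimpleGraph (Fin n)) (_ : H ∈ P n), ENNReal.ofReal (graphD1 G H)

open Classical in
/-- The step function `W_G` associated with a graph `G` on `{1,…,n}`:
its value on `((i−1)/n, i/n] × ((j−1)/n, j/n]` is `1` iff `ij ∈ E(G)`. -/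
def graphonOf {n : ℕ} (G : SimpleGraph (Fin n)) : ℝ → ℝ → ℝ := fun x y =>
  if ∃ i j : Fin n, G.Adj i j ∧ x ∈ Set.Ioc (((i : ℕ) : ℝ) / n) ((((i : ℕ) : ℝ) + 1) / n)
      ∧ y ∈ Set.Ioc (((j : ℕ) : ℝ) / n) ((((j : ℕ) : ℝ) + 1) / n)
  then 1 else 0

/-- `H` is (isomorphic to) an induced subgraph of `G`. -/
def IsInducedSubgraph {n k : ℕ} (G : SimpleGraph (Fin n)) (H : SimpleGraph (Fin k)) : Prop :=
  ∃ f : Fin k ↪ Fin n, ∀ i j, H.Adj i j ↔ G.Adj (f i) (f j)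

/-- The subgraph of `G` induced on the vertex subset `S` has property `P`
(as a graph on `k = |S|` nodes). -/
def inducedMem {n : ℕ} (G : SimpleGraph (Fin n)) (S : Finset (Fin n)) (k : ℕ)
    (P : GraphProp) : Prop :=
  ∃ H : SimpleGraph (Fin k), H ∈ P k ∧
    ∃ f : Fin k ↪ Fin n, (∀ i, f i ∈ S) ∧ ∀ i j, H.Adj i j ↔ G.Adj (f i) (f j)

/-- The number of `k`-element vertex subsets of `G` inducing a subgraph with property `P`. -/
def goodCount {n : ℕ} (G : SimpleGraph (Fin n)) (k : ℕ) (P : GraphProp) : ℕ :=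
  {S : Finset (Fin n) | S.card = k ∧ inducedMem G S k P}.ncard

/-- Testability of a graph property (Definition 1.1 of the paper). -/
def GraphTestable (P : GraphProp) : Prop :=
  ∃ P' : GraphProp, IsGraphProperty P' ∧
    (∀ (n : ℕ) (G : SimpleGraph (Fin n)), G ∈ P n → ∀ k, 1 ≤ k → k ≤ n →
      2 * n.choose k ≤ 3 * goodCount G k P') ∧
    (∀ ε : ℝ, 0 < ε → ∃ kε : ℕ, 1 ≤ kε ∧
      ∀ (n : ℕ) (G : SimpleGraph (Fin n)) (k : ℕ), kε ≤ k → k ≤ n →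
        ENNReal.ofReal ε ≤ graphD1P G P →
        3 * goodCount G k P' ≤ n.choose k)

def cube (k : ℕ) : Set (Fin k → ℝ) := Set.univ.pi fun _ => I01

open Classical in
/-- The homomorphism density `t(F,W)`. -/
def homDensity {k : ℕ} (F : SimpleGraph (Fin k)) (W : ℝ → ℝ → ℝ) : ℝ :=
  ∫ x in cube k, ∏ i : Fin k, ∏ j : Fin k,
    if i < j ∧ F.Adj i j then W (x i) (x j) else 1

open Classical in
/-- The induced density `t_ind(F,W)`. -/
def indDensity {k : ℕ} (F : SimpleGraph (Fin k)) (W : ℝ → ℝ → ℝ) : ℝ :=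
  ∫ x in cube k, ∏ i : Fin k, ∏ j : Fin k,
    if i < j then (if F.Adj i j then W (x i) (x j) else 1 - W (x i) (x j)) else 1

/-- Isomorphism of functions in `W₀`: equality of all homomorphism densities. -/
def GraphonIso (U W : ℝ → ℝ → ℝ) : Prop :=
  ∀ (k : ℕ) (F : SimpleGraph (Fin k)), homDensity F U = homDensity F W

open Classical in
/-- `P(G(k,W) ∈ R')`, the probability that the `W`-random graph on `k` nodes
has property `R'`. -/
def probIn (k : ℕ) (W : ℝ → ℝ → ℝ) (R' : GraphProp) : ℝ :=
  ∑ F : SimpleGraph (Fin k), if F ∈ R' k then indDensity F W else 0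

/-- The `L¹` distance from `W` to a set `R` of kernels, with value `∞` for `R = ∅`. -/
def d1SetE (W : ℝ → ℝ → ℝ) (R : Set (ℝ → ℝ → ℝ)) : ℝ≥0∞ :=
  ⨅ (U : ℝ → ℝ → ℝ) (_ : U ∈ R), ENNReal.ofReal (l1Norm fun x y => W x y - U x y)

/-- The cut-norm distance from `W` to a set `R` of kernels, with value `∞` for `R = ∅`. -/
def dCutSetE (W : ℝ → ℝ → ℝ) (R : Set (ℝ → ℝ → ℝ)) : ℝ≥0∞ :=
  ⨅ (U : ℝ → ℝ → ℝ) (_ : U ∈ R), ENNReal.ofReal (cutNorm fun x y => W x y - U x y)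

/-- The open ball `B₁(R,c)` (within `W₀`). -/
def ball1 (R : Set (ℝ → ℝ → ℝ)) (c : ℝ) : Set (ℝ → ℝ → ℝ) :=
  {W | IsGraphon W ∧ d1SetE W R < ENNReal.ofReal c}

/-- The open ball `B_□(R,c)` (within `W₀`). -/
def ballCut (R : Set (ℝ → ℝ → ℝ)) (c : ℝ) : Set (ℝ → ℝ → ℝ) :=
  {W | IsGraphon W ∧ dCutSetE W R < ENNReal.ofReal c}

/-- A graphon property: a set of graphons invariant under isomorphism. -/
def IsGraphonProperty (R : Set (ℝ → ℝ → ℝ)) : Prop :=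
  (∀ W ∈ R, IsGraphon W) ∧
    ∀ U W, IsGraphon U → IsGraphon W → GraphonIso U W → (U ∈ R ↔ W ∈ R)

/-- A set of graphons is closed if it is closed in the cut norm. -/
def CutClosed (R : Set (ℝ → ℝ → ℝ)) : Prop :=
  ∀ W, IsGraphon W →
    (∀ ε : ℝ, 0 < ε → ∃ U ∈ R, cutNorm (fun x y => W x y - U x y) < ε) → W ∈ R

/-- Testability of a graphon property. -/
def GraphonTestable (R : Set (ℝ → ℝ → ℝ)) : Prop :=
  ∃ R' : GraphProp, IsGraphProperty R' ∧
    (∀ W ∈ R, ∀ k : ℕ, 1 ≤ k → (2 : ℝ) / 3 ≤ probIn k W R') ∧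
    (∀ ε : ℝ, 0 < ε → ∃ kε : ℕ, 1 ≤ kε ∧ ∀ k, kε ≤ k → ∀ W, IsGraphon W →
      ENNReal.ofReal ε ≤ d1SetE W R → probIn k W R' ≤ 1 / 3)

/-- The closure `P̄` of a graph property: limits of convergent sequences
of graphs in `P` with sizes tending to infinity. -/
def closureP (P : GraphProp) : Set (ℝ → ℝ → ℝ) :=
  {W | IsGraphon W ∧ ∃ (n : ℕ → ℕ) (G : ∀ m, SimpleGraph (Fin (n m))),
    (∀ m, G m ∈ P (n m)) ∧ Tendsto n atTop atTop ∧
    Tendsto (fun m => deltaCut (graphonOf (G m)) W) atTop (nhds 0)}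

/-- A graph property is robust if graphs whose `W_G` is `d₁`-close to `P̄`
are themselves close to `P` in edit distance. -/
def Robust (P : GraphProp) : Prop :=
  ∀ ε : ℝ, 0 < ε → ∃ (N : ℕ) (ε' : ℝ), 1 ≤ N ∧ 0 < ε' ∧
    ∀ (n : ℕ), N ≤ n → ∀ G : SimpleGraph (Fin n),
      d1SetE (graphonOf G) (closureP P) ≤ ENNReal.ofReal ε' →
      graphD1P G P ≤ ENNReal.ofReal ε

/-- A hereditary graph property: closed under induced subgraphs. -/
def Hereditary (P : GraphProp) : Prop :=
  ∀ (n : ℕ) (G : SimpleGraph (Fin n)), G ∈ P n →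
    ∀ (k : ℕ) (H : SimpleGraph (Fin k)), IsInducedSubgraph G H → H ∈ P k

/-- `U` is a flexing of `W`: `U ∈ W₀` agrees with `W` wherever `W` takes value `0` or `1`. -/
def Flexing (U W : ℝ → ℝ → ℝ) : Prop :=
  IsGraphon U ∧ ∀ x y, (W x y = 0 ∨ W x y = 1) → U x y = W x y

/-- A function property is flexible if it is preserved under flexing. -/
def FlexibleFamily (R : Set (ℝ → ℝ → ℝ)) : Prop :=
  ∀ W ∈ R, ∀ U, Flexing U W → U ∈ R

/-- `U' ≤ W'` almost everywhere on `[0,1]²`. -/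
def aeLE (U W : ℝ → ℝ → ℝ) : Prop :=
  ∀ᵐ p ∂(volume.restrict (I01 ×ˢ I01)), U p.1 p.2 ≤ W p.1 p.2

/-- `U ⪯ W`: up to isomorphism, `U ≤ W` almost everywhere. -/
def graphonLE (U W : ℝ → ℝ → ℝ) : Prop :=
  ∃ U' W', IsGraphon U' ∧ IsGraphon W' ∧ GraphonIso U U' ∧ GraphonIso W W' ∧ aeLE U' W'

/-- The upward closure of a graph property: graphs having a spanning subgraph in `P`. -/
def upP (P : GraphProp) : GraphProp :=
  fun n => {G | ∃ H : SimpleGraph (Fin n), H ∈ P n ∧ H ≤ G}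

/-- The upward closure of a function property. -/
def upR (R : Set (ℝ → ℝ → ℝ)) : Set (ℝ → ℝ → ℝ) :=
  {W | IsGraphon W ∧ ∃ U ∈ R, graphonLE U W}

/-- A stepfunction: constant on the products of a finite measurable partition of `[0,1]`. -/
def IsStepfunction (W : ℝ → ℝ → ℝ) : Prop :=
  ∃ (m : ℕ) (S : Fin m → Set ℝ), (∀ i, MeasurableSet (S i)) ∧
    (⋃ i, S i) = I01 ∧ (∀ i j, i ≠ j → Disjoint (S i) (S j)) ∧
    ∀ i j : Fin m, ∀ x ∈ S i, ∀ x' ∈ S i, ∀ y ∈ S j, ∀ y' ∈ S j, W x y = W x' y'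

open Classical in
/-- A testable graphon functional: its value can be estimated from `W`-random graphs. -/
def TestableFunctional (f : (ℝ → ℝ → ℝ) → ℝ) : Prop :=
  ∃ g : ∀ n : ℕ, SimpleGraph (Fin n) → ℝ,
    (∀ (n : ℕ) (G H : SimpleGraph (Fin n)), Nonempty (G ≃g H) → g n G = g n H) ∧
    ∀ ε : ℝ, 0 < ε → ∃ kε : ℕ, 1 ≤ kε ∧ ∀ k, kε ≤ k → ∀ W, IsGraphon W →
      (∑ F : SimpleGraph (Fin k), if ε < |f W - g k F| then indDensity F W else 0) < 1 / 3


def mu1 : Measure ℝ := volume.restrict I01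

lemma measI01 : MeasurableSet I01 := measurableSet_Icc

instance instProbMu1 : IsProbabilityMeasure mu1 := ⟨by
  simp [mu1, I01]⟩

def mu2 : Measure (ℝ × ℝ) := mu1.prod mu1

instance instProbMu2 : IsProbabilityMeasure mu2 := by
  unfold mu2; infer_instance

instance instSFMu2 : SFinite mu2 := inferInstance

/-- bounded measurable kernels -/
def BK (D : ℝ → ℝ → ℝ) : Prop := Measurable (Function.uncurry D) ∧ ∃ C, ∀ x y, |D x y| ≤ C

lemma IsGraphon.bk {W : ℝ → ℝ → ℝ} (h : IsGraphon W) : BK W :=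
  ⟨h.1, 1, fun x y => by
    have := h.2.2 x y
    rw [abs_of_nonneg this.1]; exact this.2⟩

lemma BK.meas {D : ℝ → ℝ → ℝ} (h : BK D) : Measurable fun p : ℝ × ℝ => D p.1 p.2 := h.1

lemma BK.sub {D D' : ℝ → ℝ → ℝ} (h : BK D) (h' : BK D') : BK fun x y => D x y - D' x y := by
  obtain ⟨m, C, hC⟩ := h
  obtain ⟨m', C', hC'⟩ := h'
  exact ⟨m.sub m', C + C', fun x y => (abs_sub _ _).trans (add_le_add (hC x y) (hC' x y))⟩

lemma BK.add {D D' : ℝ → ℝ → ℝ} (h : BK D) (h' : BK D') : BK fun x y => D x y + D' x y := by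
  obtain ⟨m, C, hC⟩ := h
  obtain ⟨m', C', hC'⟩ := h'
  exact ⟨m.add m', C + C', fun x y => (abs_add_le _ _).trans (add_le_add (hC x y) (hC' x y))⟩

lemma BK.comp {D : ℝ → ℝ → ℝ} (h : BK D) {f : ℝ → ℝ} (hf : Measurable f) :
    BK fun x y => D (f x) (f y) := by
  obtain ⟨m, C, hC⟩ := h
  exact ⟨m.comp (by fun_prop : Measurable fun p : ℝ × ℝ => (f p.1, f p.2)), C, fun x y => hC _ _⟩

lemma integrable_of_bdd {α : Type*} [MeasurableSpace α] {μ : Measure α} [IsFiniteMeasure μ]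
    {f : α → ℝ} (hf : Measurable f) {C : ℝ} (hC : ∀ x, |f x| ≤ C) : Integrable f μ :=
  Integrable.of_bound hf.aestronglyMeasurable C (ae_of_all _ hC)

lemma BK.integrable {D : ℝ → ℝ → ℝ} (h : BK D) (μ : Measure (ℝ × ℝ)) [IsFiniteMeasure μ] :
    Integrable (fun p : ℝ × ℝ => D p.1 p.2) μ := by
  obtain ⟨m, C, hC⟩ := h
  exact integrable_of_bdd m (C := C) fun p => hC _ _

lemma l1Norm_eq {D : ℝ → ℝ → ℝ} (h : BK D) : l1Norm D = ∫ p, |D p.1 p.2| ∂mu2 := by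
  unfold l1Norm mu2 mu1
  have := (h.integrable mu2).abs
  rw [integral_prod]
  exact this

lemma rect_eq {D : ℝ → ℝ → ℝ} (h : BK D) {S T : Set ℝ} (hS : MeasurableSet S)
    (hT : MeasurableSet T) (hSI : S ⊆ I01) (hTI : T ⊆ I01) :
    ∫ x in S, ∫ y in T, D x y = ∫ p in S ×ˢ T, D p.1 p.2 ∂mu2 := by
  have e1 : volume.restrict S = mu1.restrict S := by
    rw [mu1, Measure.restrict_restrict hS, Set.inter_eq_left.2 hSI]
  have e2 : volume.restrict T = mu1.restrict T := by
    rw [mu1, Measure.restrict_restrict hT, Set.inter_eq_left.2 hTI]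
  rw [e1, e2, mu2, setIntegral_prod]
  exact (h.integrable mu2).integrableOn

lemma rect_inter {D : ℝ → ℝ → ℝ} {S T : Set ℝ} (hS : MeasurableSet S)
    (hT : MeasurableSet T) : ∫ p in (S ∩ I01) ×ˢ (T ∩ I01), D p.1 p.2 ∂mu2
      = ∫ p in S ×ˢ T, D p.1 p.2 ∂mu2 := by
  have : mu2.restrict ((S ∩ I01) ×ˢ (T ∩ I01)) = mu2.restrict (S ×ˢ T) := by
    rw [mu2, ← Measure.prod_restrict, ← Measure.prod_restrict, mu1,
      Measure.restrict_restrict hS, Measure.restrict_restrict hT,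
      Measure.restrict_restrict (hS.inter measI01), Measure.restrict_restrict (hT.inter measI01)]
    simp [Set.inter_assoc]
  rw [this]

lemma abs_setIntegral_le {D : ℝ → ℝ → ℝ} (h : BK D) (A : Set (ℝ × ℝ)) :
    |∫ p in A, D p.1 p.2 ∂mu2| ≤ l1Norm D := by
  rw [l1Norm_eq h]
  refine (abs_integral_le_integral_abs).trans ?_
  exact setIntegral_le_integral (h.integrable mu2).abs (ae_of_all _ fun _ => abs_nonneg _)

lemma cut_bdd {D : ℝ → ℝ → ℝ} (h : BK D) :
    BddAbove { r : ℝ | ∃ S T : Set ℝ, MeasurableSet S ∧ MeasurableSet T ∧ S ⊆ I01 ∧ T ⊆ I01 ∧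
    r = |∫ x in S, ∫ y in T, D x y| } := by
  refine ⟨l1Norm D, ?_⟩
  rintro r ⟨S, T, hS, hT, hSI, hTI, rfl⟩
  rw [rect_eq h hS hT hSI hTI]
  exact abs_setIntegral_le h _

lemma le_cutNorm {D : ℝ → ℝ → ℝ} (h : BK D) {S T : Set ℝ} (hS : MeasurableSet S)
    (hT : MeasurableSet T) : |∫ p in S ×ˢ T, D p.1 p.2 ∂mu2| ≤ cutNorm D := by
  rw [← rect_inter hS hT]
  refine le_csSup (cut_bdd h) ⟨S ∩ I01, T ∩ I01, hS.inter measI01, hT.inter measI01,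
    Set.inter_subset_right, Set.inter_subset_right, ?_⟩
  rw [rect_eq h (hS.inter measI01) (hT.inter measI01) Set.inter_subset_right
    Set.inter_subset_right]

lemma cutNorm_le {D : ℝ → ℝ → ℝ} (h : BK D) {c : ℝ}
    (hc : ∀ S T : Set ℝ, MeasurableSet S → MeasurableSet T →
      |∫ p in S ×ˢ T, D p.1 p.2 ∂mu2| ≤ c) : cutNorm D ≤ c := by
  refine csSup_le ⟨_, ∅, ∅, MeasurableSet.empty, MeasurableSet.empty, by simp, by simp, rfl⟩ ?_
  rintro r ⟨S, T, hS, hT, hSI, hTI, rfl⟩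
  rw [rect_eq h hS hT hSI hTI]
  exact hc S T hS hT

lemma cutNorm_nonneg {D : ℝ → ℝ → ℝ} (h : BK D) : 0 ≤ cutNorm D :=
  (abs_nonneg _).trans (le_cutNorm h MeasurableSet.empty MeasurableSet.empty)

lemma cutNorm_le_l1 {D : ℝ → ℝ → ℝ} (h : BK D) : cutNorm D ≤ l1Norm D :=
  cutNorm_le h fun _ _ _ _ => abs_setIntegral_le h _

lemma l1Norm_nonneg (D : ℝ → ℝ → ℝ) : 0 ≤ l1Norm D :=
  integral_nonneg fun _ => integral_nonneg fun _ => abs_nonneg _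

lemma cutNorm_add_le {D D' : ℝ → ℝ → ℝ} (h : BK D) (h' : BK D') :
    cutNorm (fun x y => D x y + D' x y) ≤ cutNorm D + cutNorm D' := by
  refine cutNorm_le (h.add h') fun S T hS hT => ?_
  rw [integral_add (h.integrable mu2).integrableOn (h'.integrable mu2).integrableOn]
  exact (abs_add_le _ _).trans (add_le_add (le_cutNorm h hS hT) (le_cutNorm h' hS hT))

lemma cutNorm_sub_comm (U W : ℝ → ℝ → ℝ) :
    cutNorm (fun x y => U x y - W x y) = cutNorm (fun x y => W x y - U x y) := by
  unfold cutNorm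
  congr 1
  ext r
  have : ∀ S T : Set ℝ, |∫ x in S, ∫ y in T, (U x y - W x y)|
      = |∫ x in S, ∫ y in T, (W x y - U x y)| := by
    intro S T
    rw [← abs_neg, ← integral_neg]
    simp_rw [← integral_neg, neg_sub]
  simp only [this]

lemma cutNorm_triangle {U V W : ℝ → ℝ → ℝ} (hU : BK U) (hV : BK V) (hW : BK W) :
    cutNorm (fun x y => U x y - W x y) ≤
      cutNorm (fun x y => U x y - V x y) + cutNorm (fun x y => V x y - W x y) := by
  have := cutNorm_add_le (hU.sub hV) (hV.sub hW)
  simpa using this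

lemma l1Norm_triangle {U V W : ℝ → ℝ → ℝ} (hU : BK U) (hV : BK V) (hW : BK W) :
    l1Norm (fun x y => U x y - W x y) ≤
      l1Norm (fun x y => U x y - V x y) + l1Norm (fun x y => V x y - W x y) := by
  rw [l1Norm_eq (hU.sub hW), l1Norm_eq (hU.sub hV), l1Norm_eq (hV.sub hW), ← integral_add
    ((hU.sub hV).integrable mu2).abs ((hV.sub hW).integrable mu2).abs]
  refine integral_mono ((hU.sub hW).integrable mu2).abs
    (((hU.sub hV).integrable mu2).abs.add ((hV.sub hW).integrable mu2).abs) fun p => ?_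
  exact abs_sub_le _ _ _

lemma l1Norm_sub_comm (U W : ℝ → ℝ → ℝ) :
    l1Norm (fun x y => U x y - W x y) = l1Norm (fun x y => W x y - U x y) := by
  unfold l1Norm
  simp_rw [abs_sub_comm]

lemma ae_mu1_mem : ∀ᵐ x ∂mu1, x ∈ I01 := ae_restrict_mem measI01

lemma InvMP.meas (φ : InvMP) : Measurable φ.toFun := φ.measurePreserving.measurable
lemma InvMP.measInv (φ : InvMP) : Measurable φ.invFun := φ.measurePreservingInv.measurable

lemma InvMP.mp (φ : InvMP) : MeasurePreserving φ.toFun mu1 mu1 := φ.measurePreserving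

def InvMP.symm (φ : InvMP) : InvMP where
  toFun := φ.invFun
  invFun := φ.toFun
  maps := φ.mapsInv
  mapsInv := φ.maps
  measurePreserving := φ.measurePreservingInv
  measurePreservingInv := φ.measurePreserving
  leftInv := φ.rightInv
  rightInv := φ.leftInv

def InvMP.id : InvMP where
  toFun := fun x => x
  invFun := fun x => x
  maps := fun _ h => h
  mapsInv := fun _ h => h
  measurePreserving := MeasurePreserving.id _
  measurePreservingInv := MeasurePreserving.id _
  leftInv := fun _ _ => rfl
  rightInv := fun _ _ => rfl

lemma InvMP.mp2 (φ : InvMP) :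
    MeasurePreserving (fun p : ℝ × ℝ => (φ.toFun p.1, φ.toFun p.2)) mu2 mu2 :=
  MeasurePreserving.prod φ.mp φ.mp

lemma integral_comp_mp {α β : Type*} [MeasurableSpace α] [MeasurableSpace β] {μ : Measure α}
    {ν : Measure β} {f : α → β} (hf : MeasurePreserving f μ ν) {g : β → ℝ} (hg : Measurable g) :
    ∫ x, g (f x) ∂μ = ∫ y, g y ∂ν := by
  rw [← hf.map_eq, integral_map hf.measurable.aemeasurable hg.aestronglyMeasurable]

lemma l1Norm_comp {D : ℝ → ℝ → ℝ} (h : BK D) (φ : InvMP) :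
    l1Norm (fun x y => D (φ.toFun x) (φ.toFun y)) = l1Norm D := by
  rw [l1Norm_eq (h.comp φ.meas), l1Norm_eq h]
  exact integral_comp_mp φ.mp2 (g := fun p => |D p.1 p.2|) (measurable_norm.comp h.meas)

lemma cutNorm_congr {D D' : ℝ → ℝ → ℝ} (h : ∀ x ∈ I01, ∀ y ∈ I01, D x y = D' x y) :
    cutNorm D = cutNorm D' := by
  unfold cutNorm
  congr 1
  ext r
  constructor
  all_goals
    rintro ⟨S, T, hS, hT, hSI, hTI, rfl⟩
    refine ⟨S, T, hS, hT, hSI, hTI, ?_⟩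
    congr 1
    refine setIntegral_congr_fun hS fun x hx => ?_
    refine setIntegral_congr_fun hT fun y hy => ?_
    simp [h x (hSI hx) y (hTI hy)]

lemma l1Norm_congr {D D' : ℝ → ℝ → ℝ} (h : ∀ x ∈ I01, ∀ y ∈ I01, D x y = D' x y) :
    l1Norm D = l1Norm D' := by
  unfold l1Norm
  refine setIntegral_congr_fun measI01 fun x hx => ?_
  refine setIntegral_congr_fun measI01 fun y hy => ?_
  simp [h x hx y hy]

lemma cutNorm_comp_le {D : ℝ → ℝ → ℝ} (h : BK D) (φ : InvMP) :
    cutNorm (fun x y => D (φ.toFun x) (φ.toFun y)) ≤ cutNorm D := by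
  refine cutNorm_le (h.comp φ.meas) fun S T hS hT => ?_
  have hS' := φ.measInv hS
  have hT' := φ.measInv hT
  refine le_trans (le_of_eq ?_) (le_cutNorm h hS' hT')
  congr 1
  rw [← integral_indicator (hS.prod hT), ← integral_indicator (hS'.prod hT'),
    ← integral_comp_mp φ.mp2 (h.meas.indicator (hS'.prod hT'))]
  refine integral_congr_ae ?_
  have hae : ∀ᵐ p ∂mu2, p.1 ∈ I01 ∧ p.2 ∈ I01 := by
    have : ∀ᵐ p ∂(mu1.prod mu1), p ∈ I01 ×ˢ I01 := by
      rw [mu1, Measure.prod_restrict]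
      exact ae_restrict_mem (measI01.prod measI01)
    exact this
  filter_upwards [hae] with p hp
  have key : ((φ.toFun p.1, φ.toFun p.2) ∈ (φ.invFun ⁻¹' S) ×ˢ (φ.invFun ⁻¹' T)) ↔ p ∈ S ×ˢ T := by
    rw [Set.mem_prod, Set.mem_prod, Set.mem_preimage, Set.mem_preimage, φ.leftInv _ hp.1,
      φ.leftInv _ hp.2]
  by_cases hpS : p ∈ S ×ˢ T
  · rw [Set.indicator_of_mem hpS, Set.indicator_of_mem (key.2 hpS)]
  · rw [Set.indicator_of_notMem hpS, Set.indicator_of_notMem (mt key.1 hpS)]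

lemma cutNorm_comp {D : ℝ → ℝ → ℝ} (h : BK D) (φ : InvMP) :
    cutNorm (fun x y => D (φ.toFun x) (φ.toFun y)) = cutNorm D := by
  refine le_antisymm (cutNorm_comp_le h φ) ?_
  refine le_trans (le_of_eq ?_) (cutNorm_comp_le (h.comp φ.meas) φ.symm)
  refine cutNorm_congr fun x hx y hy => ?_
  simp only [InvMP.symm, φ.rightInv x hx, φ.rightInv y hy]

lemma deltaCut_le {U W : ℝ → ℝ → ℝ} (hU : BK U) (hW : BK W) (φ : InvMP) :
    deltaCut U W ≤ cutNorm (fun x y => U x y - W (φ.toFun x) (φ.toFun y)) := by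
  refine ciInf_le ⟨0, ?_⟩ φ
  rintro r ⟨ψ, rfl⟩
  exact cutNorm_nonneg (hU.sub (hW.comp ψ.meas))

lemma deltaCut_nonneg {U W : ℝ → ℝ → ℝ} (hU : BK U) (hW : BK W) : 0 ≤ deltaCut U W :=
  Real.iInf_nonneg fun ψ => cutNorm_nonneg (hU.sub (hW.comp ψ.meas))

lemma exists_of_deltaCut_lt {U W : ℝ → ℝ → ℝ} {c : ℝ} (h : deltaCut U W < c) :
    ∃ φ : InvMP, cutNorm (fun x y => U x y - W (φ.toFun x) (φ.toFun y)) < c := by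
  have : Nonempty InvMP := ⟨InvMP.id⟩
  exact exists_lt_of_ciInf_lt h

lemma extremal_set {μ : Measure ℝ} [IsFiniteMeasure μ] {h f : ℝ → ℝ} (hm : Measurable h)
    (hi : Integrable h μ) (hf : Measurable f) (h01 : ∀ x, f x ∈ Set.Icc (0 : ℝ) 1) :
    ∃ S : Set ℝ, MeasurableSet S ∧ |∫ x, h x * f x ∂μ| ≤ |∫ x, h x * S.indicator 1 x ∂μ| := by
  have hfi : Integrable (fun x => h x * f x) μ := by
    refine hi.mul_bdd (c := 1) hf.aestronglyMeasurable (ae_of_all _ fun x => ?_)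
    rw [Real.norm_eq_abs, abs_of_nonneg (h01 x).1]; exact (h01 x).2
  have hS : ∀ S : Set ℝ, MeasurableSet S → Integrable (fun x => h x * S.indicator 1 x) μ := by
    intro S hS
    refine hi.mul_bdd (c := 1) (measurable_one.indicator hS).aestronglyMeasurable
      (ae_of_all _ fun x => ?_)
    by_cases hx : x ∈ S <;> simp [hx]
  have mp : MeasurableSet {x | 0 < h x} := measurableSet_lt measurable_const hm
  have mn : MeasurableSet {x | h x ≤ 0} := measurableSet_le hm measurable_const
  rcases le_total 0 (∫ x, h x * f x ∂μ) with h0 | h0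
  · refine ⟨_, mp, ?_⟩
    rw [abs_of_nonneg h0]
    refine le_trans ?_ (le_abs_self _)
    refine integral_mono hfi (hS _ mp) fun x => ?_
    have := h01 x
    by_cases hx : 0 < h x
    · have hx' : x ∈ {x | 0 < h x} := hx
      simp only [Set.indicator_of_mem hx', Pi.one_apply]
      nlinarith [this.2]
    · have hx' : x ∉ {x | 0 < h x} := hx
      simp only [Set.indicator_of_notMem hx']
      nlinarith [this.1]
  · refine ⟨_, mn, ?_⟩
    rw [abs_of_nonpos h0]
    refine le_trans ?_ (neg_le_abs _)
    rw [neg_le_neg_iff]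
    refine integral_mono (hS _ mn) hfi fun x => ?_
    have := h01 x
    by_cases hx : h x ≤ 0
    · have hx' : x ∈ {x | h x ≤ 0} := hx
      simp only [Set.indicator_of_mem hx', Pi.one_apply]
      nlinarith [this.2]
    · have hx' : x ∉ {x | h x ≤ 0} := hx
      simp only [Set.indicator_of_notMem hx']
      have : 0 < h x := not_le.1 hx
      nlinarith [(h01 x).1]

lemma cut_left {D : ℝ → ℝ → ℝ} (hD : BK D) {f g : ℝ → ℝ} (hf : Measurable f) (hg : Measurable g)
    (hf1 : ∀ x, f x ∈ Set.Icc (0 : ℝ) 1) (hg1 : ∀ x, g x ∈ Set.Icc (0 : ℝ) 1) :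
    ∃ S : Set ℝ, MeasurableSet S ∧ |∫ p, D p.1 p.2 * (f p.1 * g p.2) ∂mu2| ≤
      |∫ p, D p.1 p.2 * (S.indicator 1 p.1 * g p.2) ∂mu2| := by
  obtain ⟨mD, C, hC⟩ := hD
  have mD' : Measurable fun p : ℝ × ℝ => D p.1 p.2 := mD
  have C0 : 0 ≤ C := (abs_nonneg _).trans (hC 0 0)
  have mG : Measurable (fun p : ℝ × ℝ => D p.1 p.2 * g p.2) := by fun_prop
  have bG : ∀ p : ℝ × ℝ, |D p.1 p.2 * g p.2| ≤ C := fun p => by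
    rw [abs_mul, abs_of_nonneg (hg1 p.2).1]
    have := hC p.1 p.2
    have := hg1 p.2
    nlinarith [abs_nonneg (D p.1 p.2), this.1, this.2]
  let h : ℝ → ℝ := fun u => ∫ v, D u v * g v ∂mu1
  have mh : Measurable h := (mG.stronglyMeasurable.integral_prod_right (ν := mu1)).measurable
  have bh : ∀ u, |h u| ≤ C := by
    intro u
    have := norm_integral_le_of_norm_le_const (μ := mu1) (f := fun v => D u v * g v) (C := C)
      (ae_of_all _ fun v => bG (u, v))
    simpa using this
  obtain ⟨S, hS, hle⟩ := extremal_set (μ := mu1) mh (integrable_of_bdd mh bh) hf hf1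
  have key : ∀ f : ℝ → ℝ, Measurable f → (∀ x, f x ∈ Set.Icc (0 : ℝ) 1) →
      ∫ p, D p.1 p.2 * (f p.1 * g p.2) ∂mu2 = ∫ u, h u * f u ∂mu1 := by
    intro f hf hf1
    rw [mu2, integral_prod]
    · refine integral_congr_ae (ae_of_all _ fun u => ?_)
      simp only [h]
      rw [← integral_mul_const]
      refine integral_congr_ae (ae_of_all _ fun v => ?_)
      simp only
      ring
    · refine integrable_of_bdd (C := C) (by fun_prop) fun p => ?_
      rw [show D p.1 p.2 * (f p.1 * g p.2) = (D p.1 p.2 * g p.2) * f p.1 by ring, abs_mul,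
        abs_of_nonneg (hf1 p.1).1]
      nlinarith [bG p, (hf1 p.1).1, (hf1 p.1).2, abs_nonneg (D p.1 p.2 * g p.2)]
  refine ⟨S, hS, ?_⟩
  rw [key f hf hf1, key _ (measurable_one.indicator hS)]
  · exact hle
  · intro x
    by_cases hx : x ∈ S <;> simp [hx]

lemma BK.swap {D : ℝ → ℝ → ℝ} (hD : BK D) : BK fun x y => D y x := by
  obtain ⟨mD, C, hC⟩ := hD
  exact ⟨mD.comp measurable_swap, C, fun x y => hC y x⟩

lemma integral_swap (f : ℝ × ℝ → ℝ) : ∫ p, f (p.2, p.1) ∂mu2 = ∫ p, f p ∂mu2 :=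
  integral_prod_swap (μ := mu1) (ν := mu1) f

lemma cut_fun {D : ℝ → ℝ → ℝ} (hD : BK D) {f g : ℝ → ℝ} (hf : Measurable f) (hg : Measurable g)
    (hf1 : ∀ x, f x ∈ Set.Icc (0 : ℝ) 1) (hg1 : ∀ x, g x ∈ Set.Icc (0 : ℝ) 1) :
    |∫ p, D p.1 p.2 * (f p.1 * g p.2) ∂mu2| ≤ cutNorm D := by
  obtain ⟨S, hS, h1⟩ := cut_left hD hf hg hf1 hg1
  have ind01 : ∀ S : Set ℝ, ∀ x, S.indicator (1 : ℝ → ℝ) x ∈ Set.Icc (0 : ℝ) 1 := by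
    intro S x
    by_cases hx : x ∈ S <;> simp [hx]
  obtain ⟨T, hT, h2⟩ := cut_left hD.swap hg (measurable_one.indicator hS) hg1 (ind01 S)
  refine h1.trans ?_
  rw [← integral_swap]
  have e : ∀ p : ℝ × ℝ, D p.2 p.1 * (S.indicator 1 p.2 * g p.1)
      = D p.2 p.1 * (g p.1 * S.indicator 1 p.2) := fun p => by ring
  simp only [e]
  refine h2.trans ?_
  refine le_trans (le_of_eq ?_) (le_cutNorm hD hS hT)
  rw [← integral_swap, ← integral_indicator (hS.prod hT)]
  congr 1
  refine integral_congr_ae (ae_of_all _ fun p => ?_)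
  by_cases h1 : p.1 ∈ S <;> by_cases h2 : p.2 ∈ T <;> simp [h1, h2, Set.indicator, Set.mem_prod]

def muk (ι : Type*) [Fintype ι] : Measure (ι → ℝ) := Measure.pi fun _ => mu1

instance instProbMuk (ι : Type*) [Fintype ι] : IsProbabilityMeasure (muk ι) := by
  unfold muk; infer_instance

lemma restrict_cube (k : ℕ) : (volume : Measure (Fin k → ℝ)).restrict (cube k) = muk (Fin k) := by
  rw [cube, volume_pi, Measure.restrict_pi_pi]; rfl

lemma mp_update {ι : Type*} [Fintype ι] [DecidableEq ι] (i : ι) :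
    MeasurePreserving (fun p : (ι → ℝ) × ℝ => Function.update p.1 i p.2)
      ((muk ι).prod mu1) (muk ι) := by
  have hm : Measurable (fun p : (ι → ℝ) × ℝ => Function.update p.1 i p.2) := by
    refine measurable_pi_iff.2 fun j => ?_
    by_cases hj : j = i
    · subst hj; simpa using measurable_snd
    · simp only [Function.update_of_ne hj]
      exact (measurable_pi_apply j).comp measurable_fst
  refine ⟨hm, ?_⟩
  symm
  refine Measure.pi_eq fun s hs => ?_
  rw [Measure.map_apply hm (MeasurableSet.univ_pi hs)]
  have : (fun p : (ι → ℝ) × ℝ => Function.update p.1 i p.2) ⁻¹' (Set.univ.pi s)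
      = (Set.univ.pi (Function.update s i Set.univ)) ×ˢ (s i) := by
    ext p
    simp only [Set.mem_preimage, Set.mem_pi, Set.mem_univ, true_implies, Set.mem_prod]
    constructor
    · intro h
      refine ⟨fun j => ?_, by simpa using h i⟩
      by_cases hj : j = i
      · subst hj; simp
      · simpa [hj] using h j
    · rintro ⟨h, h'⟩ j
      by_cases hj : j = i
      · subst hj; simpa using h'
      · simpa [hj] using h j
  rw [this, Measure.prod_prod, muk, Measure.pi_pi]
  rw [← Finset.prod_erase_mul _ _ (Finset.mem_univ i), ← Finset.prod_erase_mul (a := i) Finset.univ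
    (fun j => mu1 (s j)) (Finset.mem_univ i)]
  simp only [Function.update_self, measure_univ, mul_one]
  congr 1
  refine Finset.prod_congr rfl fun j hj => ?_
  rw [Function.update_of_ne (Finset.ne_of_mem_erase hj)]

lemma integral_two {ι : Type*} [Fintype ι] [DecidableEq ι] (i j : ι) {h : (ι → ℝ) → ℝ}
    (hm : Measurable h) {C : ℝ} (hC : ∀ x, |h x| ≤ C) :
    ∫ x, h x ∂(muk ι) = ∫ x, ∫ p, h (Function.update (Function.update x i p.1) j p.2)
      ∂mu2 ∂(muk ι) := by
  have e : MeasurePreserving (fun q : (ι → ℝ) × (ℝ × ℝ) =>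
      Function.update (Function.update q.1 i q.2.1) j q.2.2) ((muk ι).prod mu2) (muk ι) := by
    have h1 := (mp_update (ι := ι) i).prod (MeasurePreserving.id mu1)
    have h2 := (mp_update (ι := ι) j).comp h1
    have h3 : MeasurePreserving (MeasurableEquiv.prodAssoc : ((ι → ℝ) × ℝ) × ℝ ≃ᵐ _).symm
      ((muk ι).prod mu2) (((muk ι).prod mu1).prod mu1) :=
      (measurePreserving_prodAssoc (muk ι) mu1 mu1).symm
    exact h2.comp h3
  rw [← integral_comp_mp e hm, integral_prod]
  exact integrable_of_bdd (hm.comp e.measurable) fun _ => hC _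

/-- The key hybrid estimate. -/
lemma hybrid {ι : Type*} [Fintype ι] [DecidableEq ι] {i j : ι} (hij : i ≠ j) {D : ℝ → ℝ → ℝ}
    (hD : BK D) {f g : (ι → ℝ) → ℝ} (hf : Measurable f) (hg : Measurable g)
    (hf1 : ∀ x, f x ∈ Set.Icc (0 : ℝ) 1) (hg1 : ∀ x, g x ∈ Set.Icc (0 : ℝ) 1)
    (hfj : ∀ x v, f (Function.update x j v) = f x) (hgi : ∀ x v, g (Function.update x i v) = g x) :
    |∫ x, D (x i) (x j) * (f x * g x) ∂(muk ι)| ≤ cutNorm D := by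
  have hD' := hD
  obtain ⟨mD, C, hC⟩ := hD
  have mD' : Measurable fun p : ℝ × ℝ => D p.1 p.2 := mD
  have mF : Measurable fun x : ι → ℝ => D (x i) (x j) * (f x * g x) := by
    have : Measurable fun x : ι → ℝ => D (x i) (x j) :=
      mD'.comp (by fun_prop : Measurable fun x : ι → ℝ => (x i, x j))
    fun_prop
  have bF : ∀ x : ι → ℝ, |D (x i) (x j) * (f x * g x)| ≤ C := fun x => by
    rw [abs_mul, abs_mul, abs_of_nonneg (hf1 x).1, abs_of_nonneg (hg1 x).1]
    have h1 : f x * g x ≤ 1 := mul_le_one₀ (hf1 x).2 (hg1 x).1 (hg1 x).2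
    have h0 : 0 ≤ f x * g x := mul_nonneg (hf1 x).1 (hg1 x).1
    nlinarith [hC (x i) (x j), abs_nonneg (D (x i) (x j))]
  rw [integral_two i j mF bF]
  have hin : ∀ x : ι → ℝ, |∫ p : ℝ × ℝ, D ((Function.update (Function.update x i p.1) j p.2) i)
      ((Function.update (Function.update x i p.1) j p.2) j) *
      (f (Function.update (Function.update x i p.1) j p.2) *
        g (Function.update (Function.update x i p.1) j p.2)) ∂mu2| ≤ cutNorm D := by
    intro x
    have := cut_fun hD' (f := fun u => f (Function.update x i u))
      (g := fun v => g (Function.update x j v)) (hf.comp (measurable_update x))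
      (hg.comp (measurable_update x)) (fun _ => hf1 _) (fun _ => hg1 _)
    refine le_trans (le_of_eq ?_) this
    congr 1
    refine integral_congr_ae (ae_of_all _ fun p => ?_)
    simp only [Function.update_self]
    rw [hfj, Function.update_of_ne hij, Function.update_self, Function.update_comm hij, hgi]
  simp only [← Real.norm_eq_abs] at hin
  have := norm_integral_le_of_norm_le_const (μ := muk ι) (ae_of_all _ hin)
  simpa using this

lemma prod_mem01 {α : Type*} (s : Finset α) {f : α → ℝ} (h : ∀ a ∈ s, f a ∈ Set.Icc (0 : ℝ) 1) :
    ∏ a ∈ s, f a ∈ Set.Icc (0 : ℝ) 1 :=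
  ⟨Finset.prod_nonneg fun a ha => (h a ha).1,
    Finset.prod_le_one (fun a ha => (h a ha).1) fun a ha => (h a ha).2⟩

/-- `e` ranges over pairs; product over a set of distinct pairs `i < j`. -/
lemma counting {k : ℕ} (E : Finset (Fin k × Fin k)) (hE : ∀ e ∈ E, e.1 < e.2)
    (a b : Fin k × Fin k → ℝ → ℝ → ℝ) (ha : ∀ e, IsGraphon (a e)) (hb : ∀ e, IsGraphon (b e)) :
    ∀ A : Finset (Fin k × Fin k), A ⊆ E →
    |(∫ x, ∏ e ∈ E, (if e ∈ A then a e else b e) (x e.1) (x e.2) ∂(muk (Fin k)))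
      - ∫ x, ∏ e ∈ E, b e (x e.1) (x e.2) ∂(muk (Fin k))| ≤
      ∑ e ∈ A, cutNorm (fun x y => a e x y - b e x y) := by
  classical
  intro A
  induction A using Finset.induction_on with
  | empty => intro _; simp
  | insert e A heA ih =>
    intro hA
    have heE : e ∈ E := hA (Finset.mem_insert_self _ _)
    have ih' := ih ((Finset.subset_insert _ _).trans hA)
    rw [Finset.sum_insert heA]
    set c : Fin k × Fin k → ℝ → ℝ → ℝ := fun e' => if e' ∈ A then a e' else b e' with hc
    have hcg : ∀ e', IsGraphon (c e') := by
      intro e'; simp only [hc]; split_ifs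
      exacts [ha e', hb e']
    have mc : ∀ e', Measurable fun x : Fin k → ℝ => c e' (x e'.1) (x e'.2) := fun e' =>
      (hcg e').1.comp (by fun_prop : Measurable fun x : Fin k → ℝ => (x e'.1, x e'.2))
    have ma : Measurable fun x : Fin k → ℝ => a e (x e.1) (x e.2) :=
      (ha e).1.comp (by fun_prop : Measurable fun x : Fin k → ℝ => (x e.1, x e.2))
    have mb : Measurable fun x : Fin k → ℝ => b e (x e.1) (x e.2) :=
      (hb e).1.comp (by fun_prop : Measurable fun x : Fin k → ℝ => (x e.1, x e.2))
    have hne : e.1 ≠ e.2 := (hE e heE).ne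
    set f : (Fin k → ℝ) → ℝ := fun x =>
      ∏ e' ∈ (E.erase e).filter (fun e' => e'.1 ≠ e.2 ∧ e'.2 ≠ e.2), c e' (x e'.1) (x e'.2) with hf
    set g : (Fin k → ℝ) → ℝ := fun x =>
      ∏ e' ∈ (E.erase e).filter (fun e' => ¬ (e'.1 ≠ e.2 ∧ e'.2 ≠ e.2)), c e' (x e'.1) (x e'.2)
      with hg
    have hprod : ∀ x, f x * g x = ∏ e' ∈ E.erase e, c e' (x e'.1) (x e'.2) := fun x =>
      Finset.prod_filter_mul_prod_filter_not _ _ _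
    have hstep := hybrid (ι := Fin k) (i := e.1) (j := e.2) hne ((ha e).bk.sub (hb e).bk)
      (f := f) (g := g) (Finset.measurable_prod _ fun e' _ => mc e')
      (Finset.measurable_prod _ fun e' _ => mc e')
      (fun x => prod_mem01 _ fun e' _ => (hcg e').2.2 _ _)
      (fun x => prod_mem01 _ fun e' _ => (hcg e').2.2 _ _)
      (fun x v => by
        refine Finset.prod_congr rfl fun e' he' => ?_
        have := (Finset.mem_filter.1 he').2
        rw [Function.update_of_ne this.1, Function.update_of_ne this.2])
      (fun x v => by
        refine Finset.prod_congr rfl fun e' he' => ?_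
        obtain ⟨h1, h2⟩ := Finset.mem_filter.1 he'
        have h3 := hE e' (Finset.mem_of_mem_erase h1)
        have h4 := hE e heE
        have h5 := Finset.ne_of_mem_erase h1
        have h6 : e'.1 ≠ e.1 ∧ e'.2 ≠ e.1 := by
          rw [Ne, Prod.ext_iff] at h5
          constructor <;> intro h <;> (rw [not_and_or, not_not, not_not] at h2) <;> grind
        rw [Function.update_of_ne h6.1, Function.update_of_ne h6.2])
    have E1 : ∀ x : Fin k → ℝ, ∏ e' ∈ E, (if e' ∈ insert e A then a e' else b e') (x e'.1) (x e'.2)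
        = a e (x e.1) (x e.2) * (f x * g x) := by
      intro x
      rw [hprod, ← Finset.mul_prod_erase _ _ heE]
      simp only [Finset.mem_insert_self, if_true]
      congr 1
      refine Finset.prod_congr rfl fun e' he' => ?_
      simp [hc, Finset.mem_insert, Finset.ne_of_mem_erase he']
    have E2 : ∀ x : Fin k → ℝ, ∏ e' ∈ E, c e' (x e'.1) (x e'.2)
        = b e (x e.1) (x e.2) * (f x * g x) := by
      intro x
      rw [hprod, ← Finset.mul_prod_erase _ _ heE]
      simp [hc, heA]
    have mfg : Measurable fun x => f x * g x := by
      simp only [hprod]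
      exact Finset.measurable_prod _ fun e' _ => mc e'
    have bfg : ∀ x, f x * g x ∈ Set.Icc (0 : ℝ) 1 := fun x => by
      rw [hprod]; exact prod_mem01 _ fun e' _ => (hcg e').2.2 _ _
    have bd : ∀ u : ℝ, ∀ x, u ∈ Set.Icc (0 : ℝ) 1 → |u * (f x * g x)| ≤ 1 := by
      intro u x hu
      have := bfg x
      rw [abs_of_nonneg (mul_nonneg hu.1 this.1)]
      exact mul_le_one₀ hu.2 this.1 this.2
    have I1 : Integrable (fun x => a e (x e.1) (x e.2) * (f x * g x)) (muk (Fin k)) :=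
      integrable_of_bdd (ma.mul mfg) fun x => bd _ x ((ha e).2.2 _ _)
    have I2 : Integrable (fun x => b e (x e.1) (x e.2) * (f x * g x)) (muk (Fin k)) :=
      integrable_of_bdd (mb.mul mfg) fun x => bd _ x ((hb e).2.2 _ _)
    simp only [E1]
    have ih2 : |(∫ x, b e (x e.1) (x e.2) * (f x * g x) ∂(muk (Fin k)))
      - ∫ x, ∏ e ∈ E, b e (x e.1) (x e.2) ∂(muk (Fin k))| ≤
      ∑ e ∈ A, cutNorm (fun x y => a e x y - b e x y) := by
      simp only [← E2]; exact ih'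
    simp only [sub_mul] at hstep
    rw [integral_sub I1 I2] at hstep
    refine (abs_sub_le _ (∫ x, b e (x e.1) (x e.2) * (f x * g x) ∂(muk (Fin k))) _).trans ?_
    exact add_le_add hstep ih2

lemma IsGraphon.compl {W : ℝ → ℝ → ℝ} (h : IsGraphon W) : IsGraphon fun x y => 1 - W x y :=
  ⟨measurable_const.sub h.1, fun x y => by simp only [h.2.1 x y], fun x y => by
    have := h.2.2 x y
    exact ⟨by linarith [this.2], by linarith [this.1]⟩⟩

lemma IsGraphon.comp {W : ℝ → ℝ → ℝ} (h : IsGraphon W) {f : ℝ → ℝ} (hf : Measurable f) :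
    IsGraphon fun x y => W (f x) (f y) :=
  ⟨(h.bk.comp hf).1, fun _ _ => h.2.1 _ _, fun _ _ => h.2.2 _ _⟩

def pairsF (k : ℕ) : Finset (Fin k × Fin k) := Finset.univ.filter fun e => e.1 < e.2

open Classical in
def edgeKer {k : ℕ} (F : SimpleGraph (Fin k)) (W : ℝ → ℝ → ℝ) (e : Fin k × Fin k) : ℝ → ℝ → ℝ :=
  if F.Adj e.1 e.2 then W else fun x y => 1 - W x y

lemma edgeKer_graphon {k : ℕ} (F : SimpleGraph (Fin k)) {W : ℝ → ℝ → ℝ} (h : IsGraphon W) (e) :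
    IsGraphon (edgeKer F W e) := by
  unfold edgeKer
  split_ifs
  exacts [h, h.compl]

lemma indDensity_eq {k : ℕ} (F : SimpleGraph (Fin k)) (W : ℝ → ℝ → ℝ) :
    indDensity F W = ∫ x, ∏ e ∈ pairsF k, edgeKer F W e (x e.1) (x e.2) ∂(muk (Fin k)) := by
  classical
  unfold indDensity
  rw [restrict_cube]
  refine integral_congr_ae (ae_of_all _ fun x => ?_)
  simp only
  rw [pairsF, Finset.prod_filter, Fintype.prod_prod_type]
  refine Finset.prod_congr rfl fun i _ => Finset.prod_congr rfl fun j _ => ?_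
  simp only [edgeKer]
  split_ifs <;> rfl

lemma indDensity_lip {k : ℕ} (F : SimpleGraph (Fin k)) {U W : ℝ → ℝ → ℝ} (hU : IsGraphon U)
    (hW : IsGraphon W) :
    |indDensity F U - indDensity F W| ≤ (k : ℝ) ^ 2 * cutNorm (fun x y => U x y - W x y) := by
  classical
  have h := counting (pairsF k) (fun e he => (Finset.mem_filter.1 he).2) (edgeKer F U)
    (edgeKer F W) (edgeKer_graphon F hU) (edgeKer_graphon F hW) (pairsF k) subset_rfl
  have e1 : ∀ x : Fin k → ℝ, ∏ e ∈ pairsF k, (if e ∈ pairsF k then edgeKer F U e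
      else edgeKer F W e) (x e.1) (x e.2) = ∏ e ∈ pairsF k, edgeKer F U e (x e.1) (x e.2) :=
    fun x => Finset.prod_congr rfl fun e he => by rw [if_pos he]
  simp only [e1] at h
  rw [indDensity_eq, indDensity_eq]
  refine h.trans ?_
  have e2 : ∀ e, cutNorm (fun x y => edgeKer F U e x y - edgeKer F W e x y)
      = cutNorm (fun x y => U x y - W x y) := by
    intro e
    unfold edgeKer
    split_ifs
    · rfl
    · rw [cutNorm_sub_comm U W]
      congr 1
      funext x y
      ring
  simp only [e2, Finset.sum_const, nsmul_eq_mul]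
  refine mul_le_mul_of_nonneg_right ?_ (cutNorm_nonneg (hU.bk.sub hW.bk))
  have : (pairsF k).card ≤ k ^ 2 := by
    refine (Finset.card_le_univ _).trans ?_
    simp [sq]
  exact_mod_cast this

def Clip (k : ℕ) : ℝ := (Fintype.card (SimpleGraph (Fin k)) : ℝ) * (k : ℝ) ^ 2 + 1

lemma Clip_pos (k : ℕ) : 0 < Clip k := by unfold Clip; positivity

lemma probIn_lip (k : ℕ) (R : GraphProp) {U W : ℝ → ℝ → ℝ} (hU : IsGraphon U)
    (hW : IsGraphon W) :
    |probIn k U R - probIn k W R| ≤ Clip k * cutNorm (fun x y => U x y - W x y) := by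
  classical
  have c0 := cutNorm_nonneg (hU.bk.sub hW.bk)
  unfold probIn
  rw [← Finset.sum_sub_distrib]
  refine (Finset.abs_sum_le_sum_abs _ _).trans ?_
  have : ∀ F ∈ (Finset.univ : Finset (SimpleGraph (Fin k))),
      |(if F ∈ R k then indDensity F U else 0) - (if F ∈ R k then indDensity F W else 0)| ≤
      (k : ℝ) ^ 2 * cutNorm (fun x y => U x y - W x y) := by
    intro F _
    split_ifs
    · exact indDensity_lip F hU hW
    · simp only [sub_self, abs_zero]; positivity
  refine (Finset.sum_le_sum this).trans ?_
  rw [Finset.sum_const, nsmul_eq_mul, Finset.card_univ]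
  have e : Fintype.card (SimpleGraph (Fin k)) = Fintype.card (SimpleGraph (Fin k)) := rfl
  unfold Clip
  nlinarith [c0]

lemma indDensity_comp {k : ℕ} (F : SimpleGraph (Fin k)) {W : ℝ → ℝ → ℝ} (hW : IsGraphon W)
    (φ : InvMP) : indDensity F (fun x y => W (φ.toFun x) (φ.toFun y)) = indDensity F W := by
  rw [indDensity_eq, indDensity_eq]
  have mp : MeasurePreserving (fun x : Fin k → ℝ => fun i => φ.toFun (x i)) (muk (Fin k))
      (muk (Fin k)) := measurePreserving_pi _ _ fun _ => φ.mp
  have mm : Measurable fun x : Fin k → ℝ => ∏ e ∈ pairsF k, edgeKer F W e (x e.1) (x e.2) :=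
    Finset.measurable_prod _ fun e _ => (edgeKer_graphon F hW e).1.comp
      (by fun_prop : Measurable fun x : Fin k → ℝ => (x e.1, x e.2))
  rw [← integral_comp_mp mp mm]
  refine integral_congr_ae (ae_of_all _ fun x => ?_)
  simp only
  refine Finset.prod_congr rfl fun e _ => ?_
  unfold edgeKer
  split_ifs <;> rfl

lemma probIn_comp (k : ℕ) (R : GraphProp) {W : ℝ → ℝ → ℝ} (hW : IsGraphon W)
    (φ : InvMP) : probIn k (fun x y => W (φ.toFun x) (φ.toFun y)) R = probIn k W R := by
  unfold probIn
  simp only [indDensity_comp _ hW φ]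

def J (n : ℕ) (i : Fin n) : Set ℝ := Set.Ioc (((i : ℕ) : ℝ) / n) ((((i : ℕ) : ℝ) + 1) / n)

lemma measJ (n : ℕ) (i : Fin n) : MeasurableSet (J n i) := measurableSet_Ioc

lemma J_inj {n : ℕ} {i j : Fin n} {x : ℝ} (hi : x ∈ J n i) (hj : x ∈ J n j) : i = j := by
  have hn : (0 : ℝ) < n := by exact_mod_cast (Nat.zero_le _).trans_lt i.2
  obtain ⟨h1, h2⟩ := hi
  obtain ⟨h3, h4⟩ := hj
  rw [div_lt_iff₀ hn] at h1 h3
  rw [le_div_iff₀ hn] at h2 h4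
  have a : ((i : ℕ) : ℝ) < (j : ℕ) + 1 := by linarith
  have b : ((j : ℕ) : ℝ) < (i : ℕ) + 1 := by linarith
  have a' : (i : ℕ) < (j : ℕ) + 1 := by exact_mod_cast a
  have b' : (j : ℕ) < (i : ℕ) + 1 := by exact_mod_cast b
  ext; omega

lemma J_subset (n : ℕ) (i : Fin n) : J n i ⊆ Set.Ioc 0 1 := by
  have hn : (0 : ℝ) < n := by exact_mod_cast (Nat.zero_le _).trans_lt i.2
  rintro x ⟨h1, h2⟩
  refine ⟨lt_of_le_of_lt (by positivity) h1, h2.trans ?_⟩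
  rw [div_le_one hn]
  exact_mod_cast i.2

lemma exists_J {n : ℕ} (hn : 0 < n) {x : ℝ} (hx : x ∈ Set.Ioc (0 : ℝ) 1) : ∃ i, x ∈ J n i := by
  have hn' : (0 : ℝ) < n := by exact_mod_cast hn
  have h0 : 0 < x * n := mul_pos hx.1 hn'
  have hc : 0 < ⌈x * n⌉₊ := Nat.ceil_pos.2 h0
  have hle : ⌈x * n⌉₊ ≤ n := Nat.ceil_le.2 (by nlinarith [hx.2])
  refine ⟨⟨⌈x * n⌉₊ - 1, by omega⟩, ?_⟩
  have e : (((⌈x * n⌉₊ - 1 : ℕ) : ℝ)) = (⌈x * n⌉₊ : ℝ) - 1 := by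
    rw [Nat.cast_sub hc]; simp
  constructor
  · simp only [e]
    rw [div_lt_iff₀ hn']
    have := Nat.ceil_lt_add_one h0.le
    linarith
  · simp only [e]
    rw [le_div_iff₀ hn']
    have := Nat.le_ceil (x * n)
    linarith

lemma iUnion_J {n : ℕ} (hn : 0 < n) : ⋃ i, J n i = Set.Ioc 0 1 := by
  refine Set.Subset.antisymm (Set.iUnion_subset (J_subset n)) fun x hx => ?_
  exact Set.mem_iUnion.2 (exists_J hn hx)

lemma mu1_eq_Ioc : mu1 = volume.restrict (Set.Ioc 0 1) :=
  (Measure.restrict_congr_set Ioc_ae_eq_Icc).symm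

lemma mu1_eq_sum {n : ℕ} (hn : 0 < n) :
    mu1 = Measure.sum fun i : Fin n => volume.restrict (J n i) := by
  rw [mu1_eq_Ioc, ← iUnion_J hn, Measure.restrict_iUnion]
  · intro i j hij
    rw [Function.onFun, Set.disjoint_left]
    exact fun x hi hj => hij (J_inj hi hj)
  · exact measJ n

lemma ae_exists_J {n : ℕ} (hn : 0 < n) : ∀ᵐ x ∂mu1, ∃ i, x ∈ J n i := by
  rw [mu1_eq_Ioc]
  filter_upwards [ae_restrict_mem measurableSet_Ioc] with x hx
  exact exists_J hn hx

lemma mu1_J {n : ℕ} (i : Fin n) : mu1.real (J n i) = 1 / n := by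
  have hn : (0 : ℝ) < n := by exact_mod_cast (Nat.zero_le _).trans_lt i.2
  rw [mu1_eq_Ioc, Measure.real, Measure.restrict_apply (measJ n i),
    Set.inter_eq_left.2 (J_subset n i), J, Real.volume_Ioc, ENNReal.toReal_ofReal]
  · ring
  · rw [← sub_div]; simp

def chi (n : ℕ) (i : Fin n) (x : ℝ) : ℝ := (J n i).indicator 1 x

lemma chi_meas (n : ℕ) (i : Fin n) : Measurable (chi n i) := measurable_one.indicator (measJ n i)

lemma chi_mem {n : ℕ} {i : Fin n} {x : ℝ} (h : x ∈ J n i) : chi n i x = 1 := by simp [chi, h]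

lemma chi_notMem {n : ℕ} {i : Fin n} {x : ℝ} (h : x ∉ J n i) : chi n i x = 0 := by simp [chi, h]

lemma chi_of_mem {n : ℕ} {i j : Fin n} {x : ℝ} (h : x ∈ J n i) :
    chi n j x = if j = i then 1 else 0 := by
  split_ifs with hj
  · rw [hj]; exact chi_mem h
  · exact chi_notMem fun h' => hj (J_inj h' h)

lemma chi_01 (n : ℕ) (i : Fin n) (x : ℝ) : chi n i x ∈ Set.Icc (0 : ℝ) 1 := by
  by_cases h : x ∈ J n i
  · simp [chi_mem h]
  · simp [chi_notMem h]

lemma integral_chi {n : ℕ} (i : Fin n) : ∫ x, chi n i x ∂mu1 = 1 / n := by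
  unfold chi
  rw [integral_indicator_one (measJ n i), mu1_J]

def step1 (n : ℕ) (a : Fin n → ℝ) (x : ℝ) : ℝ := ∑ v, a v * chi n v x

lemma step1_meas (n : ℕ) (a : Fin n → ℝ) : Measurable (step1 n a) := by
  unfold step1
  exact Finset.measurable_fun_sum _ fun v _ => (chi_meas n v).const_mul _

lemma step1_mem {n : ℕ} (a : Fin n → ℝ) {i : Fin n} {x : ℝ} (h : x ∈ J n i) :
    step1 n a x = a i := by
  simp [step1, chi_of_mem h]

lemma step1_notMem {n : ℕ} (a : Fin n → ℝ) {x : ℝ} (h : ∀ i, x ∉ J n i) :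
    step1 n a x = 0 := by
  simp [step1, chi_notMem (h _)]

def stepK (n : ℕ) (D : Fin n → Fin n → ℝ) (x y : ℝ) : ℝ :=
  ∑ i, ∑ j, D i j * (chi n i x * chi n j y)

lemma stepK_meas (n : ℕ) (D : Fin n → Fin n → ℝ) : Measurable (Function.uncurry (stepK n D)) := by
  have : ∀ i, Measurable (chi n i) := chi_meas n
  unfold stepK Function.uncurry
  fun_prop

lemma stepK_mem {n : ℕ} (D : Fin n → Fin n → ℝ) {i j : Fin n} {x y : ℝ} (h : x ∈ J n i)
    (h' : y ∈ J n j) : stepK n D x y = D i j := by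
  unfold stepK
  simp [chi_of_mem h, chi_of_mem h']

lemma stepK_notMem {n : ℕ} (D : Fin n → Fin n → ℝ) {x y : ℝ}
    (h : (∀ i, x ∉ J n i) ∨ ∀ i, y ∉ J n i) : stepK n D x y = 0 := by
  unfold stepK
  rcases h with h | h <;> simp [chi_notMem (h _)]

lemma stepK_bk (n : ℕ) (D : Fin n → Fin n → ℝ) : BK (stepK n D) := by
  refine ⟨stepK_meas n D, ∑ i, ∑ j, |D i j|, fun x y => ?_⟩
  refine (Finset.abs_sum_le_sum_abs _ _).trans (Finset.sum_le_sum fun i _ => ?_)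
  refine (Finset.abs_sum_le_sum_abs _ _).trans (Finset.sum_le_sum fun j _ => ?_)
  rw [abs_mul]
  have h1 := chi_01 n i x
  have h2 := chi_01 n j y
  rw [abs_of_nonneg (mul_nonneg h1.1 h2.1)]
  exact mul_le_of_le_one_right (abs_nonneg _) (mul_le_one₀ h1.2 h2.1 h2.2)

lemma stepK_sub (n : ℕ) (D D' : Fin n → Fin n → ℝ) (x y : ℝ) :
    stepK n D x y - stepK n D' x y = stepK n (fun i j => D i j - D' i j) x y := by
  unfold stepK
  rw [← Finset.sum_sub_distrib]
  refine Finset.sum_congr rfl fun i _ => ?_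
  rw [← Finset.sum_sub_distrib]
  refine Finset.sum_congr rfl fun j _ => ?_
  ring

lemma integral_prod2 {f g : ℝ → ℝ} : ∫ p : ℝ × ℝ, f p.1 * g p.2 ∂mu2
    = (∫ x, f x ∂mu1) * ∫ y, g y ∂mu1 := integral_prod_mul f g

lemma setIntegral_stepK {n : ℕ} (D : Fin n → Fin n → ℝ) {S T : Set ℝ} (hS : MeasurableSet S)
    (hT : MeasurableSet T) : ∫ p in S ×ˢ T, stepK n D p.1 p.2 ∂mu2
      = ∑ i, ∑ j, D i j * ((∫ x in S, chi n i x ∂mu1) * ∫ y in T, chi n j y ∂mu1) := by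
  rw [mu2, ← Measure.prod_restrict]
  unfold stepK
  have hI : ∀ i j, Integrable (fun p : ℝ × ℝ => D i j * (chi n i p.1 * chi n j p.2))
      ((mu1.restrict S).prod (mu1.restrict T)) := fun i j => by
    have := chi_meas n
    refine integrable_of_bdd (C := |D i j|) (by fun_prop) fun p => ?_
    rw [abs_mul]
    have h1 := chi_01 n i p.1
    have h2 := chi_01 n j p.2
    rw [abs_of_nonneg (mul_nonneg h1.1 h2.1)]
    exact mul_le_of_le_one_right (abs_nonneg _) (mul_le_one₀ h1.2 h2.1 h2.2)
  rw [integral_finsetSum _ fun i _ => integrable_finsetSum _ fun j _ => hI i j]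
  refine Finset.sum_congr rfl fun i _ => ?_
  rw [integral_finsetSum _ fun j _ => hI i j]
  refine Finset.sum_congr rfl fun j _ => ?_
  rw [integral_const_mul, integral_prod_mul (chi n i) (chi n j)]

lemma setIntegral_chi_bound {n : ℕ} (i : Fin n) (S : Set ℝ) :
    n * ∫ x in S, chi n i x ∂mu1 ∈ Set.Icc (0 : ℝ) 1 := by
  have hn : (0 : ℝ) < n := by exact_mod_cast (Nat.zero_le _).trans_lt i.2
  constructor
  · exact mul_nonneg hn.le (integral_nonneg fun x => (chi_01 n i x).1)
  · have : ∫ x in S, chi n i x ∂mu1 ≤ ∫ x, chi n i x ∂mu1 :=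
      setIntegral_le_integral (integrable_of_bdd (chi_meas n i) (C := 1) fun x => by
        rw [abs_of_nonneg (chi_01 n i x).1]; exact (chi_01 n i x).2)
        (ae_of_all _ fun x => (chi_01 n i x).1)
    rw [integral_chi] at this
    calc _ ≤ n * (1 / n : ℝ) := by gcongr
      _ = 1 := by field_simp

lemma cutNorm_stepK_le {n : ℕ} (D : Fin n → Fin n → ℝ) {c : ℝ}
    (h : ∀ s t : Fin n → ℝ, (∀ i, s i ∈ Set.Icc (0 : ℝ) 1) → (∀ i, t i ∈ Set.Icc (0 : ℝ) 1) →
      |∑ i, ∑ j, D i j * (s i * t j)| ≤ c * n ^ 2) (hn : 0 < n) : cutNorm (stepK n D) ≤ c := by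
  refine cutNorm_le (stepK_bk n D) fun S T hS hT => ?_
  rw [setIntegral_stepK D hS hT]
  have hn' : (0 : ℝ) < n := by exact_mod_cast hn
  have := h _ _ (fun i => setIntegral_chi_bound i S) (fun i => setIntegral_chi_bound i T)
  have e : ∑ i, ∑ j, D i j * ((n * ∫ x in S, chi n i x ∂mu1) * (n * ∫ y in T, chi n j y ∂mu1))
      = n ^ 2 * ∑ i, ∑ j, D i j * ((∫ x in S, chi n i x ∂mu1) * ∫ y in T, chi n j y ∂mu1) := by
    rw [Finset.mul_sum]
    refine Finset.sum_congr rfl fun i _ => ?_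
    rw [Finset.mul_sum]
    refine Finset.sum_congr rfl fun j _ => ?_
    ring
  rw [e, abs_mul, abs_of_pos (by positivity), mul_comm] at this
  exact le_of_mul_le_mul_right this (by positivity)

lemma abs_stepK {n : ℕ} (D : Fin n → Fin n → ℝ) (x y : ℝ) :
    |stepK n D x y| = stepK n (fun i j => |D i j|) x y := by
  by_cases hx : ∃ i, x ∈ J n i
  · by_cases hy : ∃ j, y ∈ J n j
    · obtain ⟨i, hi⟩ := hx
      obtain ⟨j, hj⟩ := hy
      rw [stepK_mem _ hi hj, stepK_mem _ hi hj]
    · push Not at hy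
      rw [stepK_notMem _ (Or.inr hy), stepK_notMem _ (Or.inr hy), abs_zero]
  · push Not at hx
    rw [stepK_notMem _ (Or.inl hx), stepK_notMem _ (Or.inl hx), abs_zero]

lemma l1Norm_stepK {n : ℕ} (D : Fin n → Fin n → ℝ) :
    l1Norm (stepK n D) = (∑ i, ∑ j, |D i j|) / n ^ 2 := by
  rw [l1Norm_eq (stepK_bk n D)]
  simp only [abs_stepK]
  have := setIntegral_stepK (fun i j => |D i j|) MeasurableSet.univ MeasurableSet.univ
  rw [Set.univ_prod_univ, Measure.restrict_univ] at this
  rw [this]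
  simp only [Measure.restrict_univ, integral_chi]
  rw [Finset.sum_div]
  refine Finset.sum_congr rfl fun i _ => ?_
  rw [Finset.sum_div]
  refine Finset.sum_congr rfl fun j _ => ?_
  ring

open Classical in
def adj01 {n : ℕ} (G : SimpleGraph (Fin n)) (i j : Fin n) : ℝ := if G.Adj i j then 1 else 0

lemma graphonOf_eq {n : ℕ} (G : SimpleGraph (Fin n)) : graphonOf G = stepK n (adj01 G) := by
  classical
  funext x y
  unfold graphonOf
  by_cases hx : ∃ i, x ∈ J n i
  · by_cases hy : ∃ j, y ∈ J n j
    · obtain ⟨i, hi⟩ := hx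
      obtain ⟨j, hj⟩ := hy
      rw [stepK_mem _ hi hj, adj01]
      congr 1
      rw [eq_iff_iff]
      constructor
      · rintro ⟨i', j', h, hi', hj'⟩
        rwa [J_inj hi hi', J_inj hj hj']
      · intro h
        exact ⟨i, j, h, hi, hj⟩
    · rw [if_neg, stepK_notMem]
      · exact Or.inr (by push Not at hy; exact hy)
      · rintro ⟨i', j', h, hi', hj'⟩
        exact hy ⟨_, hj'⟩
  · rw [if_neg, stepK_notMem]
    · exact Or.inl (by push Not at hx; exact hx)
    · rintro ⟨i', j', h, hi', hj'⟩
      exact hx ⟨_, hi'⟩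

lemma graphonOf_graphon {n : ℕ} (G : SimpleGraph (Fin n)) : IsGraphon (graphonOf G) := by
  refine ⟨by rw [graphonOf_eq]; exact stepK_meas _ _, fun x y => ?_, fun x y => ?_⟩
  · unfold graphonOf
    congr 1
    rw [eq_iff_iff]
    constructor
    all_goals
      rintro ⟨i', j', h, hi', hj'⟩
      exact ⟨j', i', h.symm, hj', hi'⟩
  · unfold graphonOf
    split_ifs <;> simp

open Classical in
def avgF {n : ℕ} (G : SimpleGraph (Fin n)) (k : ℕ) (R : GraphProp) : ℝ :=
  (∑ g : Fin k → Fin n, if G.comap g ∈ R k then (1 : ℝ) else 0) / (n : ℝ) ^ k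

lemma indDensity_graphonOf {n : ℕ} (hn : 0 < n) (G : SimpleGraph (Fin n)) {k : ℕ}
    [DecidableEq (SimpleGraph (Fin k))] (F : SimpleGraph (Fin k)) :
    indDensity F (graphonOf G) =
      ∑ g : Fin k → Fin n, (if F = G.comap g then (1 : ℝ) else 0) / (n : ℝ) ^ k := by
  classical
  rw [indDensity_eq]
  have hae : ∀ᵐ x ∂(muk (Fin k)), ∃ g : Fin k → Fin n, ∀ i, x i ∈ J n (g i) := by
    have : ∀ᵐ x ∂(muk (Fin k)), ∀ i, ∃ v, x i ∈ J n v := by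
      rw [ae_all_iff]
      intro i
      exact (measurePreserving_eval (fun _ : Fin k => mu1) i).quasiMeasurePreserving.ae
        (ae_exists_J hn)
    filter_upwards [this] with x hx
    choose g hg using hx
    exact ⟨g, hg⟩
  have e : ∀ᵐ x ∂(muk (Fin k)), ∏ e ∈ pairsF k, edgeKer F (graphonOf G) e (x e.1) (x e.2)
      = ∑ g : Fin k → Fin n, (if F = G.comap g then (1 : ℝ) else 0) * ∏ i, chi n (g i) (x i) := by
    filter_upwards [hae] with x hx
    obtain ⟨g, hg⟩ := hx
    rw [Finset.sum_eq_single g]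
    · rw [Finset.prod_eq_one (fun i _ => chi_mem (hg i)), mul_one]
      have e1 : ∀ e : Fin k × Fin k, edgeKer F (graphonOf G) e (x e.1) (x e.2)
          = if (F.Adj e.1 e.2 ↔ G.Adj (g e.1) (g e.2)) then 1 else 0 := by
        intro e
        unfold edgeKer
        rw [graphonOf_eq]
        split_ifs with h1 h2 h2
        · rw [stepK_mem _ (hg _) (hg _), adj01, if_pos (h2.1 h1)]
        · rw [stepK_mem _ (hg _) (hg _), adj01, if_neg (fun h => h2 ⟨fun _ => h, fun _ => h1⟩)]
        · show 1 - stepK n (adj01 G) (x e.1) (x e.2) = _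
          rw [stepK_mem _ (hg _) (hg _), adj01, if_neg (fun h => h1 (h2.2 h)), sub_zero]
        · show 1 - stepK n (adj01 G) (x e.1) (x e.2) = _
          rw [stepK_mem _ (hg _) (hg _), adj01, if_pos, sub_self]
          by_contra h
          exact h2 ⟨fun h' => absurd h' h1, fun h' => absurd h' h⟩
      simp only [e1]
      split_ifs with hF
      · refine Finset.prod_eq_one fun e _ => ?_
        rw [if_pos]
        rw [hF]; rfl
      · have : ∃ i j, i < j ∧ ¬ (F.Adj i j ↔ G.Adj (g i) (g j)) := by
          by_contra hcon
          push Not at hcon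
          apply hF
          ext i j
          rcases lt_trichotomy i j with h | h | h
          · exact hcon i j h
          · subst h; simp
          · rw [F.adj_comm, hcon j i h, G.adj_comm]; rfl
        obtain ⟨i, j, hij, h⟩ := this
        refine Finset.prod_eq_zero (i := (i, j)) (by simp [pairsF, hij]) ?_
        rw [if_neg h]
    · intro g' _ hne
      obtain ⟨i, hi⟩ := Function.ne_iff.1 hne
      rw [Finset.prod_eq_zero (Finset.mem_univ i), mul_zero]
      exact chi_notMem fun h => hi (J_inj h (hg i))
    · intro h; exact absurd (Finset.mem_univ _) h
  rw [integral_congr_ae e]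
  have hm := chi_meas n
  rw [integral_finsetSum]
  · refine Finset.sum_congr rfl fun g _ => ?_
    rw [integral_const_mul, muk, integral_fintype_prod_eq_prod (fun i => chi n (g i))]
    simp only [integral_chi, Finset.prod_const, Finset.card_univ, Fintype.card_fin]
    rw [one_div, inv_pow, div_eq_mul_inv]
  · intro g _
    refine Integrable.const_mul ?_ _
    refine integrable_of_bdd (C := 1) (by fun_prop) fun x => ?_
    have := prod_mem01 Finset.univ (fun i _ => chi_01 n (g i) (x i))
    rw [abs_of_nonneg this.1]; exact this.2

lemma probIn_graphonOf {n : ℕ} (hn : 0 < n) (G : SimpleGraph (Fin n)) (k : ℕ) (R : GraphProp) :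
    probIn k (graphonOf G) R = avgF G k R := by
  classical
  unfold probIn avgF
  simp only [indDensity_graphonOf hn G]
  rw [Finset.sum_div]
  have : ∀ F : SimpleGraph (Fin k), (if F ∈ R k then
      ∑ g : Fin k → Fin n, (if F = G.comap g then (1 : ℝ) else 0) / (n : ℝ) ^ k else 0)
      = ∑ g : Fin k → Fin n, if F = G.comap g then
        ((if G.comap g ∈ R k then (1 : ℝ) else 0) / (n : ℝ) ^ k) else 0 := by
    intro F
    split_ifs with hF
    · refine Finset.sum_congr rfl fun g _ => ?_
      split_ifs with h1 h2 h2
      · rfl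
      · rw [← h1] at h2; exact absurd hF h2
      · simp
    · symm
      refine Finset.sum_eq_zero fun g _ => ?_
      split_ifs with h1 h2
      · rw [← h1] at h2; exact absurd h2 hF
      · simp
      · rfl
  simp only [this]
  rw [Finset.sum_comm]
  refine Finset.sum_congr rfl fun g _ => ?_
  simp

lemma avgF_comap {n : ℕ} (G : SimpleGraph (Fin n)) (k : ℕ) (R : GraphProp)
    (σ : Equiv.Perm (Fin n)) : avgF (G.comap σ) k R = avgF G k R := by
  classical
  unfold avgF
  congr 1
  refine Fintype.sum_equiv (Equiv.arrowCongr (Equiv.refl _) σ) _ _ fun g => ?_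
  simp only [SimpleGraph.comap_comap]
  rfl

lemma l1_graph_le {n : ℕ} (G H : SimpleGraph (Fin n)) :
    l1Norm (fun x y => graphonOf G x y - graphonOf H x y) ≤ 2 * graphD1 G H := by
  classical
  simp only [graphonOf_eq, stepK_sub]
  rw [show (fun x y => stepK n (fun i j => adj01 G i j - adj01 H i j) x y)
    = stepK n (fun i j => adj01 G i j - adj01 H i j) from rfl, l1Norm_stepK, graphD1, ← mul_div_assoc]
  refine div_le_div_of_nonneg_right ?_ (by positivity)
  let A : Finset (Fin n × Fin n) := Finset.univ.filter fun e => ¬ (G.Adj e.1 e.2 ↔ H.Adj e.1 e.2)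
  have e1 : ∑ i, ∑ j, |adj01 G i j - adj01 H i j| = (A.card : ℝ) := by
    rw [← Fintype.sum_prod_type' (f := fun i j => |adj01 G i j - adj01 H i j|), Finset.card_filter]
    push_cast
    refine Finset.sum_congr rfl fun e _ => ?_
    unfold adj01
    by_cases h1 : G.Adj e.1 e.2 <;> by_cases h2 : H.Adj e.1 e.2 <;> simp [h1, h2]
  rw [e1]
  have e2 : A.card ≤ 2 * (A.image fun e => s(e.1, e.2)).card := by
    refine Finset.card_le_mul_card_image _ _ fun b hb => ?_
    obtain ⟨e, he, rfl⟩ := Finset.mem_image.1 hb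
    have : (A.filter fun x => s(x.1, x.2) = s(e.1, e.2)) ⊆ {e, (e.2, e.1)} := by
      intro x hx
      have := (Finset.mem_filter.1 hx).2
      rw [Sym2.eq_iff] at this
      rcases this with h | h
      · simp [Prod.ext_iff, h]
      · simp [Prod.ext_iff, h]
    exact (Finset.card_le_card this).trans Finset.card_le_two
  have e3 : (A.image fun e => s(e.1, e.2)).card ≤ (symmDiff G.edgeSet H.edgeSet).ncard := by
    rw [← Set.ncard_coe_finset]
    refine Set.ncard_le_ncard ?_ (Set.toFinite _)
    intro b hb
    obtain ⟨e, he, rfl⟩ := Finset.mem_image.1 (Finset.mem_coe.1 hb)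
    have := (Finset.mem_filter.1 he).2
    rw [Set.mem_symmDiff, SimpleGraph.mem_edgeSet, SimpleGraph.mem_edgeSet]
    tauto
  exact_mod_cast e2.trans (Nat.mul_le_mul_left 2 e3)

def permFun (n : ℕ) (σ : Equiv.Perm (Fin n)) (x : ℝ) : ℝ :=
  x + step1 n (fun i => (((σ i : ℕ) : ℝ) - ((i : ℕ) : ℝ)) / n) x

lemma permFun_mem_eq {n : ℕ} (σ : Equiv.Perm (Fin n)) {i : Fin n} {x : ℝ} (h : x ∈ J n i) :
    permFun n σ x = x + (((σ i : ℕ) : ℝ) - ((i : ℕ) : ℝ)) / n := by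
  rw [permFun, step1_mem _ h]

lemma permFun_mem {n : ℕ} (σ : Equiv.Perm (Fin n)) {i : Fin n} {x : ℝ} (h : x ∈ J n i) :
    permFun n σ x ∈ J n (σ i) := by
  rw [permFun_mem_eq σ h]
  simp only [J, Set.mem_Ioc] at h ⊢
  constructor
  · have := h.1
    rw [sub_div]; linarith
  · have := h.2
    rw [sub_div]
    rw [add_div] at *
    linarith

lemma permFun_notMem {n : ℕ} (σ : Equiv.Perm (Fin n)) {x : ℝ} (h : ∀ i, x ∉ J n i) :
    permFun n σ x = x := by
  rw [permFun, step1_notMem _ h, add_zero]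

lemma permFun_inv {n : ℕ} (σ : Equiv.Perm (Fin n)) (x : ℝ) :
    permFun n σ.symm (permFun n σ x) = x := by
  by_cases h : ∃ i, x ∈ J n i
  · obtain ⟨i, hi⟩ := h
    rw [permFun_mem_eq _ (permFun_mem σ hi), permFun_mem_eq σ hi]
    simp only [Equiv.symm_apply_apply]
    ring
  · push Not at h
    rw [permFun_notMem σ h, permFun_notMem _ h]

lemma permFun_maps {n : ℕ} (σ : Equiv.Perm (Fin n)) (x : ℝ) (hx : x ∈ I01) :
    permFun n σ x ∈ I01 := by
  by_cases h : ∃ i, x ∈ J n i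
  · obtain ⟨i, hi⟩ := h
    exact Set.Ioc_subset_Icc_self (J_subset n _ (permFun_mem σ hi))
  · push Not at h
    rwa [permFun_notMem σ h]

lemma permFun_meas {n : ℕ} (σ : Equiv.Perm (Fin n)) : Measurable (permFun n σ) :=
  measurable_id.add (step1_meas n _)

lemma permFun_mp {n : ℕ} (hn : 0 < n) (σ : Equiv.Perm (Fin n)) :
    MeasurePreserving (permFun n σ) mu1 mu1 := by
  refine ⟨permFun_meas σ, ?_⟩
  have e : ∀ i : Fin n, Measure.map (permFun n σ) (volume.restrict (J n i))
      = volume.restrict (J n (σ i)) := by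
    intro i
    set c : ℝ := (((σ i : ℕ) : ℝ) - ((i : ℕ) : ℝ)) / n with hc
    have h1 : Measure.map (permFun n σ) (volume.restrict (J n i))
        = Measure.map (fun x => x + c) (volume.restrict (J n i)) := by
      refine Measure.map_congr ?_
      filter_upwards [ae_restrict_mem (measJ n i)] with x hx
      exact permFun_mem_eq σ hx
    rw [h1]
    have h2 : J n i = (fun x => x + c) ⁻¹' (J n (σ i)) := by
      ext x
      simp only [J, Set.mem_Ioc, Set.mem_preimage, hc, sub_div, add_div]
      constructor <;> rintro ⟨h, h'⟩ <;> constructor <;> linarith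
    rw [h2]
    exact ((measurePreserving_add_right volume c).restrict_preimage (measJ n (σ i))).map_eq
  rw [mu1_eq_sum hn, Measure.map_sum (permFun_meas σ).aemeasurable]
  simp_rw [e]
  ext s hs
  rw [Measure.sum_apply _ hs, Measure.sum_apply _ hs]
  exact Equiv.tsum_eq σ (fun i => (volume.restrict (J n i)) s)

def permMP {n : ℕ} (hn : 0 < n) (σ : Equiv.Perm (Fin n)) : InvMP where
  toFun := permFun n σ
  invFun := permFun n σ.symm
  maps := permFun_maps σ
  mapsInv := permFun_maps σ.symm
  measurePreserving := permFun_mp hn σ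
  measurePreservingInv := permFun_mp hn σ.symm
  leftInv := fun x _ => permFun_inv σ x
  rightInv := fun x _ => by simpa using permFun_inv σ.symm x

lemma graphonOf_comap {n : ℕ} (hn : 0 < n) (G : SimpleGraph (Fin n)) (σ : Equiv.Perm (Fin n))
    (x y : ℝ) : graphonOf (G.comap σ) x y
      = graphonOf G ((permMP hn σ).toFun x) ((permMP hn σ).toFun y) := by
  have hex : ∀ z, (∀ i, z ∉ J n i) → ∀ i, permFun n σ z ∉ J n i := by
    intro z hz i
    rw [permFun_notMem σ hz]; exact hz i
  rw [graphonOf_eq, graphonOf_eq]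
  show _ = stepK n (adj01 G) (permFun n σ x) (permFun n σ y)
  by_cases hx : ∃ i, x ∈ J n i
  · by_cases hy : ∃ i, y ∈ J n i
    · obtain ⟨i, hi⟩ := hx
      obtain ⟨j, hj⟩ := hy
      rw [stepK_mem _ hi hj, stepK_mem _ (permFun_mem σ hi) (permFun_mem σ hj)]
      rfl
    · push Not at hy
      rw [stepK_notMem _ (Or.inr hy), stepK_notMem _ (Or.inr (hex y hy))]
  · push Not at hx
    rw [stepK_notMem _ (Or.inl hx), stepK_notMem _ (Or.inl (hex x hx))]

open scoped BigOperators in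
lemma expect_act {n : ℕ} {X : Type*} [Fintype X] (act : Equiv.Perm (Fin n) → X → X)
    (hmul : ∀ π ρ x, act (π * ρ) x = act π (act ρ x)) (hone : ∀ x, act 1 x = x)
    (htrans : ∀ x y, ∃ π, act π x = y) (x : X) (f : X → ℝ) :
    𝔼 π, f (act π x) = 𝔼 y, f y := by
  classical
  have : Nonempty X := ⟨x⟩
  have hbij : ∀ π, 𝔼 y, f (act π y) = 𝔼 y, f y := by
    intro π
    refine Fintype.expect_equiv ⟨act π, act π⁻¹, fun y => ?_, fun y => ?_⟩ _ _ fun y => rfl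
    · rw [← hmul, inv_mul_cancel, hone]
    · rw [← hmul, mul_inv_cancel, hone]
  have hconst : ∀ y, 𝔼 π, f (act π y) = 𝔼 π, f (act π x) := by
    intro y
    obtain ⟨ρ, rfl⟩ := htrans x y
    refine Fintype.expect_equiv (Equiv.mulRight ρ) _ _ fun π => ?_
    rw [← hmul]; rfl
  calc 𝔼 π, f (act π x) = 𝔼 _y : X, 𝔼 π, f (act π x) := by
        rw [Fintype.expect_const]
    _ = 𝔼 y : X, 𝔼 π, f (act π y) := by simp_rw [hconst]
    _ = 𝔼 π, 𝔼 y : X, f (act π y) := Finset.expect_comm _ _ _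
    _ = 𝔼 y, f y := by simp_rw [hbij]; rw [Fintype.expect_const]

lemma exists_perm_sets {n : ℕ} {α : Type*} (h h' : α ↪ Fin n) :
    ∃ π : Equiv.Perm (Fin n), ∀ a, π (h a) = h' a := by
  classical
  let e : {x // x ∈ Set.range h} ≃ {x // x ∈ Set.range h'} :=
    (Equiv.ofInjective h h.injective).symm.trans (Equiv.ofInjective h' h'.injective)
  refine ⟨e.extendSubtype, fun a => ?_⟩
  rw [Equiv.extendSubtype_apply_of_mem _ _ ⟨a, rfl⟩]
  have : (⟨h a, ⟨a, rfl⟩⟩ : {x // x ∈ Set.range h}) = Equiv.ofInjective h h.injective a := rfl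
  simp only [e, Equiv.trans_apply]
  rw [this, Equiv.symm_apply_apply]
  rfl

open scoped BigOperators in
lemma expect_emb {n : ℕ} {α : Type*} [Fintype α] [DecidableEq α] (h : α ↪ Fin n)
    (Φ : (α → Fin n) → ℝ) :
    𝔼 π : Equiv.Perm (Fin n), Φ (fun a => π (h a)) = 𝔼 g : α ↪ Fin n, Φ g := by
  refine expect_act (fun π g => g.trans π.toEmbedding) (fun _ _ _ => rfl) (fun _ => rfl) ?_ h
    (fun g : α ↪ Fin n => Φ g)
  intro g g'
  obtain ⟨π, hπ⟩ := exists_perm_sets g g'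
  exact ⟨π, by ext a; exact congrArg _ (hπ a)⟩

lemma descFactorial_bound (n a : ℕ) :
    (n : ℝ) ^ a * n - a ^ 2 * (n : ℝ) ^ a ≤ (n.descFactorial a : ℝ) * n := by
  induction a with
  | zero => simp
  | succ a ih =>
    rw [Nat.descFactorial_succ, pow_succ]
    push_cast
    have hn : (0 : ℝ) ≤ n := Nat.cast_nonneg n
    have h1 : ((n - a : ℕ) : ℝ) ≥ n - a := by
      rw [ge_iff_le, sub_le_iff_le_add]
      have : n ≤ n - a + a := by omega
      exact_mod_cast this
    have h2 : (n.descFactorial a : ℝ) ≤ (n : ℝ) ^ a := by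
      exact_mod_cast Nat.descFactorial_le_pow n a
    have h3 : (0 : ℝ) ≤ n.descFactorial a := Nat.cast_nonneg _
    have h4 : (0 : ℝ) ≤ a := Nat.cast_nonneg _
    have h5 : (0 : ℝ) ≤ (n : ℝ) ^ a := by positivity
    have : ((n : ℝ) - a) * n.descFactorial a * n ≤ ((n - a : ℕ) : ℝ) * n.descFactorial a * n := by
      gcongr
    refine le_trans ?_ this
    have h6 := mul_le_mul_of_nonneg_right ih hn
    have h7 : (a : ℝ) * (n.descFactorial a * n) ≤ a * ((n : ℝ) ^ a * n) := by gcongr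
    have h8 : 0 ≤ ((n : ℝ) ^ a * n) * (a + 1) := by positivity
    nlinarith

/-- fraction of injections -/
lemma inj_frac {n a : ℕ} (hn : 0 < n) :
    1 - (a : ℝ) ^ 2 / n ≤ (n.descFactorial a : ℝ) / (n : ℝ) ^ a := by
  have hn' : (0 : ℝ) < n := by exact_mod_cast hn
  have := descFactorial_bound n a
  rw [le_div_iff₀ (by positivity)]
  have e : (1 - (a : ℝ) ^ 2 / n) * (n : ℝ) ^ a = ((n : ℝ) ^ a * n - a ^ 2 * (n : ℝ) ^ a) / n := by
    field_simp
  rw [e, div_le_iff₀ hn']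
  exact this

lemma sum_inj {n : ℕ} {α : Type*} [Fintype α] [DecidableEq α] (Φ : (α → Fin n) → ℝ) :
    ∑ g : α ↪ Fin n, Φ g = ∑ g : α → Fin n with Function.Injective g, Φ g := by
  classical
  refine Finset.sum_bij (fun g _ => (g : α → Fin n)) ?_ ?_ ?_ ?_
  · intro g _; simpa using g.injective
  · intro g _ g' _ h; exact DFunLike.coe_injective h
  · intro g hg
    simp only [Finset.mem_filter, Finset.mem_univ, true_and] at hg
    exact ⟨⟨g, hg⟩, Finset.mem_univ _, rfl⟩
  · intro _ _; rfl

open scoped BigOperators in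
lemma noninj_frac {n : ℕ} (hn : 0 < n) {α : Type*} [Fintype α] [DecidableEq α] :
    𝔼 g : α → Fin n, (if Function.Injective g then (0 : ℝ) else 1) ≤
      (Fintype.card α : ℝ) ^ 2 / n := by
  classical
  have : Nonempty (Fin n) := ⟨⟨0, hn⟩⟩
  have h := inj_frac (a := Fintype.card α) hn
  have h1 := sum_inj (α := α) (n := n) (fun _ => (1 : ℝ))
  simp only [Finset.sum_const, Finset.card_univ, Fintype.card_embedding_eq, Fintype.card_fin,
    nsmul_eq_mul, mul_one] at h1
  have h2 : 𝔼 g : α → Fin n, (if Function.Injective g then (0 : ℝ) else 1)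
      = 1 - (n.descFactorial (Fintype.card α) : ℝ) / (n : ℝ) ^ (Fintype.card α) := by
    have h3 : 𝔼 g : α → Fin n, (if Function.Injective g then (0 : ℝ) else 1)
      = 𝔼 g : α → Fin n, (1 - (if Function.Injective g then (1 : ℝ) else 0)) := by
      refine Finset.expect_congr rfl fun g _ => ?_
      split_ifs <;> simp
    rw [h3, Finset.expect_sub_distrib, Fintype.expect_const]
    congr 1
    rw [Fintype.expect_eq_sum_div_card, h1, ← Finset.sum_filter]
    simp
  rw [h2]; linarith

open scoped BigOperators in
lemma expect_inj_all {n : ℕ} (hn : 0 < n) {α : Type*} [Fintype α] [DecidableEq α] (h : α ↪ Fin n)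
    (Φ : (α → Fin n) → ℝ) (hΦ : ∀ g, Φ g ∈ Set.Icc (0 : ℝ) 1) :
    |𝔼 π : Equiv.Perm (Fin n), Φ (fun a => π (h a)) - 𝔼 g, Φ g| ≤ (Fintype.card α : ℝ) ^ 2 / n := by
  classical
  have : Nonempty (Fin n) := ⟨⟨0, hn⟩⟩
  have : Nonempty (α ↪ Fin n) := ⟨h⟩
  rw [expect_emb]
  have h0 := noninj_frac hn (α := α)
  have hsplit : 𝔼 g, Φ g = 𝔼 g : α → Fin n, (if Function.Injective g then Φ g else 0)
      + 𝔼 g : α → Fin n, (if Function.Injective g then 0 else Φ g) := by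
    rw [← Finset.expect_add_distrib]
    refine Finset.expect_congr rfl fun g _ => ?_
    split_ifs <;> simp
  have hr : 𝔼 g : α → Fin n, (if Function.Injective g then 0 else Φ g) ≤
      𝔼 g : α → Fin n, (if Function.Injective g then (0 : ℝ) else 1) := by
    refine Finset.expect_le_expect fun g _ => ?_
    split_ifs
    · exact le_rfl
    · exact (hΦ g).2
  have hr0 : 0 ≤ 𝔼 g : α → Fin n, (if Function.Injective g then 0 else Φ g) := by
    refine Finset.expect_nonneg fun g _ => ?_
    split_ifs
    · exact le_rfl
    · exact (hΦ g).1
  have hA : 𝔼 g : α → Fin n, (if Function.Injective g then Φ g else 0)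
      = (𝔼 g : α ↪ Fin n, Φ g) * (1 - 𝔼 g : α → Fin n, (if Function.Injective g then (0 : ℝ) else 1)) := by
    have h3 : 𝔼 g : α → Fin n, (if Function.Injective g then (0 : ℝ) else 1)
      = 𝔼 g : α → Fin n, (1 - (if Function.Injective g then (1 : ℝ) else 0)) := by
      refine Finset.expect_congr rfl fun g _ => ?_
      split_ifs <;> simp
    rw [h3, Finset.expect_sub_distrib, Fintype.expect_const, sub_sub_cancel,
      Fintype.expect_eq_sum_div_card, Fintype.expect_eq_sum_div_card,
      Fintype.expect_eq_sum_div_card, sum_inj, ← Finset.sum_filter, ← Finset.sum_filter]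
    have h1 := sum_inj (α := α) (n := n) (fun _ => (1 : ℝ))
    rw [← h1]
    have : (Fintype.card (α ↪ Fin n) : ℝ) ≠ 0 := by
      exact_mod_cast Fintype.card_ne_zero
    simp only [Finset.sum_const, Finset.card_univ, nsmul_eq_mul, mul_one]
    field_simp
  have hE0 : 0 ≤ 𝔼 g : α ↪ Fin n, Φ g := Finset.expect_nonneg fun g _ => (hΦ g).1
  have hE1 : 𝔼 g : α ↪ Fin n, Φ g ≤ 1 := by
    refine le_trans (Finset.expect_le_expect fun g _ => (hΦ g).2) ?_
    rw [Fintype.expect_const]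
  have hq0 : 0 ≤ 𝔼 g : α → Fin n, (if Function.Injective g then (0 : ℝ) else 1) := by
    refine Finset.expect_nonneg fun g _ => ?_
    split_ifs <;> norm_num
  rw [hsplit, hA, abs_le]
  constructor <;> nlinarith

open scoped BigOperators in
lemma expect_two {n k : ℕ} (hk : 0 < k) (hkn : k ≤ n) {α : Type*} [Fintype α] [DecidableEq α]
    (Φ : (α → Fin n) → ℝ) (hΦ : ∀ g, Φ g ∈ Set.Icc (0 : ℝ) 1) :
    |𝔼 π : Equiv.Perm (Fin n), 𝔼 f : α → Fin k, Φ (fun a => π (Fin.castLE hkn (f a)))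
      - 𝔼 g, Φ g| ≤ 2 * (Fintype.card α : ℝ) ^ 2 / k := by
  classical
  have hn : 0 < n := hk.trans_le hkn
  have : Nonempty (Fin n) := ⟨⟨0, hn⟩⟩
  have : Nonempty (Fin k) := ⟨⟨0, hk⟩⟩
  have h0 := noninj_frac hk (α := α)
  rw [Finset.expect_comm]
  have e : 𝔼 g, Φ g = 𝔼 _f : α → Fin k, 𝔼 g, Φ g := by rw [Fintype.expect_const]
  rw [e, ← Finset.expect_sub_distrib]
  refine (Finset.abs_expect_le _ _).trans ?_
  have hE0 : 0 ≤ 𝔼 g, Φ g := Finset.expect_nonneg fun g _ => (hΦ g).1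
  have hE1 : 𝔼 g, Φ g ≤ 1 := by
    refine le_trans (Finset.expect_le_expect fun g _ => (hΦ g).2) ?_
    rw [Fintype.expect_const]
  have hb : ∀ f : α → Fin k, |𝔼 π : Equiv.Perm (Fin n), Φ (fun a => π (Fin.castLE hkn (f a)))
      - 𝔼 g, Φ g| ≤ (Fintype.card α : ℝ) ^ 2 / k + (if Function.Injective f then (0 : ℝ) else 1) := by
    intro f
    split_ifs with hf
    · have := expect_inj_all hn ⟨fun a => Fin.castLE hkn (f a),
        (Fin.castLE_injective hkn).comp hf⟩ Φ hΦ
      refine le_trans this ?_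
      rw [add_zero]
      have : (0 : ℝ) < k := by exact_mod_cast hk
      gcongr
    · have h1 : 0 ≤ 𝔼 π : Equiv.Perm (Fin n), Φ (fun a => π (Fin.castLE hkn (f a))) :=
        Finset.expect_nonneg fun g _ => (hΦ _).1
      have h2 : 𝔼 π : Equiv.Perm (Fin n), Φ (fun a => π (Fin.castLE hkn (f a))) ≤ 1 := by
        refine le_trans (Finset.expect_le_expect fun g _ => (hΦ _).2) ?_
        rw [Fintype.expect_const]
      have h3 : 0 ≤ (Fintype.card α : ℝ) ^ 2 / k := by positivity
      rw [abs_le]; constructor <;> linarith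
  refine (Finset.expect_le_expect fun f _ => hb f).trans ?_
  rw [Finset.expect_add_distrib, Fintype.expect_const]
  have : 2 * (Fintype.card α : ℝ) ^ 2 / k = (Fintype.card α : ℝ) ^ 2 / k
    + (Fintype.card α : ℝ) ^ 2 / k := by ring
  linarith

open scoped BigOperators

lemma avgF_eq {n : ℕ} (G : SimpleGraph (Fin n)) (k : ℕ) (R : GraphProp)
    [DecidablePred (· ∈ R k)] :
    avgF G k R = 𝔼 g : Fin k → Fin n, if G.comap g ∈ R k then (1 : ℝ) else 0 := by
  classical
  rw [avgF, Fintype.expect_eq_sum_div_card]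
  simp only [Fintype.card_pi, Fintype.card_fin, Finset.prod_const, Finset.card_univ, Nat.cast_pow]
  congr 1
  refine Finset.sum_congr rfl fun g _ => ?_
  congr 1

lemma avgF_mem {n : ℕ} (hn : 0 < n) (G : SimpleGraph (Fin n)) (k : ℕ) (R : GraphProp) :
    avgF G k R ∈ Set.Icc (0 : ℝ) 1 := by
  classical
  have : Nonempty (Fin n) := ⟨⟨0, hn⟩⟩
  rw [avgF_eq]
  constructor
  · refine Finset.expect_nonneg fun g _ => ?_
    split_ifs <;> norm_num
  · refine le_trans (Finset.expect_le_expect (g := fun _ => (1 : ℝ)) fun g _ => ?_) ?_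
    · split_ifs <;> norm_num
    · rw [Fintype.expect_const]

lemma inducedMem_iff {n k : ℕ} (G : SimpleGraph (Fin n)) {P : GraphProp} (hP : IsGraphProperty P)
    (f : Fin k ↪ Fin n) (S : Finset (Fin n)) (hS : S = Finset.univ.map f) :
    inducedMem G S k P ↔ G.comap f ∈ P k := by
  subst hS
  constructor
  · rintro ⟨H, hH, f', hf', hadj⟩
    have hex : ∀ i, ∃ j, f j = f' i := by
      intro i
      have := hf' i
      simpa using this
    choose s hs using hex
    have hinj : Function.Injective s := by
      intro i j h
      apply f'.injective
      rw [← hs, ← hs, h]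
    have hbij : Function.Bijective s := Finite.injective_iff_bijective.1 hinj
    refine (hP k H (G.comap f) ⟨⟨Equiv.ofBijective s hbij, ?_⟩⟩).1 hH
    intro a b
    simp only [SimpleGraph.comap_adj, Equiv.ofBijective_apply, hs]
    exact (hadj a b).symm
  · intro h
    exact ⟨_, h, f, fun i => by simp, fun i j => Iff.rfl⟩

open Classical in
lemma goodCount_eq {n k : ℕ} (hkn : k ≤ n) (G : SimpleGraph (Fin n)) {P : GraphProp}
    (hP : IsGraphProperty P) :
    (goodCount G k P : ℝ) / n.choose k = 𝔼 π : Equiv.Perm (Fin n),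
      if G.comap (fun a => π (Fin.castLE hkn a)) ∈ P k then (1 : ℝ) else 0 := by
  let X := {S : Finset (Fin n) // S ∈ Finset.powersetCard k Finset.univ}
  have hcard : ∀ S : X, S.1.card = k := fun S => (Finset.mem_powersetCard.1 S.2).2
  let act : Equiv.Perm (Fin n) → X → X := fun π S =>
    ⟨S.1.map π.toEmbedding, by
      rw [Finset.mem_powersetCard]; exact ⟨Finset.subset_univ _, by rw [Finset.card_map, hcard]⟩⟩
  let emb : Fin k ↪ Fin n := Fin.castLEEmb hkn
  let S0 : X := ⟨Finset.univ.map emb, by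
    rw [Finset.mem_powersetCard]; exact ⟨Finset.subset_univ _, by simp⟩⟩
  have key := expect_act act (fun π ρ S => by
      apply Subtype.ext
      simp only [act, Finset.map_map]; rfl) (fun S => by
      apply Subtype.ext
      simp only [act]
      exact Finset.map_refl) (fun S T => by
      have e1 : ∀ S : X, ∃ f : Fin k ↪ Fin n, S.1 = Finset.univ.map f := by
        intro S
        refine ⟨(S.1.orderEmbOfFin (hcard S)).toEmbedding, ?_⟩
        rw [Finset.map_orderEmbOfFin_univ]
      obtain ⟨f, hf⟩ := e1 S
      obtain ⟨f', hf'⟩ := e1 T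
      obtain ⟨π, hπ⟩ := exists_perm_sets f f'
      refine ⟨π, Subtype.ext ?_⟩
      simp only [act, hf, hf', Finset.map_map]
      congr 1
      ext a
      exact congrArg _ (hπ a)) S0 (fun S => if inducedMem G S.1 k P then (1 : ℝ) else 0)
  have e2 : 𝔼 y : X, (if inducedMem G y.1 k P then (1 : ℝ) else 0)
      = (goodCount G k P : ℝ) / n.choose k := by
    rw [Fintype.expect_eq_sum_div_card]
    have hc : Fintype.card X = n.choose k := by
      simp [X]
    rw [hc]
    congr 1
    refine (Finset.sum_subtype (Finset.powersetCard k (Finset.univ : Finset (Fin n)))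
      (fun x => Iff.rfl) (fun S => if inducedMem G S k P then (1 : ℝ) else 0)).symm.trans ?_
    rw [← Finset.sum_filter]
    simp only [Finset.sum_const, nsmul_eq_mul, mul_one, goodCount]
    rw [← Set.ncard_coe_finset]
    congr 2
    ext S
    simp [Finset.mem_powersetCard]
  rw [← e2, ← key]
  refine Finset.expect_congr rfl fun π _ => ?_
  have := inducedMem_iff G hP (emb.trans π.toEmbedding) (act π S0).1 (by
    simp only [act, S0, Finset.map_map])
  simp only [this]
  rfl

lemma goodCount_avgF {n k : ℕ} (hn : 0 < n) (hkn : k ≤ n) (G : SimpleGraph (Fin n))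
    {P : GraphProp} (hP : IsGraphProperty P) :
    |(goodCount G k P : ℝ) / n.choose k - avgF G k P| ≤ (k : ℝ) ^ 2 / n := by
  classical
  rw [goodCount_eq hkn G hP, avgF_eq]
  have := expect_inj_all hn (Fin.castLEEmb hkn)
    (fun g => if G.comap g ∈ P k then (1 : ℝ) else 0) (fun g => by
      show (if G.comap g ∈ P k then (1 : ℝ) else 0) ∈ _
      split_ifs <;> simp)
  simpa using this

/-- variance bound -/
lemma variance_bound {n k m : ℕ} (hk : 0 < k) (hkn : k ≤ n) (G : SimpleGraph (Fin n))
    (R : GraphProp) :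
    𝔼 π : Equiv.Perm (Fin n), (avgF (G.comap (fun a => π (Fin.castLE hkn a))) m R - avgF G m R) ^ 2
      ≤ 12 * (m : ℝ) ^ 2 / k := by
  classical
  have hn : 0 < n := hk.trans_le hkn
  have : Nonempty (Fin n) := ⟨⟨0, hn⟩⟩
  have : Nonempty (Fin k) := ⟨⟨0, hk⟩⟩
  set Φ : (Fin m → Fin n) → ℝ := fun g => if G.comap g ∈ R m then (1 : ℝ) else 0 with hΦ
  have hΦ01 : ∀ g, Φ g ∈ Set.Icc (0 : ℝ) 1 := fun g => by
    simp only [hΦ]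
    split_ifs <;> simp
  have hX : ∀ π : Equiv.Perm (Fin n), avgF (G.comap (fun a => π (Fin.castLE hkn a))) m R
      = 𝔼 f : Fin m → Fin k, Φ (fun a => π (Fin.castLE hkn (f a))) := by
    intro π
    rw [avgF_eq]
    rfl
  have hp : avgF G m R = 𝔼 g, Φ g := avgF_eq G m R
  set p := avgF G m R with hpdef
  have hp01 : p ∈ Set.Icc (0 : ℝ) 1 := avgF_mem hn G m R
  have h1 := expect_two hk hkn Φ hΦ01
  rw [← hp] at h1
  let Ψ : (Fin m ⊕ Fin m → Fin n) → ℝ := fun g => Φ (fun a => g (Sum.inl a)) * Φ (fun a => g (Sum.inr a))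
  have h2 := expect_two hk hkn Ψ (fun g => ⟨mul_nonneg (hΦ01 _).1 (hΦ01 _).1,
    mul_le_one₀ (hΦ01 _).2 (hΦ01 _).1 (hΦ01 _).2⟩)
  have hsq : ∀ (q : ℕ) (A : (Fin m → Fin q) → ℝ),
      𝔼 g : Fin m ⊕ Fin m → Fin q, A (fun a => g (Sum.inl a)) * A (fun a => g (Sum.inr a))
        = (𝔼 g, A g) ^ 2 := by
    intro q A
    rw [sq, Finset.expect_mul_expect]
    have := Finset.expect_product (Finset.univ) (Finset.univ)
      (fun x : (Fin m → Fin q) × (Fin m → Fin q) => A x.1 * A x.2)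
    rw [← this, Finset.univ_product_univ]
    exact Fintype.expect_equiv (Equiv.sumArrowEquivProdArrow _ _ _) _ _ fun g => rfl
  have hΨ : 𝔼 g, Ψ g = p ^ 2 := by rw [hp]; exact hsq n Φ
  rw [hΨ] at h2
  have hΨ2 : ∀ π : Equiv.Perm (Fin n),
      𝔼 f : Fin m ⊕ Fin m → Fin k, Ψ (fun a => π (Fin.castLE hkn (f a)))
      = (avgF (G.comap (fun a => π (Fin.castLE hkn a))) m R) ^ 2 := by
    intro π
    rw [hX]
    exact hsq k (fun f => Φ (fun a => π (Fin.castLE hkn (f a))))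
  simp only [hΨ2] at h2
  simp only [← hX] at h1
  set X := fun π : Equiv.Perm (Fin n) => avgF (G.comap (fun a => π (Fin.castLE hkn a))) m R
  have e : 𝔼 π, (X π - p) ^ 2 = 𝔼 π, (X π) ^ 2 - 2 * p * 𝔼 π, X π + p ^ 2 := by
    have : ∀ π, (X π - p) ^ 2 = X π ^ 2 - 2 * p * X π + p ^ 2 := fun π => by ring
    simp_rw [this]
    rw [Finset.expect_add_distrib, Finset.expect_sub_distrib, Fintype.expect_const,
      Finset.mul_expect]
  rw [e]
  simp only [Fintype.card_fin, Fintype.card_sum] at h1 h2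
  rw [abs_le] at h1 h2
  have hk' : (0 : ℝ) < k := by exact_mod_cast hk
  have e3 : 2 * ((m + m : ℕ) : ℝ) ^ 2 / k = 8 * ((m : ℝ) ^ 2 / k) := by push_cast; ring
  rw [e3] at h2
  have e4 : 2 * (m : ℝ) ^ 2 / k = 2 * ((m : ℝ) ^ 2 / k) := by ring
  rw [e4] at h1
  have e5 : 12 * (m : ℝ) ^ 2 / k = 12 * ((m : ℝ) ^ 2 / k) := by ring
  rw [e5]
  have hpos : 0 ≤ (m : ℝ) ^ 2 / k := by positivity
  have := mul_le_mul_of_nonneg_left h1.1 hp01.1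
  have h7 := mul_le_mul_of_nonneg_right hp01.2 hpos
  nlinarith [h2.2]

lemma cheb {n k m : ℕ} (hk : 0 < k) (hkn : k ≤ n) (hm : 3600 * m ^ 2 ≤ k) (G : SimpleGraph (Fin n))
    (R : GraphProp) (B : Equiv.Perm (Fin n) → Prop) [DecidablePred B]
    (hB : ∀ π, B π → 1 / 10 ≤ |avgF (G.comap (fun a => π (Fin.castLE hkn a))) m R - avgF G m R|) :
    𝔼 π : Equiv.Perm (Fin n), (if B π then (1 : ℝ) else 0) ≤ 1 / 3 := by
  have h := variance_bound hk hkn G R (m := m)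
  have h1 : 𝔼 π : Equiv.Perm (Fin n), (if B π then (1 : ℝ) else 0) ≤
    𝔼 π : Equiv.Perm (Fin n),
      100 * (avgF (G.comap (fun a => π (Fin.castLE hkn a))) m R - avgF G m R) ^ 2 := by
    refine Finset.expect_le_expect fun π _ => ?_
    split_ifs with hb
    · have := hB π hb
      rw [← sq_abs]
      nlinarith
    · positivity
  refine h1.trans ?_
  rw [← Finset.mul_expect]
  have hk' : (0 : ℝ) < k := by exact_mod_cast hk
  have : 12 * (m : ℝ) ^ 2 / k ≤ 1 / 300 := by
    rw [div_le_iff₀ hk']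
    have : (3600 : ℝ) * m ^ 2 ≤ k := by exact_mod_cast hm
    linarith
  linarith

lemma abs_setInt_bound {D : ℝ → ℝ → ℝ} {C : ℝ} (hC : ∀ x y, |D x y| ≤ C)
    (A : Set (ℝ × ℝ)) : |∫ p in A, D p.1 p.2 ∂mu2| ≤ C * mu2.real A := by
  have := norm_setIntegral_le_of_norm_le_const (μ := mu2) (s := A) (C := C)
    (f := fun p : ℝ × ℝ => D p.1 p.2) (measure_lt_top _ _) (fun p _ => hC p.1 p.2)
  simpa using this

lemma weak_set {D : ℕ → ℝ → ℝ → ℝ} (hD : ∀ t, BK (D t)) {C : ℝ} (hC : ∀ t x y, |D t x y| ≤ C)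
    (h0 : Tendsto (fun t => cutNorm (D t)) atTop (𝓝 0)) (A : Set (ℝ × ℝ)) (hA : MeasurableSet A) :
    Tendsto (fun t => ∫ p in A, D t p.1 p.2 ∂mu2) atTop (𝓝 0) := by
  have hrect : ∀ S T : Set ℝ, MeasurableSet S → MeasurableSet T →
      Tendsto (fun t => ∫ p in S ×ˢ T, D t p.1 p.2 ∂mu2) atTop (𝓝 0) := by
    intro S T hS hT
    exact squeeze_zero_norm (fun t => le_cutNorm (hD t) hS hT) h0
  refine MeasurableSpace.induction_on_inter (C := fun A _ =>
    Tendsto (fun t => ∫ p in A, D t p.1 p.2 ∂mu2) atTop (𝓝 0)) generateFrom_prod.symm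
    isPiSystem_prod ?_ ?_ ?_ ?_ A hA
  · simp
  · rintro _ ⟨S, hS, T, hT, rfl⟩
    exact hrect S T hS hT
  · intro A hA h
    have hu := hrect Set.univ Set.univ MeasurableSet.univ MeasurableSet.univ
    have := hu.sub h
    simp only [Set.univ_prod_univ, Measure.restrict_univ, sub_zero] at this
    refine this.congr fun t => ?_
    rw [← integral_add_compl hA ((hD t).integrable mu2)]
    ring
  · intro f hdis hf h
    have e : ∀ t, ∫ p in ⋃ i, f i, D t p.1 p.2 ∂mu2 = ∑' i, ∫ p in f i, D t p.1 p.2 ∂mu2 :=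
      fun t => integral_iUnion hf hdis ((hD t).integrable mu2).integrableOn
    simp only [e]
    have hs : Summable fun i => C * mu2.real (f i) := by
      refine Summable.mul_left _ ?_
      refine ENNReal.summable_toReal ?_
      rw [← measure_iUnion hdis hf]
      exact measure_ne_top _ _
    have := tendsto_tsum_of_dominated_convergence (𝓕 := atTop)
      (f := fun t i => ∫ p in f i, D t p.1 p.2 ∂mu2) (g := fun _ => (0 : ℝ)) hs h
      (Eventually.of_forall fun t i => abs_setInt_bound (hC t) _)
    simpa using this

lemma BK.mul_integrable {D : ℝ → ℝ → ℝ} (hD : BK D) {g : ℝ × ℝ → ℝ} (hg : Integrable g mu2) :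
    Integrable (fun p => g p * D p.1 p.2) mu2 := by
  obtain ⟨m, C, hC⟩ := hD
  exact hg.mul_bdd (c := C) (Measurable.aestronglyMeasurable m) (ae_of_all _ fun p => hC _ _)

lemma weak_fun {D : ℕ → ℝ → ℝ → ℝ} (hD : ∀ t, BK (D t)) {C : ℝ} (hC : ∀ t x y, |D t x y| ≤ C)
    (h0 : Tendsto (fun t => cutNorm (D t)) atTop (𝓝 0)) {g : ℝ × ℝ → ℝ} (hg : Integrable g mu2) :
    Tendsto (fun t => ∫ p, g p * D t p.1 p.2 ∂mu2) atTop (𝓝 0) := by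
  have hC0 : 0 ≤ C := (abs_nonneg _).trans (hC 0 0 0)
  refine Integrable.induction (P := fun g : ℝ × ℝ → ℝ =>
    Tendsto (fun t => ∫ p, g p * D t p.1 p.2 ∂mu2) atTop (𝓝 0)) ?_ ?_ ?_ ?_ hg
  · intro c A hA _
    have := (weak_set hD hC h0 A hA).const_mul c
    rw [mul_zero] at this
    refine this.congr fun t => ?_
    rw [← integral_const_mul, ← integral_indicator hA]
    refine integral_congr_ae (ae_of_all _ fun p => ?_)
    by_cases hp : p ∈ A <;> simp [hp]
  · intro f g _ hf hg h1 h2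
    have := h1.add h2
    rw [add_zero] at this
    refine this.congr fun t => ?_
    rw [← integral_add ((hD t).mul_integrable hf) ((hD t).mul_integrable hg)]
    refine integral_congr_ae (ae_of_all _ fun p => ?_)
    simp [add_mul]
  · rw [← closure_subset_iff_isClosed]
    intro f hf
    simp only [Set.mem_ofPred_eq]
    rw [Metric.tendsto_atTop]
    intro ε hε
    rw [Metric.mem_closure_iff] at hf
    obtain ⟨g, hg, hfg⟩ := hf (ε / (2 * (C + 1))) (by positivity)
    simp only [Set.mem_ofPred_eq] at hg
    rw [Metric.tendsto_atTop] at hg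
    obtain ⟨N, hN⟩ := hg (ε / 2) (by positivity)
    refine ⟨N, fun t ht => ?_⟩
    have h1 := hN t ht
    rw [Real.dist_eq, sub_zero] at h1 ⊢
    have hfi := L1.integrable_coeFn f
    have hgi := L1.integrable_coeFn g
    have h2 : |∫ p, f p * D t p.1 p.2 ∂mu2 - ∫ p, g p * D t p.1 p.2 ∂mu2| ≤ C * dist f g := by
      rw [← integral_sub ((hD t).mul_integrable hfi) ((hD t).mul_integrable hgi)]
      refine abs_integral_le_integral_abs.trans ?_
      rw [L1.dist_eq_integral_dist, ← integral_const_mul]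
      refine integral_mono_ae (((hD t).mul_integrable hfi).sub ((hD t).mul_integrable hgi)).abs
        ((hfi.sub hgi).norm.const_mul C) (ae_of_all _ fun p => ?_)
      simp only [Pi.sub_apply, ← sub_mul, abs_mul, Real.norm_eq_abs, Real.dist_eq]
      rw [mul_comm]
      exact mul_le_mul_of_nonneg_right (hC _ _ _) (abs_nonneg _)
    have h3 : C * dist f g ≤ ε / 2 := by
      have : C * dist f g ≤ (C + 1) * (ε / (2 * (C + 1))) := by gcongr; linarith
      refine this.trans (le_of_eq ?_)
      field_simp
    rw [abs_le] at h2
    rw [abs_lt] at h1 ⊢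
    constructor <;> linarith [h2.1, h2.2]
  · intro f g hfg _ h
    refine h.congr fun t => integral_congr_ae ?_
    filter_upwards [hfg] with p hp
    rw [hp]

lemma IsGraphon.abs_le {W : ℝ → ℝ → ℝ} (h : IsGraphon W) (x y : ℝ) : |W x y| ≤ 1 := by
  have := h.2.2 x y
  rw [abs_of_nonneg this.1]; exact this.2

lemma IsGraphon.abs_sub_le {U W : ℝ → ℝ → ℝ} (h : IsGraphon U) (h' : IsGraphon W) (x y : ℝ) :
    |U x y - W x y| ≤ 1 := by
  have := h.2.2 x y
  have := h'.2.2 x y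
  simp only [Set.mem_Icc] at *
  rw [_root_.abs_le]; constructor <;> linarith

/-- lower semicontinuity of the L1 distance -/
lemma l1_lsc {A B : ℕ → ℝ → ℝ → ℝ} {W U : ℝ → ℝ → ℝ} (hA : ∀ t, IsGraphon (A t))
    (hB : ∀ t, IsGraphon (B t)) (hW : IsGraphon W) (hU : IsGraphon U)
    (hAW : Tendsto (fun t => cutNorm fun x y => A t x y - W x y) atTop (𝓝 0))
    (hBU : Tendsto (fun t => cutNorm fun x y => B t x y - U x y) atTop (𝓝 0)) {c : ℝ}
    (hc : ∀ t, l1Norm (fun x y => A t x y - B t x y) ≤ c) :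
    l1Norm (fun x y => W x y - U x y) ≤ c := by
  let g : ℝ × ℝ → ℝ := fun p => if U p.1 p.2 ≤ W p.1 p.2 then 1 else -1
  have hgm : Measurable g := Measurable.ite (measurableSet_le hU.bk.meas hW.bk.meas)
    measurable_const measurable_const
  have hgb : ∀ p, |g p| ≤ 1 := fun p => by
    simp only [g]; split_ifs <;> simp
  have hgi : Integrable g mu2 := integrable_of_bdd hgm hgb
  have h1 := weak_fun (fun t => (hA t).bk.sub hW.bk) (fun t => (hA t).abs_sub_le hW) hAW hgi
  have h2 := weak_fun (fun t => (hB t).bk.sub hU.bk) (fun t => (hB t).abs_sub_le hU) hBU hgi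
  have h3 := h1.sub h2
  rw [sub_zero] at h3
  have h4 : ∀ t, ∫ p, g p * (A t p.1 p.2 - W p.1 p.2) ∂mu2 - ∫ p, g p * (B t p.1 p.2 - U p.1 p.2) ∂mu2
      ≤ c - l1Norm (fun x y => W x y - U x y) := by
    intro t
    refine le_trans ?_ (sub_le_sub_right (hc t) _)
    have iA := ((hA t).bk.sub hW.bk).mul_integrable hgi
    have iB := ((hB t).bk.sub hU.bk).mul_integrable hgi
    have i1 := (((hA t).bk.sub (hB t).bk).integrable mu2).abs
    have i2 := ((hW.bk.sub hU.bk).integrable mu2).abs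
    rw [l1Norm_eq ((hA t).bk.sub (hB t).bk), l1Norm_eq (hW.bk.sub hU.bk),
      ← integral_sub iA iB, ← integral_sub i1 i2]
    refine integral_mono (iA.sub iB) (i1.sub i2) fun p => ?_
    simp only [g]
    split_ifs with h
    · rw [abs_of_nonneg (sub_nonneg.2 h)]
      have := le_abs_self (A t p.1 p.2 - B t p.1 p.2)
      linarith
    · rw [abs_of_neg (sub_neg.2 (not_le.1 h))]
      have := neg_abs_le (A t p.1 p.2 - B t p.1 p.2)
      linarith
  have := le_of_tendsto h3 (Eventually.of_forall h4)
  linarith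

lemma l1_le_sqrt {D : ℝ → ℝ → ℝ} (hD : BK D) {η : ℝ} (hη : 0 < η) :
    l1Norm D ≤ η / 2 + (∫ p, (D p.1 p.2) ^ 2 ∂mu2) / (2 * η) := by
  rw [l1Norm_eq hD]
  obtain ⟨m, C, hC⟩ := hD
  have i1 : Integrable (fun p : ℝ × ℝ => |D p.1 p.2|) mu2 := (BK.integrable ⟨m, C, hC⟩ mu2).abs
  have hm : Measurable fun p : ℝ × ℝ => D p.1 p.2 := m
  have i2 : Integrable (fun p : ℝ × ℝ => (D p.1 p.2) ^ 2) mu2 :=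
    integrable_of_bdd (C := C ^ 2) (hm.pow_const 2) fun p => by
      rw [abs_pow]; exact pow_le_pow_left₀ (abs_nonneg _) (hC _ _) 2
  have e : η / 2 + (∫ p, (D p.1 p.2) ^ 2 ∂mu2) / (2 * η)
      = ∫ p, (η / 2 + (D p.1 p.2) ^ 2 / (2 * η)) ∂mu2 := by
    rw [integral_add (integrable_const _) (i2.div_const _), ← integral_div]
    simp
  rw [e]
  refine integral_mono i1 ((integrable_const _).add (i2.div_const _)) fun p => ?_
  have h1 := sq_nonneg (|D p.1 p.2| - η)
  have h2 := sq_abs (D p.1 p.2)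
  show _ ≤ η / 2 + (D p.1 p.2) ^ 2 / (2 * η)
  rw [div_add_div _ _ (by norm_num) (by positivity), le_div_iff₀ (by positivity)]
  nlinarith

lemma l2_expand {U W : ℝ → ℝ → ℝ} (hU : IsGraphon U) (hW : IsGraphon W) :
    ∫ p, (U p.1 p.2 - W p.1 p.2) ^ 2 ∂mu2 = ∫ p, (U p.1 p.2) ^ 2 ∂mu2 - ∫ p, (W p.1 p.2) ^ 2 ∂mu2
      - 2 * ∫ p, W p.1 p.2 * (U p.1 p.2 - W p.1 p.2) ∂mu2 := by
  have mU := hU.bk.meas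
  have mW := hW.bk.meas
  have i1 : Integrable (fun p : ℝ × ℝ => (U p.1 p.2) ^ 2) mu2 :=
    integrable_of_bdd (C := 1) (mU.pow_const 2) fun p => by
      rw [abs_pow]; exact pow_le_one₀ (abs_nonneg _) (hU.abs_le _ _)
  have i2 : Integrable (fun p : ℝ × ℝ => (W p.1 p.2) ^ 2) mu2 :=
    integrable_of_bdd (C := 1) (mW.pow_const 2) fun p => by
      rw [abs_pow]; exact pow_le_one₀ (abs_nonneg _) (hW.abs_le _ _)
  have i3 := (hU.bk.sub hW.bk).mul_integrable (hW.bk.integrable mu2)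
  have i12 : Integrable (fun p : ℝ × ℝ => (U p.1 p.2) ^ 2 - (W p.1 p.2) ^ 2) mu2 := i1.sub i2
  rw [← integral_const_mul, ← integral_sub i1 i2, ← integral_sub i12 (i3.const_mul 2)]
  refine integral_congr_ae (ae_of_all _ fun p => ?_)
  show _ = _
  ring

lemma IsGraphon.compMP {W : ℝ → ℝ → ℝ} (hW : IsGraphon W) (φ : InvMP) :
    IsGraphon fun x y => W (φ.toFun x) (φ.toFun y) :=
  ⟨(hW.bk.comp φ.meas).meas, fun _ _ => hW.2.1 _ _, fun _ _ => hW.2.2 _ _⟩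

lemma l1_of_cut {W W' : ℝ → ℝ → ℝ} (hW : IsGraphon W) (hW' : IsGraphon W') (φ : ℕ → InvMP)
    (h : Tendsto (fun t => cutNorm fun x y => W ((φ t).toFun x) ((φ t).toFun y) - W' x y)
      atTop (𝓝 0)) :
    Tendsto (fun t => l1Norm fun x y => W ((φ t).toFun x) ((φ t).toFun y) - W' x y)
      atTop (𝓝 0) := by
  have ha := weak_fun (fun t => (hW.compMP (φ t)).bk.sub hW'.bk)
    (fun t => (hW.compMP (φ t)).abs_sub_le hW') h (hW'.bk.integrable mu2)
  have h' : Tendsto (fun t => cutNorm fun x y =>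
      W' ((φ t).symm.toFun x) ((φ t).symm.toFun y) - W x y) atTop (𝓝 0) := by
    refine h.congr fun t => ?_
    rw [cutNorm_sub_comm, ← cutNorm_comp (hW'.bk.sub (hW.compMP (φ t)).bk) (φ t).symm]
    refine cutNorm_congr fun x hx y hy => ?_
    show _ - W ((φ t).toFun ((φ t).invFun x)) ((φ t).toFun ((φ t).invFun y)) = _
    rw [(φ t).rightInv x hx, (φ t).rightInv y hy]
  have hb := weak_fun (fun t => (hW'.compMP (φ t).symm).bk.sub hW.bk)
    (fun t => (hW'.compMP (φ t).symm).abs_sub_le hW) h' (hW.bk.integrable mu2)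
  have eqA : ∀ t, ∫ p, (W ((φ t).toFun p.1) ((φ t).toFun p.2) - W' p.1 p.2) ^ 2 ∂mu2
      = ∫ p, (W p.1 p.2) ^ 2 ∂mu2 - ∫ p, (W' p.1 p.2) ^ 2 ∂mu2 - 2 * ∫ p, W' p.1 p.2 *
        (W ((φ t).toFun p.1) ((φ t).toFun p.2) - W' p.1 p.2) ∂mu2 := by
    intro t
    have := l2_expand (hW.compMP (φ t)) hW'
    rw [this]
    congr 2
    exact integral_comp_mp (φ t).mp2 (g := fun p => (W p.1 p.2) ^ 2) (hW.bk.meas.pow_const 2)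
  have eqB : ∀ t, 0 ≤ ∫ p, (W' p.1 p.2) ^ 2 ∂mu2 - ∫ p, (W p.1 p.2) ^ 2 ∂mu2
      - 2 * ∫ p, W p.1 p.2 *
        (W' ((φ t).symm.toFun p.1) ((φ t).symm.toFun p.2) - W p.1 p.2) ∂mu2 := by
    intro t
    have := l2_expand (hW'.compMP (φ t).symm) hW
    have e2 : ∫ p, (W' ((φ t).symm.toFun p.1) ((φ t).symm.toFun p.2)) ^ 2 ∂mu2
      = ∫ p, (W' p.1 p.2) ^ 2 ∂mu2 :=
      integral_comp_mp (φ t).symm.mp2 (g := fun p => (W' p.1 p.2) ^ 2) (hW'.bk.meas.pow_const 2)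
    rw [e2] at this
    rw [← this]
    exact integral_nonneg fun p => sq_nonneg _
  have h1 : 0 ≤ ∫ p, (W' p.1 p.2) ^ 2 ∂mu2 - ∫ p, (W p.1 p.2) ^ 2 ∂mu2 := by
    have := ge_of_tendsto ((hb.const_mul 2).const_sub
      (∫ p, (W' p.1 p.2) ^ 2 ∂mu2 - ∫ p, (W p.1 p.2) ^ 2 ∂mu2)) (Eventually.of_forall eqB)
    simpa using this
  rw [Metric.tendsto_atTop]
  intro ε hε
  have ha' := (ha.const_mul (-2)).mul_const (1 / (2 * ε))
  simp only [mul_zero, zero_mul] at ha'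
  rw [Metric.tendsto_atTop] at ha'
  obtain ⟨N, hN⟩ := ha' (ε / 2) (by positivity)
  refine ⟨N, fun t ht => ?_⟩
  have h2 := hN t ht
  rw [Real.dist_eq, sub_zero] at h2 ⊢
  rw [abs_of_nonneg (l1Norm_nonneg _)]
  refine (l1_le_sqrt ((hW.compMP (φ t)).bk.sub hW'.bk) hε).trans_lt ?_
  rw [eqA t]
  have h3 := (abs_lt.1 h2).2
  have : (∫ p, (W p.1 p.2) ^ 2 ∂mu2 - ∫ p, (W' p.1 p.2) ^ 2 ∂mu2 - 2 * ∫ p, W' p.1 p.2 *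
        (W ((φ t).toFun p.1) ((φ t).toFun p.2) - W' p.1 p.2) ∂mu2) / (2 * ε)
      ≤ (-2 * ∫ p, W' p.1 p.2 *
        (W ((φ t).toFun p.1) ((φ t).toFun p.2) - W' p.1 p.2) ∂mu2) * (1 / (2 * ε)) := by
    rw [mul_one_div]
    gcongr
    linarith
  linarith

lemma weak_compact (W : ℕ → ℝ × ℝ → ℝ) (hm : ∀ t, Measurable (W t))
    (h01 : ∀ t p, W t p ∈ Set.Icc (0 : ℝ) 1) :
    ∃ f : ℝ × ℝ → ℝ, Measurable f ∧ Integrable f mu2 ∧ ∀ A, MeasurableSet A →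
      Tendsto (fun t => ∫ p in A, W t p ∂mu2) (hyperfilter ℕ : Filter ℕ)
        (𝓝 (∫ p in A, f p ∂mu2)) := by
  have hb : ∀ t p, ‖W t p‖ ≤ 1 := fun t p => by
    rw [Real.norm_eq_abs, abs_of_nonneg (h01 t p).1]; exact (h01 t p).2
  have hL : ∀ t, MemLp (W t) 2 mu2 := fun t =>
    MemLp.of_bound (hm t).aestronglyMeasurable 1 (ae_of_all _ (hb t))
  let F : ℕ → Lp ℝ 2 mu2 := fun t => (hL t).toLp (W t)
  have hF : ∀ t, ‖F t‖ ≤ 1 := by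
    intro t
    have := Lp.norm_le_of_ae_bound (f := F t) (C := 1) zero_le_one (by
      filter_upwards [(hL t).coeFn_toLp] with p hp
      rw [hp]; exact hb t p)
    simpa [measureUnivNNReal] using this
  let L : ℕ → WeakDual ℝ (Lp ℝ 2 mu2) := fun t =>
    StrongDual.toWeakDual (InnerProductSpace.toDual ℝ (Lp ℝ 2 mu2) (F t))
  obtain ⟨ℓ, -, hℓ⟩ := (WeakDual.isCompact_closedBall (𝕜 := ℝ) (E := Lp ℝ 2 mu2) 0 1).ultrafilter_le_nhds
    ((hyperfilter ℕ).map L) (by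
      rw [le_principal_iff]
      refine Filter.mem_map.2 (Filter.univ_mem' fun t => ?_)
      simp only [Set.mem_preimage, Metric.mem_closedBall, dist_zero_right]
      show ‖InnerProductSpace.toDual ℝ (Lp ℝ 2 mu2) (F t)‖ ≤ 1
      rw [LinearIsometryEquiv.norm_map]
      exact hF t)
  let f : Lp ℝ 2 mu2 := (InnerProductSpace.toDual ℝ (Lp ℝ 2 mu2)).symm (WeakDual.toStrongDual ℓ)
  refine ⟨f, (Lp.stronglyMeasurable f).measurable,
    (Lp.memLp f).integrable (by norm_num), fun A hA => ?_⟩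
  have h1 : Tendsto L (hyperfilter ℕ : Filter ℕ) (𝓝 ℓ) := hℓ
  have h2 := ((WeakDual.eval_continuous (𝕜 := ℝ)
    (indicatorConstLp 2 hA (measure_ne_top mu2 A) (1 : ℝ))).tendsto ℓ).comp h1
  have e1 : ℓ (indicatorConstLp 2 hA (measure_ne_top mu2 A) (1 : ℝ)) = ∫ p in A, f p ∂mu2 := by
    rw [← L2.inner_indicatorConstLp_one (𝕜 := ℝ) hA (measure_ne_top mu2 A), real_inner_comm]
    exact InnerProductSpace.toDual_symm_apply.symm
  rw [e1] at h2
  refine h2.congr fun t => ?_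
  show (InnerProductSpace.toDual ℝ (Lp ℝ 2 mu2) (F t)) _ = _
  rw [InnerProductSpace.toDual_apply_apply, real_inner_comm, L2.inner_indicatorConstLp_one]
  refine integral_congr_ae (ae_restrict_of_ae ?_)
  exact (hL t).coeFn_toLp

lemma mu2_swap : MeasurePreserving (Prod.swap : ℝ × ℝ → ℝ × ℝ) mu2 mu2 := by
  unfold mu2; exact Measure.measurePreserving_swap

lemma cut_complete (W : ℕ → ℝ → ℝ → ℝ) (hW : ∀ t, IsGraphon (W t))
    (hC : ∀ ε > 0, ∃ N, ∀ s ≥ N, ∀ t ≥ N, cutNorm (fun x y => W s x y - W t x y) ≤ ε) :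
    ∃ U, IsGraphon U ∧ Tendsto (fun t => cutNorm fun x y => W t x y - U x y) atTop (𝓝 0) := by
  obtain ⟨f, hfm, hfi, hf⟩ := weak_compact (fun t p => W t p.1 p.2) (fun t => (hW t).bk.meas)
    (fun t p => (hW t).2.2 _ _)
  have hf0 : ∀ᵐ p ∂mu2, 0 ≤ f p := by
    have := ae_le_of_forall_setIntegral_le (μ := mu2) (f := fun _ => (0 : ℝ)) (g := f)
      (integrable_const _) hfi (fun A hA _ => by
        simp only [integral_zero]
        exact ge_of_tendsto (hf A hA) (Eventually.of_forall fun t =>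
          integral_nonneg fun p => ((hW t).2.2 _ _).1))
    exact this
  have hf1 : ∀ᵐ p ∂mu2, f p ≤ 1 := by
    have := ae_le_of_forall_setIntegral_le (μ := mu2) (f := f) (g := fun _ => (1 : ℝ))
      hfi (integrable_const _) (fun A hA _ => by
        refine le_of_tendsto (hf A hA) (Eventually.of_forall fun t => ?_)
        exact integral_mono ((hW t).bk.integrable _) (integrable_const _)
          fun p => ((hW t).2.2 _ _).2)
    exact this
  let U : ℝ → ℝ → ℝ := fun x y => max 0 (min 1 ((f (x, y) + f (y, x)) / 2))
  have hUm : Measurable fun p : ℝ × ℝ => U p.1 p.2 := by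
    have h2 : Measurable fun p : ℝ × ℝ => f (p.2, p.1) := hfm.comp measurable_swap
    have h1 : Measurable fun p : ℝ × ℝ => f (p.1, p.2) := hfm
    exact measurable_const.max (measurable_const.min ((h1.add h2).div_const 2))
  have hU : IsGraphon U := by
    refine ⟨hUm, fun x y => ?_, fun x y => ?_⟩
    · simp only [U, add_comm]
    · exact ⟨le_max_left _ _, max_le zero_le_one (min_le_left _ _)⟩
  have hUae : ∀ᵐ p ∂mu2, U p.1 p.2 = (f p + f p.swap) / 2 := by
    filter_upwards [hf0, hf1, mu2_swap.quasiMeasurePreserving.ae hf0,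
      mu2_swap.quasiMeasurePreserving.ae hf1] with p h0 h1 h2 h3
    show max 0 (min 1 ((f p + f p.swap) / 2)) = _
    rw [min_eq_right (by linarith), max_eq_right (by linarith)]
  have hfs : Integrable (fun p : ℝ × ℝ => f p.swap) mu2 := mu2_swap.integrable_comp_of_integrable hfi
  have hrect : ∀ S T : Set ℝ, MeasurableSet S → MeasurableSet T →
      Tendsto (fun t => ∫ p in S ×ˢ T, W t p.1 p.2 ∂mu2) (hyperfilter ℕ : Filter ℕ)
        (𝓝 (∫ p in S ×ˢ T, U p.1 p.2 ∂mu2)) := by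
    intro S T hS hT
    have hsw : ∀ g : ℝ × ℝ → ℝ, ∫ p in S ×ˢ T, g p.swap ∂mu2 = ∫ p in T ×ˢ S, g p ∂mu2 := by
      intro g
      have := mu2_swap.setIntegral_preimage_emb
        (MeasurableEquiv.prodComm (α := ℝ) (β := ℝ)).measurableEmbedding g (T ×ˢ S)
      rw [Set.preimage_swap_prod] at this
      exact this
    have h1 := hf (S ×ˢ T) (hS.prod hT)
    have h2 := hf (T ×ˢ S) (hT.prod hS)
    have h3 := (h1.add h2).div_const 2
    have e : (∫ p in S ×ˢ T, f p ∂mu2 + ∫ p in T ×ˢ S, f p ∂mu2) / 2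
        = ∫ p in S ×ˢ T, U p.1 p.2 ∂mu2 := by
      rw [← hsw, ← integral_add hfi.integrableOn hfs.integrableOn, ← integral_div]
      exact (integral_congr_ae (ae_restrict_of_ae hUae)).symm
    rw [e] at h3
    refine h3.congr fun t => ?_
    have : ∫ p in T ×ˢ S, W t p.1 p.2 ∂mu2 = ∫ p in S ×ˢ T, W t p.1 p.2 ∂mu2 := by
      rw [← hsw]
      refine integral_congr_ae (ae_of_all _ fun p => ?_)
      exact (hW t).2.1 _ _
    rw [this]; ring
  refine ⟨U, hU, ?_⟩
  rw [Metric.tendsto_atTop]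
  intro ε hε
  obtain ⟨N, hN⟩ := hC (ε / 2) (by positivity)
  refine ⟨N, fun s hs => ?_⟩
  rw [Real.dist_eq, sub_zero, abs_of_nonneg (cutNorm_nonneg ((hW s).bk.sub hU.bk))]
  refine lt_of_le_of_lt (cutNorm_le ((hW s).bk.sub hU.bk) (c := ε / 2) fun S T hS hT => ?_)
    (by linarith)
  rw [integral_sub ((hW s).bk.integrable _) (hU.bk.integrable _)]
  have h1 := (((hrect S T hS hT).const_sub (∫ p in S ×ˢ T, W s p.1 p.2 ∂mu2))).abs
  refine le_of_tendsto h1 ?_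
  have : ∀ᶠ t in (hyperfilter ℕ : Filter ℕ), N ≤ t := by
    refine Nat.hyperfilter_le_atTop (eventually_ge_atTop N)
  filter_upwards [this] with t ht
  rw [← integral_sub ((hW s).bk.integrable _) ((hW t).bk.integrable _)]
  exact (le_cutNorm ((hW s).bk.sub (hW t).bk) hS hT).trans (hN s hs t ht)

def bv (b : Bool) : ℝ := if b then 1 else 0

lemma bv_01 (b : Bool) : bv b ∈ Set.Icc (0 : ℝ) 1 := by cases b <;> simp [bv]

lemma bv_sq (b : Bool) : bv b * bv b = bv b := by cases b <;> simp [bv]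

def fMat {n : ℕ} (ε : ℝ) (m : ℕ) (P Q T : ℕ → Fin n → Bool) (u v : Fin n) : ℝ :=
  ε * ∑ i ∈ Finset.range m, (bv (P i u) - bv (Q i u)) * bv (T i v)

lemma ext_one {n : ℕ} (r : Fin n → ℝ) : ∃ S : Fin n → Bool, ∀ s : Fin n → ℝ,
    (∀ i, s i ∈ Set.Icc (0 : ℝ) 1) → ∑ i, r i * s i ≤ ∑ i, r i * bv (S i) := by
  refine ⟨fun i => decide (0 ≤ r i), fun s hs => Finset.sum_le_sum fun i _ => ?_⟩
  by_cases h : 0 ≤ r i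
  · simp only [h, bv, decide_true, if_true, mul_one]
    exact mul_le_of_le_one_right h (hs i).2
  · rw [show bv (decide (0 ≤ r i)) = 0 by simp [bv, h], mul_zero]
    exact mul_nonpos_of_nonpos_of_nonneg (not_le.1 h).le (hs i).1

lemma ext_two {n : ℕ} (D : Fin n → Fin n → ℝ) (s t : Fin n → ℝ) (hs : ∀ i, s i ∈ Set.Icc (0 : ℝ) 1)
    (ht : ∀ i, t i ∈ Set.Icc (0 : ℝ) 1) : ∃ S T : Fin n → Bool,
    ∑ i, ∑ j, D i j * (s i * t j) ≤ ∑ i, ∑ j, D i j * (bv (S i) * bv (T j)) := by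
  obtain ⟨S, hS⟩ := ext_one (fun i => ∑ j, D i j * t j)
  obtain ⟨T, hT⟩ := ext_one (fun j => ∑ i, D i j * bv (S i))
  refine ⟨S, T, ?_⟩
  have e1 : ∑ i, ∑ j, D i j * (s i * t j) = ∑ i, (∑ j, D i j * t j) * s i := by
    refine Finset.sum_congr rfl fun i _ => ?_
    rw [Finset.sum_mul]
    exact Finset.sum_congr rfl fun j _ => by ring
  have e2 : ∑ i, (∑ j, D i j * t j) * bv (S i) = ∑ j, (∑ i, D i j * bv (S i)) * t j := by
    simp only [Finset.sum_mul]
    rw [Finset.sum_comm]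
    exact Finset.sum_congr rfl fun j _ => Finset.sum_congr rfl fun i _ => by ring
  have e3 : ∑ j, (∑ i, D i j * bv (S i)) * bv (T j) = ∑ i, ∑ j, D i j * (bv (S i) * bv (T j)) := by
    simp only [Finset.sum_mul]
    rw [Finset.sum_comm]
    exact Finset.sum_congr rfl fun j _ => Finset.sum_congr rfl fun i _ => by ring
  rw [e1, ← e3]
  exact (hS s hs).trans (e2.le.trans (hT t ht))

def GoodApprox {n : ℕ} (ε : ℝ) (D : Fin n → Fin n → ℝ) : Prop :=
  ∀ s t : Fin n → ℝ, (∀ i, s i ∈ Set.Icc (0 : ℝ) 1) → (∀ i, t i ∈ Set.Icc (0 : ℝ) 1) →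
      |∑ i, ∑ j, D i j * (s i * t j)| ≤ ε * n ^ 2

lemma energy_drop {n : ℕ} {ε : ℝ} (hε : 0 < ε) (D : Fin n → Fin n → ℝ) (S T : Fin n → Bool)
    (c : ℝ) (hc : c ^ 2 = 1) (h : ε * n ^ 2 ≤ c * ∑ i, ∑ j, D i j * (bv (S i) * bv (T j))) :
    ∑ i, ∑ j, (D i j - ε * c * (bv (S i) * bv (T j))) ^ 2
      ≤ ∑ i, ∑ j, (D i j) ^ 2 - ε ^ 2 * n ^ 2 := by
  have e : ∀ i j, (D i j - ε * c * (bv (S i) * bv (T j))) ^ 2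
      = (D i j) ^ 2 - 2 * ε * c * (D i j * (bv (S i) * bv (T j)))
        + ε ^ 2 * (bv (S i) * bv (T j)) := by
    intro i j
    have : (bv (S i) * bv (T j)) ^ 2 = bv (S i) * bv (T j) := by
      rw [sq, mul_mul_mul_comm, bv_sq, bv_sq]
    calc _ = (D i j) ^ 2 - 2 * ε * c * (D i j * (bv (S i) * bv (T j)))
        + ε ^ 2 * c ^ 2 * (bv (S i) * bv (T j)) ^ 2 := by ring
      _ = _ := by rw [hc, this, mul_one]
  simp only [e, Finset.sum_add_distrib, Finset.sum_sub_distrib, ← Finset.mul_sum]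
  have h2 : ∑ i, ∑ j, bv (S i) * bv (T j) ≤ (n : ℝ) ^ 2 := by
    calc ∑ i, ∑ j, bv (S i) * bv (T j) ≤ ∑ _i : Fin n, ∑ _j : Fin n, (1 : ℝ) := by
          refine Finset.sum_le_sum fun i _ => Finset.sum_le_sum fun j _ => ?_
          exact mul_le_one₀ (bv_01 _).2 (bv_01 _).1 (bv_01 _).2
      _ = (n : ℝ) ^ 2 := by simp [sq]
  have h2' : ∑ i, bv (S i) * ∑ j, bv (T j) ≤ (n : ℝ) ^ 2 := by
    simpa only [Finset.mul_sum] using h2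
  have h3 := mul_le_mul_of_nonneg_left h2' (sq_nonneg ε)
  have h4 := mul_le_mul_of_nonneg_left h hε.le
  nlinarith

lemma reg_step {n : ℕ} (A : Fin n → Fin n → ℝ) (h01 : ∀ i j, A i j ∈ Set.Icc (0 : ℝ) 1) {ε : ℝ}
    (hε : 0 < ε) (m : ℕ) : ∃ P Q T : ℕ → Fin n → Bool,
      GoodApprox ε (fun u v => A u v - fMat ε m P Q T u v) ∨
      ∑ u, ∑ v, (A u v - fMat ε m P Q T u v) ^ 2 ≤ n ^ 2 - m * (ε ^ 2 * n ^ 2) := by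
  induction m with
  | zero =>
    refine ⟨fun _ _ => false, fun _ _ => false, fun _ _ => false, Or.inr ?_⟩
    simp only [fMat, Finset.range_zero, Finset.sum_empty, mul_zero, sub_zero, Nat.cast_zero,
      zero_mul]
    calc ∑ u, ∑ v, (A u v) ^ 2 ≤ ∑ _i : Fin n, ∑ _j : Fin n, (1 : ℝ) := by
          refine Finset.sum_le_sum fun i _ => Finset.sum_le_sum fun j _ => ?_
          exact pow_le_one₀ (h01 i j).1 (h01 i j).2
      _ = (n : ℝ) ^ 2 := by simp [sq]
  | succ m ih =>
    obtain ⟨P, Q, T, h⟩ := ih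
    have key : ∀ (p q r : Fin n → Bool) (u v : Fin n),
        fMat ε (m + 1) (Function.update P m p) (Function.update Q m q) (Function.update T m r) u v
        = fMat ε m P Q T u v + ε * ((bv (p u) - bv (q u)) * bv (r v)) := by
      intro p q r u v
      unfold fMat
      rw [Finset.sum_range_succ, mul_add]
      simp only [Function.update_self]
      congr 2
      refine Finset.sum_congr rfl fun i hi => ?_
      have : i ≠ m := (Finset.mem_range.1 hi).ne
      rw [Function.update_of_ne this, Function.update_of_ne this, Function.update_of_ne this]
    by_cases hg : GoodApprox ε (fun u v => A u v - fMat ε m P Q T u v)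
    · refine ⟨Function.update P m fun _ => false, Function.update Q m fun _ => false,
        Function.update T m fun _ => false, Or.inl ?_⟩
      simpa [key] using hg
    · have hE := h.resolve_left hg
      unfold GoodApprox at hg
      push Not at hg
      obtain ⟨s, t, hs, ht, hst⟩ := hg
      rcases lt_abs.1 hst with h1 | h1
      · obtain ⟨S, R, hSR⟩ := ext_two (fun u v => A u v - fMat ε m P Q T u v) s t hs ht
        refine ⟨Function.update P m S, Function.update Q m fun _ => false, Function.update T m R,
          Or.inr ?_⟩
        have := energy_drop hε (fun u v => A u v - fMat ε m P Q T u v) S R 1 (by norm_num)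
          (by rw [one_mul]; exact h1.le.trans hSR)
        refine le_trans (le_of_eq ?_) (this.trans ?_)
        · refine Finset.sum_congr rfl fun u _ => Finset.sum_congr rfl fun v _ => ?_
          rw [key, show bv false = 0 from rfl]; ring
        · push_cast; linarith
      · obtain ⟨S, R, hSR⟩ := ext_two (fun u v => -(A u v - fMat ε m P Q T u v)) s t hs ht
        refine ⟨Function.update P m fun _ => false, Function.update Q m S, Function.update T m R,
          Or.inr ?_⟩
        have := energy_drop hε (fun u v => A u v - fMat ε m P Q T u v) S R (-1) (by norm_num)
          (by
            simp only [neg_mul, Finset.sum_neg_distrib] at hSR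
            rw [neg_one_mul]; exact h1.le.trans hSR)
        refine le_trans (le_of_eq ?_) (this.trans ?_)
        · refine Finset.sum_congr rfl fun u _ => Finset.sum_congr rfl fun v _ => ?_
          rw [key, show bv false = 0 from rfl]; ring
        · push_cast; linarith

def lev (s : ℕ) : ℝ := 1 / ((s : ℝ) + 1)
def levm (s : ℕ) : ℕ := (s + 1) ^ 2 + 1

lemma lev_pos (s : ℕ) : 0 < lev s := by unfold lev; positivity

lemma reg {n : ℕ} (A : Fin n → Fin n → ℝ) (h01 : ∀ i j, A i j ∈ Set.Icc (0 : ℝ) 1) (s : ℕ) :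
    ∃ P Q T : ℕ → Fin n → Bool,
      GoodApprox (lev s) (fun u v => A u v - fMat (lev s) (levm s) P Q T u v) := by
  rcases Nat.eq_zero_or_pos n with rfl | hn
  · exact ⟨fun _ _ => false, fun _ _ => false, fun _ _ => false, fun a b _ _ => by simp⟩
  obtain ⟨P, Q, T, h⟩ := reg_step A h01 (lev_pos s) (levm s)
  refine ⟨P, Q, T, h.resolve_right fun hE => ?_⟩
  have h0 : 0 ≤ ∑ u, ∑ v, (A u v - fMat (lev s) (levm s) P Q T u v) ^ 2 :=
    Finset.sum_nonneg fun u _ => Finset.sum_nonneg fun v _ => sq_nonneg _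
  have hn' : (0 : ℝ) < n := by exact_mod_cast hn
  have e : (levm s : ℝ) * (lev s ^ 2 * n ^ 2) = n ^ 2 + lev s ^ 2 * n ^ 2 := by
    unfold levm lev
    push_cast
    field_simp
  rw [e] at hE
  have : 0 < lev s ^ 2 * (n : ℝ) ^ 2 := by have := lev_pos s; positivity
  linarith

def code {n : ℕ} (b : ℕ → Fin n → Bool) : ℕ → Fin n → ℕ
  | 0, _ => 0
  | j + 1, v => 2 * code b j v + (if b j v then 1 else 0)

lemma code_lt {n : ℕ} (b : ℕ → Fin n → Bool) (j : ℕ) (v : Fin n) : code b j v < 2 ^ j := by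
  induction j with
  | zero => simp [code]
  | succ j ih =>
    rw [code, pow_succ]
    split_ifs <;> omega

lemma code_mono {n : ℕ} (b : ℕ → Fin n → Bool) (σ : Equiv.Perm (Fin n)) (j d : ℕ)
    (h : Monotone fun v => code b (j + d) (σ v)) : Monotone fun v => code b j (σ v) := by
  induction d with
  | zero => exact h
  | succ d ih =>
    refine ih fun u v huv => ?_
    have : 2 * code b (j + d) (σ u) + (if b (j + d) (σ u) then 1 else 0)
        ≤ 2 * code b (j + d) (σ v) + (if b (j + d) (σ v) then 1 else 0) := h huv
    show code b (j + d) (σ u) ≤ code b (j + d) (σ v)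
    split_ifs at this <;> omega

lemma bit_eq {n : ℕ} (b : ℕ → Fin n → Bool) (j : ℕ) (v : Fin n) :
    bv (b j v) = ∑ a ∈ Finset.range (2 ^ j), ((if code b (j + 1) v ≤ 2 * a + 1 then (1 : ℝ) else 0)
      - (if code b (j + 1) v ≤ 2 * a then (1 : ℝ) else 0)) := by
  have e : ∀ a, ((if code b (j + 1) v ≤ 2 * a + 1 then (1 : ℝ) else 0)
      - (if code b (j + 1) v ≤ 2 * a then (1 : ℝ) else 0))
      = if a = code b j v then bv (b j v) else 0 := by
    intro a
    rw [code, bv]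
    cases b j v <;> simp only [Bool.false_eq_true, if_false, if_true] <;> split_ifs <;>
      first | omega | norm_num
  simp only [e]
  rw [Finset.sum_ite_eq' (Finset.range (2 ^ j)) (code b j v) (fun _ => bv (b j v)),
    if_pos (Finset.mem_range.2 (code_lt b j v))]

def brk {n : ℕ} (b : ℕ → Fin n → Bool) (σ : Equiv.Perm (Fin n)) (j a : ℕ) : ℝ :=
  ((Finset.univ.filter fun v => code b j (σ v) ≤ a).card : ℝ) / n

lemma brk_mem {n : ℕ} (b : ℕ → Fin n → Bool) (σ : Equiv.Perm (Fin n)) (j a : ℕ) :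
    brk b σ j a ∈ Set.Icc (0 : ℝ) 1 := by
  unfold brk
  refine ⟨by positivity, div_le_one_of_le₀ ?_ (by positivity)⟩
  have := Finset.card_filter_le (Finset.univ : Finset (Fin n)) fun v => code b j (σ v) ≤ a
  rw [Finset.card_univ, Fintype.card_fin] at this
  exact_mod_cast this

lemma brk_iff {n : ℕ} (b : ℕ → Fin n → Bool) (σ : Equiv.Perm (Fin n)) (j a : ℕ)
    (h : Monotone fun v => code b j (σ v)) {v : Fin n} {x : ℝ} (hx : x ∈ J n v) :
    code b j (σ v) ≤ a ↔ x ≤ brk b σ j a := by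
  have hn : (0 : ℝ) < n := by exact_mod_cast (Nat.zero_le _).trans_lt v.2
  have key : (v : ℕ) < (Finset.univ.filter fun v => code b j (σ v) ≤ a).card ↔ code b j (σ v) ≤ a :=
    Tuple.lt_card_le_iff_apply_le_of_monotone (f := fun v => code b j (σ v)) h
  rw [← key, brk]
  obtain ⟨h1, h2⟩ := hx
  constructor
  · intro hv
    refine h2.trans (div_le_div_of_nonneg_right ?_ hn.le)
    exact_mod_cast hv
  · intro hv
    have := h1.trans_le hv
    rw [div_lt_div_iff_of_pos_right hn] at this
    exact_mod_cast this

lemma sort_conv (n : ℕ → ℕ) (hn : ∀ t, 0 < n t) (b : ∀ t, ℕ → Fin (n t) → Bool) :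
    ∃ ψ : ℕ → ℕ, StrictMono ψ ∧ ∃ σ : ∀ t, Equiv.Perm (Fin (n t)), ∀ l, ∀ᵐ x ∂mu1, ∃ g,
      Tendsto (fun t => step1 (n (ψ t)) (fun v => bv (b (ψ t) l (σ (ψ t) v))) x) atTop (𝓝 g) := by
  let σ : ∀ t, Equiv.Perm (Fin (n t)) := fun t => Tuple.sort (code (b t) t)
  have hσ : ∀ t j, j ≤ t → Monotone fun v => code (b t) j (σ t v) := by
    intro t j hj
    obtain ⟨d, rfl⟩ := Nat.exists_eq_add_of_le hj
    exact code_mono _ _ j d (Tuple.monotone_sort (code (b (j + d)) (j + d)))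
  let β : ℕ → (ℕ × ℕ → ℝ) := fun t p => brk (b t) (σ t) p.1 p.2
  have hc : IsCompact (Set.univ.pi fun _ : ℕ × ℕ => Set.Icc (0 : ℝ) 1) :=
    isCompact_univ_pi fun _ => isCompact_Icc
  obtain ⟨β', -, ψ, hψ, hlim⟩ := hc.tendsto_subseq (x := β) fun t p _ => brk_mem _ _ _ _
  rw [tendsto_pi_nhds] at hlim
  refine ⟨ψ, hψ, σ, fun l => ?_⟩
  have hcount : ∀ᵐ x ∂mu1, x ∉ Set.range β' :=
    (ae_restrict_of_ae ((Set.countable_range β').ae_notMem volume))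
  have hmem : ∀ᵐ x ∂mu1, x ∈ Set.Ioc (0 : ℝ) 1 := by
    rw [mu1_eq_Ioc]; exact ae_restrict_mem measurableSet_Ioc
  filter_upwards [hcount, hmem] with x hx hx1
  have hind : ∀ a : ℕ, ∃ g : ℝ, Tendsto (fun t => if x ≤ β (ψ t) (l + 1, a) then (1 : ℝ) else 0) atTop
      (𝓝 g) := by
    intro a
    have hne : x ≠ β' (l + 1, a) := fun h => hx ⟨_, h.symm⟩
    rcases lt_or_gt_of_ne hne with h | h
    · refine ⟨1, tendsto_const_nhds.congr' ?_⟩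
      filter_upwards [(hlim (l + 1, a)).eventually (lt_mem_nhds h)] with t ht
      rw [if_pos]; exact ht.le
    · refine ⟨0, tendsto_const_nhds.congr' ?_⟩
      filter_upwards [(hlim (l + 1, a)).eventually (gt_mem_nhds h)] with t ht
      rw [if_neg]; exact not_le.2 ht
  choose g hg using hind
  refine ⟨∑ a ∈ Finset.range (2 ^ l), (g (2 * a + 1) - g (2 * a)), ?_⟩
  refine (tendsto_finsetSum (Finset.range (2 ^ l)) fun a _ =>
    (hg (2 * a + 1)).sub (hg (2 * a))).congr' ?_
  filter_upwards [eventually_ge_atTop (l + 1)] with t ht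
  obtain ⟨v, hv⟩ := exists_J (hn (ψ t)) hx1
  rw [step1_mem _ hv, bit_eq]
  have hm := hσ (ψ t) (l + 1) (ht.trans (hψ.id_le t))
  refine Finset.sum_congr rfl fun a _ => ?_
  simp only [brk_iff (b (ψ t)) (σ (ψ t)) (l + 1) _ hm hv]
  rfl

lemma stepK_fMat {n : ℕ} (ε : ℝ) (m : ℕ) (P Q T : ℕ → Fin n → Bool) (σ : Equiv.Perm (Fin n)) (x y : ℝ) :
    stepK n (fun u v => fMat ε m P Q T (σ u) (σ v)) x y
      = ε * ∑ i ∈ Finset.range m, (step1 n (fun v => bv (P i (σ v))) x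
        - step1 n (fun v => bv (Q i (σ v))) x) * step1 n (fun v => bv (T i (σ v))) y := by
  by_cases hx : ∃ u, x ∈ J n u
  · by_cases hy : ∃ v, y ∈ J n v
    · obtain ⟨u, hu⟩ := hx
      obtain ⟨v, hv⟩ := hy
      rw [stepK_mem _ hu hv, fMat]
      simp only [step1_mem _ hu, step1_mem _ hv]
    · push Not at hy
      rw [stepK_notMem _ (Or.inr hy)]
      simp only [step1_notMem _ hy, mul_zero, Finset.sum_const_zero]
  · push Not at hx
    rw [stepK_notMem _ (Or.inl hx)]
    simp only [step1_notMem _ hx, sub_zero, zero_mul, Finset.sum_const_zero, mul_zero]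

lemma step1_bv {n : ℕ} (b : Fin n → Bool) (x : ℝ) :
    step1 n (fun v => bv (b v)) x ∈ Set.Icc (0 : ℝ) 1 := by
  by_cases hx : ∃ u, x ∈ J n u
  · obtain ⟨u, hu⟩ := hx
    rw [step1_mem _ hu]; exact bv_01 _
  · push Not at hx
    rw [step1_notMem _ hx]; simp

lemma fMat_bound {n : ℕ} {ε : ℝ} (hε : 0 ≤ ε) (m : ℕ) (P Q T : ℕ → Fin n → Bool)
    (σ : Equiv.Perm (Fin n)) (x y : ℝ) :
    |stepK n (fun u v => fMat ε m P Q T (σ u) (σ v)) x y| ≤ ε * m := by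
  rw [stepK_fMat, abs_mul, abs_of_nonneg hε]
  refine mul_le_mul_of_nonneg_left ?_ hε
  refine (Finset.abs_sum_le_sum_abs _ _).trans ?_
  calc _ ≤ ∑ i ∈ Finset.range m, (1 : ℝ) := Finset.sum_le_sum fun i _ => by
        have h1 := step1_bv (fun v => P i (σ v)) x
        have h2 := step1_bv (fun v => Q i (σ v)) x
        have h3 := step1_bv (fun v => T i (σ v)) y
        rw [abs_mul]
        refine mul_le_one₀ ?_ (abs_nonneg _) ?_
        · rw [abs_le]; constructor <;> linarith [h1.1, h1.2, h2.1, h2.2]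
        · rw [abs_le]; constructor <;> linarith [h3.1, h3.2]
    _ = m := by simp

lemma approx_cut {n : ℕ} (hn : 0 < n) (A : SimpleGraph (Fin n)) (σ : Equiv.Perm (Fin n)) {ε : ℝ}
    (f : Fin n → Fin n → ℝ) (h : GoodApprox ε fun u v => adj01 A u v - f u v) :
    cutNorm (fun x y => graphonOf (A.comap σ) x y - stepK n (fun u v => f (σ u) (σ v)) x y) ≤ ε := by
  rw [graphonOf_eq]
  simp only [stepK_sub]
  refine cutNorm_stepK_le _ (fun s t hs ht => ?_) hn
  have := h (fun i => s (σ.symm i)) (fun i => t (σ.symm i)) (fun i => hs _) (fun i => ht _)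
  refine le_trans (le_of_eq ?_) this
  congr 1
  symm
  rw [← Equiv.sum_comp σ]
  refine Finset.sum_congr rfl fun i _ => ?_
  rw [← Equiv.sum_comp σ]
  refine Finset.sum_congr rfl fun j _ => ?_
  simp only [Equiv.symm_apply_apply]
  rfl

lemma l1_cauchy (f : ℕ → ℝ → ℝ → ℝ) (hf : ∀ t, BK (f t)) (C : ℝ) (hC : ∀ t x y, |f t x y| ≤ C)
    (hlim : ∀ᵐ p ∂mu2, ∃ g, Tendsto (fun t => f t p.1 p.2) atTop (𝓝 g)) (ε : ℝ) (hε : 0 < ε) :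
    ∃ N, ∀ s ≥ N, ∀ t ≥ N, l1Norm (fun x y => f s x y - f t x y) ≤ ε := by
  have key : Tendsto (fun q : ℕ × ℕ => ∫ p, |f q.1 p.1 p.2 - f q.2 p.1 p.2| ∂mu2)
      (atTop ×ˢ atTop) (𝓝 (∫ _p : ℝ × ℝ, (0 : ℝ) ∂mu2)) := by
    refine tendsto_integral_filter_of_dominated_convergence (fun _ => 2 * C) ?_ ?_ ?_ ?_
    · refine Eventually.of_forall fun q => ?_
      exact (((hf q.1).sub (hf q.2)).integrable mu2).abs.aestronglyMeasurable
    · refine Eventually.of_forall fun q => Eventually.of_forall fun p => ?_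
      rw [Real.norm_eq_abs, abs_abs]
      have := abs_sub (f q.1 p.1 p.2) (f q.2 p.1 p.2)
      linarith [hC q.1 p.1 p.2, hC q.2 p.1 p.2]
    · exact integrable_const _
    · filter_upwards [hlim] with p ⟨g, hg⟩
      have h1 : Tendsto (fun q : ℕ × ℕ => f q.1 p.1 p.2) (atTop ×ˢ atTop) (𝓝 g) :=
        hg.comp tendsto_fst
      have h2 : Tendsto (fun q : ℕ × ℕ => f q.2 p.1 p.2) (atTop ×ˢ atTop) (𝓝 g) :=
        hg.comp tendsto_snd
      simpa using (h1.sub h2).abs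
  rw [integral_zero] at key
  have := key.eventually (gt_mem_nhds hε)
  rw [prod_atTop_atTop_eq, eventually_atTop] at this
  obtain ⟨⟨a, b⟩, hab⟩ := this
  refine ⟨max a b, fun s hs t ht => ?_⟩
  rw [l1Norm_eq ((hf s).sub (hf t))]
  exact (hab (s, t) ⟨(le_max_left _ _).trans hs, (le_max_right _ _).trans ht⟩).le

lemma conv_one (n : ℕ → ℕ) (hn : ∀ t, 0 < n t) (A : ∀ t, SimpleGraph (Fin (n t)))
    (σ : ∀ t, Equiv.Perm (Fin (n t))) (P Q T : ∀ t, ℕ → ℕ → Fin (n t) → Bool)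
    (hg : ∀ t s, GoodApprox (lev s) (fun u v => adj01 (A t) u v
      - fMat (lev s) (levm s) (P t s) (Q t s) (T t s) u v))
    (hP : ∀ s i, ∀ᵐ x ∂mu1, ∃ g,
      Tendsto (fun t => step1 (n t) (fun v => bv (P t s i (σ t v))) x) atTop (𝓝 g))
    (hQ : ∀ s i, ∀ᵐ x ∂mu1, ∃ g,
      Tendsto (fun t => step1 (n t) (fun v => bv (Q t s i (σ t v))) x) atTop (𝓝 g))
    (hT : ∀ s i, ∀ᵐ x ∂mu1, ∃ g,
      Tendsto (fun t => step1 (n t) (fun v => bv (T t s i (σ t v))) x) atTop (𝓝 g)) :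
    ∃ U, IsGraphon U ∧ Tendsto (fun t => cutNorm fun x y =>
      graphonOf ((A t).comap (σ t)) x y - U x y) atTop (𝓝 0) := by
  refine cut_complete _ (fun t => graphonOf_graphon _) fun ε hε => ?_
  obtain ⟨s, hs⟩ : ∃ s : ℕ, lev s < ε / 3 := exists_nat_one_div_lt (by positivity)
  let f : ℕ → ℝ → ℝ → ℝ := fun t =>
    stepK (n t) (fun u v => fMat (lev s) (levm s) (P t s) (Q t s) (T t s) (σ t u) (σ t v))
  have hfb : ∀ t, BK (f t) := fun t => stepK_bk _ _
  have hlim : ∀ᵐ p ∂mu2, ∃ g, Tendsto (fun t => f t p.1 p.2) atTop (𝓝 g) := by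
    have h1 : ∀ᵐ p ∂mu2, ∀ i, ∃ g,
      Tendsto (fun t => step1 (n t) (fun v => bv (P t s i (σ t v))) p.1) atTop (𝓝 g) :=
      Measure.quasiMeasurePreserving_fst.ae (ae_all_iff.2 (hP s))
    have h2 : ∀ᵐ p ∂mu2, ∀ i, ∃ g,
      Tendsto (fun t => step1 (n t) (fun v => bv (Q t s i (σ t v))) p.1) atTop (𝓝 g) :=
      Measure.quasiMeasurePreserving_fst.ae (ae_all_iff.2 (hQ s))
    have h3 : ∀ᵐ p ∂mu2, ∀ i, ∃ g,
      Tendsto (fun t => step1 (n t) (fun v => bv (T t s i (σ t v))) p.2) atTop (𝓝 g) :=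
      Measure.quasiMeasurePreserving_snd.ae (ae_all_iff.2 (hT s))
    filter_upwards [h1, h2, h3] with p a b c
    choose a ha using a
    choose b hb using b
    choose c hc using c
    refine ⟨lev s * ∑ i ∈ Finset.range (levm s), (a i - b i) * c i, ?_⟩
    simp only [f, stepK_fMat]
    exact (tendsto_finsetSum _ fun i _ => ((ha i).sub (hb i)).mul (hc i)).const_mul _
  obtain ⟨N, hN⟩ := l1_cauchy f hfb (lev s * levm s)
    (fun t x y => fMat_bound (lev_pos s).le _ _ _ _ _ _ _) hlim (ε / 3) (by positivity)
  refine ⟨N, fun t ht t' ht' => ?_⟩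
  have k := fun t => approx_cut (hn t) (A t) (σ t) _ (hg t s)
  have e0 := fun t => (graphonOf_graphon ((A t).comap (σ t))).bk
  have e1 := cutNorm_triangle (e0 t) (hfb t) (e0 t')
  have e2 := cutNorm_triangle (hfb t) (hfb t') (e0 t')
  have e3 := (cutNorm_le_l1 ((hfb t).sub (hfb t'))).trans (hN t ht t' ht')
  have e4 := cutNorm_sub_comm (f t') (graphonOf ((A t').comap (σ t')))
  have e5 := k t
  have e6 := k t'
  change cutNorm (fun x y => graphonOf ((A t).comap (σ t)) x y - f t x y) ≤ _ at e5
  change cutNorm (fun x y => graphonOf ((A t').comap (σ t')) x y - f t' x y) ≤ _ at e6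
  linarith

lemma compact_pair (n : ℕ → ℕ) (hn : ∀ t, 0 < n t) (A B : ∀ t, SimpleGraph (Fin (n t))) :
    ∃ ψ : ℕ → ℕ, StrictMono ψ ∧ ∃ σ : ∀ t, Equiv.Perm (Fin (n t)), ∃ W U, IsGraphon W ∧ IsGraphon U ∧
      Tendsto (fun t => cutNorm fun x y =>
        graphonOf ((A (ψ t)).comap (σ (ψ t))) x y - W x y) atTop (𝓝 0) ∧
      Tendsto (fun t => cutNorm fun x y =>
        graphonOf ((B (ψ t)).comap (σ (ψ t))) x y - U x y) atTop (𝓝 0) := by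
  have h01 : ∀ {n : ℕ} (G : SimpleGraph (Fin n)) (i j), adj01 G i j ∈ Set.Icc (0 : ℝ) 1 := by
    intro n G i j
    unfold adj01
    split_ifs <;> simp
  choose P Q T hA using fun t s => reg (adj01 (A t)) (h01 (A t)) s
  choose P' Q' T' hB using fun t s => reg (adj01 (B t)) (h01 (B t)) s
  let pk : ∀ t, Fin 6 → ℕ → ℕ → Fin (n t) → Bool := fun t => ![P t, Q t, T t, P' t, Q' t, T' t]
  let b : ∀ t, ℕ → Fin (n t) → Bool := fun t l =>
    match (Encodable.decode (α := Fin 6 × ℕ × ℕ) l) with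
    | none => fun _ => false
    | some q => pk t q.1 q.2.1 q.2.2
  have hb : ∀ t c s i, b t (Encodable.encode ((c, s, i) : Fin 6 × ℕ × ℕ)) = pk t c s i := by
    intro t c s i
    simp only [b, Encodable.encodek]
  obtain ⟨ψ, hψ, σ, hσ⟩ := sort_conv n hn b
  have hc : ∀ c s i, ∀ᵐ x ∂mu1, ∃ g, Tendsto (fun t => step1 (n (ψ t))
      (fun v => bv (pk (ψ t) c s i (σ (ψ t) v))) x) atTop (𝓝 g) := by
    intro c s i
    have := hσ (Encodable.encode ((c, s, i) : Fin 6 × ℕ × ℕ))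
    simpa only [hb] using this
  obtain ⟨W, hW, hW'⟩ := conv_one (fun t => n (ψ t)) (fun t => hn _) (fun t => A (ψ t))
    (fun t => σ (ψ t)) (fun t => P (ψ t)) (fun t => Q (ψ t)) (fun t => T (ψ t)) (fun t s => hA _ _)
    (hc 0) (hc 1) (hc 2)
  obtain ⟨U, hU, hU'⟩ := conv_one (fun t => n (ψ t)) (fun t => hn _) (fun t => B (ψ t))
    (fun t => σ (ψ t)) (fun t => P' (ψ t)) (fun t => Q' (ψ t)) (fun t => T' (ψ t)) (fun t s => hB _ _)
    (hc 3) (hc 4) (hc 5)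
  exact ⟨ψ, hψ, σ, W, U, hW, hU, hW', hU'⟩

lemma vertex_round {E : Type*} [DecidableEq E] (Q : (E → ℝ) → ℝ)
    (hQ : ∀ a e x, Q (Function.update a e x)
      = (1 - x) * Q (Function.update a e 0) + x * Q (Function.update a e 1))
    (s : Finset E) (a : E → ℝ) (ha : ∀ e, a e ∈ Set.Icc (0 : ℝ) 1) :
    ∃ a' : E → ℝ, (∀ e ∈ s, a' e = 0 ∨ a' e = 1) ∧ (∀ e, a' e ∈ Set.Icc (0 : ℝ) 1) ∧ Q a' ≤ Q a := by
  induction s using Finset.induction_on with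
  | empty => exact ⟨a, by simp, ha, le_rfl⟩
  | insert e s he ih =>
    obtain ⟨b, hb1, hb2, hb3⟩ := ih
    have h := hQ b e (b e)
    rw [Function.update_eq_self] at h
    have h0 := (hb2 e).1
    have h1 := (hb2 e).2
    have hx : ∃ x : ℝ, (x = 0 ∨ x = 1) ∧ Q (Function.update b e x) ≤ Q b := by
      by_contra hcon
      push Not at hcon
      have k0 := hcon 0 (Or.inl rfl)
      have k1 := hcon 1 (Or.inr rfl)
      rcases h0.eq_or_lt with h0 | h0
      · rw [← h0] at h; linarith
      · nlinarith
    obtain ⟨x, hx01, hx⟩ := hx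
    refine ⟨Function.update b e x, fun f hf => ?_, fun f => ?_, hx.trans hb3⟩
    · by_cases hfe : f = e
      · subst hfe; simpa using hx01
      · rw [Function.update_of_ne hfe]
        exact hb1 f ((Finset.mem_insert.1 hf).resolve_left hfe)
    · by_cases hfe : f = e
      · subst hfe; rw [Function.update_self]; rcases hx01 with rfl | rfl <;> simp
      · rw [Function.update_of_ne hfe]; exact hb2 f

def dd {n : ℕ} (p a : Sym2 (Fin n) → ℝ) (i j : Fin n) : ℝ :=
  if i = j then 0 else a s(i, j) - p s(i, j)

lemma dd_symm {n : ℕ} (p a : Sym2 (Fin n) → ℝ) (i j : Fin n) : dd p a i j = dd p a j i := by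
  unfold dd
  rw [Sym2.eq_swap]
  simp only [eq_comm]

def QQ {n : ℕ} (p a : Sym2 (Fin n) → ℝ) : ℝ :=
  ∑ i, ∑ j, ∑ k, ∑ l, if i ≠ j ∧ j ≠ k ∧ k ≠ l ∧ l ≠ i ∧ i ≠ k ∧ j ≠ l then
    (a s(i, j) - p s(i, j)) * (a s(j, k) - p s(j, k)) * (a s(k, l) - p s(k, l)) * (a s(l, i) - p s(l, i))
    else 0

lemma four_affine {E : Type*} [DecidableEq E] (p a : E → ℝ) (e e1 e2 e3 e4 : E) (x : ℝ)
    (h12 : e1 ≠ e2) (h13 : e1 ≠ e3) (h14 : e1 ≠ e4) (h23 : e2 ≠ e3) (h24 : e2 ≠ e4) (h34 : e3 ≠ e4)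
    (F : (E → ℝ) → ℝ)
    (hF : ∀ a, F a = (a e1 - p e1) * (a e2 - p e2) * (a e3 - p e3) * (a e4 - p e4)) :
    F (Function.update a e x)
      = (1 - x) * F (Function.update a e 0) + x * F (Function.update a e 1) := by
  simp only [hF]
  by_cases k1 : e1 = e
  · subst k1
    simp only [Function.update_self, Function.update_of_ne h12.symm, Function.update_of_ne h13.symm,
      Function.update_of_ne h14.symm]
    ring
  by_cases k2 : e2 = e
  · subst k2
    simp only [Function.update_self, Function.update_of_ne h12, Function.update_of_ne h23.symm,
      Function.update_of_ne h24.symm]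
    ring
  by_cases k3 : e3 = e
  · subst k3
    simp only [Function.update_self, Function.update_of_ne h13, Function.update_of_ne h23,
      Function.update_of_ne h34.symm]
    ring
  by_cases k4 : e4 = e
  · subst k4
    simp only [Function.update_self, Function.update_of_ne h14, Function.update_of_ne h24,
      Function.update_of_ne h34]
    ring
  · simp only [Function.update_of_ne k1, Function.update_of_ne k2, Function.update_of_ne k3,
      Function.update_of_ne k4]
    ring

lemma QQ_affine {n : ℕ} (p a : Sym2 (Fin n) → ℝ) (e : Sym2 (Fin n)) (x : ℝ) :
    QQ p (Function.update a e x)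
      = (1 - x) * QQ p (Function.update a e 0) + x * QQ p (Function.update a e 1) := by
  unfold QQ
  simp only [Finset.mul_sum, ← Finset.sum_add_distrib]
  refine Finset.sum_congr rfl fun i _ => Finset.sum_congr rfl fun j _ =>
    Finset.sum_congr rfl fun k _ => Finset.sum_congr rfl fun l _ => ?_
  split_ifs with h
  · obtain ⟨h1, h2, h3, h4, h5, h6⟩ := h
    refine four_affine p a e s(i, j) s(j, k) s(k, l) s(l, i) x ?_ ?_ ?_ ?_ ?_ ?_ (fun a =>
      (a s(i, j) - p s(i, j)) * (a s(j, k) - p s(j, k)) * (a s(k, l) - p s(k, l))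
        * (a s(l, i) - p s(l, i))) (fun _ => rfl) <;>
    · simp only [ne_eq, Sym2.eq_iff]
      grind
  · ring

lemma QQ_self {n : ℕ} (p : Sym2 (Fin n) → ℝ) : QQ p p = 0 := by
  unfold QQ
  simp

lemma four_total {n : ℕ} (p a : Sym2 (Fin n) → ℝ) (hp : ∀ e, p e ∈ Set.Icc (0 : ℝ) 1)
    (ha : ∀ e, a e ∈ Set.Icc (0 : ℝ) 1) :
    ∑ i, ∑ j, ∑ k, ∑ l, dd p a i j * dd p a j k * dd p a k l * dd p a l i
      ≤ QQ p a + 2 * (n : ℝ) ^ 3 := by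
  have hb : ∀ i j, |dd p a i j| ≤ 1 := by
    intro i j
    unfold dd
    split_ifs
    · simp
    · have h1 := hp s(i, j)
      have h2 := ha s(i, j)
      rw [abs_le]; constructor <;> linarith [h1.1, h1.2, h2.1, h2.2]
  have hb4 : ∀ i j k l, dd p a i j * dd p a j k * dd p a k l * dd p a l i ≤ 1 := by
    intro i j k l
    refine (le_abs_self _).trans ?_
    rw [abs_mul, abs_mul, abs_mul]
    refine mul_le_one₀ (mul_le_one₀ (mul_le_one₀ (hb _ _) (abs_nonneg _) (hb _ _))
      (abs_nonneg _) (hb _ _)) (abs_nonneg _) (hb _ _)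
  have e : ∑ i : Fin n, ∑ j : Fin n, ∑ k : Fin n, ∑ l : Fin n,
      (((if i = k then 1 else 0) + (if j = l then 1 else 0) : ℝ)) = 2 * (n : ℝ) ^ 3 := by
    simp only [Finset.sum_add_distrib, Finset.sum_const, Finset.sum_ite_eq, Finset.mem_univ, if_true,
      Finset.card_univ, Fintype.card_fin, nsmul_eq_mul, mul_ite, mul_one, mul_zero]
    ring
  rw [← e, QQ]
  simp only [← Finset.sum_add_distrib]
  refine Finset.sum_le_sum fun i _ => Finset.sum_le_sum fun j _ =>
    Finset.sum_le_sum fun k _ => Finset.sum_le_sum fun l _ => ?_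
  by_cases h1 : i = k
  · rw [if_neg (by tauto), if_pos h1]
    have := hb4 i j k l
    split_ifs <;> linarith
  by_cases h2 : j = l
  · rw [if_neg (by tauto), if_pos h2]
    have := hb4 i j k l
    split_ifs <;> linarith
  rw [if_neg h1, if_neg h2]
  split_ifs with h
  · obtain ⟨k1, k2, k3, k4, k5, k6⟩ := h
    unfold dd
    rw [if_neg k1, if_neg k2, if_neg k3, if_neg k4]; linarith
  · have : i = j ∨ j = k ∨ k = l ∨ l = i := by tauto
    unfold dd
    rcases this with h | h | h | h <;> simp [h]

lemma cs_four {n : ℕ} (D : Fin n → Fin n → ℝ) (s t : Fin n → ℝ) (hs : ∀ i, s i ∈ Set.Icc (0 : ℝ) 1)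
    (ht : ∀ i, t i ∈ Set.Icc (0 : ℝ) 1) (hD : ∀ i j, D i j = D j i) :
    (∑ i, ∑ j, D i j * (s i * t j)) ^ 4 ≤ (n : ℝ) ^ 4 *
      ∑ i, ∑ j, ∑ k, ∑ l, D i j * D j k * D k l * D l i := by
  have sq1 : ∀ (x : ℝ), x ∈ Set.Icc (0 : ℝ) 1 → x ^ 2 ≤ 1 := fun x hx => pow_le_one₀ hx.1 hx.2
  have hs2 : ∑ i, s i ^ 2 ≤ (n : ℝ) := by
    calc ∑ i, s i ^ 2 ≤ ∑ _i : Fin n, (1 : ℝ) := Finset.sum_le_sum fun i _ => sq1 _ (hs i)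
      _ = n := by simp
  have step1' : (∑ i, ∑ j, D i j * (s i * t j)) ^ 2 ≤ n * ∑ i, (∑ j, D i j * t j) ^ 2 := by
    have e : ∑ i, ∑ j, D i j * (s i * t j) = ∑ i, s i * ∑ j, D i j * t j :=
      Finset.sum_congr rfl fun i _ => by
        rw [Finset.mul_sum]; exact Finset.sum_congr rfl fun j _ => by ring
    rw [e]
    refine (Finset.sum_mul_sq_le_sq_mul_sq _ _ _).trans ?_
    exact mul_le_mul_of_nonneg_right hs2 (Finset.sum_nonneg fun i _ => sq_nonneg _)
  have e2 : ∑ i, (∑ j, D i j * t j) ^ 2 = ∑ q : Fin n × Fin n, (t q.1 * t q.2) * ∑ i, D i q.1 * D i q.2 := by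
    rw [Fintype.sum_prod_type]
    have : ∀ i, (∑ j, D i j * t j) ^ 2 = ∑ j, ∑ l, D i j * t j * (D i l * t l) := fun i => by
      rw [sq, Finset.sum_mul_sum]
    simp only [this, Finset.mul_sum]
    rw [Finset.sum_comm]
    refine Finset.sum_congr rfl fun j _ => ?_
    rw [Finset.sum_comm]
    exact Finset.sum_congr rfl fun l _ => Finset.sum_congr rfl fun i _ => by ring
  have step2' : (∑ i, (∑ j, D i j * t j) ^ 2) ^ 2
      ≤ (n : ℝ) ^ 2 * ∑ q : Fin n × Fin n, (∑ i, D i q.1 * D i q.2) ^ 2 := by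
    rw [e2]
    refine (Finset.sum_mul_sq_le_sq_mul_sq _ _ _).trans ?_
    refine mul_le_mul_of_nonneg_right ?_ (Finset.sum_nonneg fun i _ => sq_nonneg _)
    calc ∑ q : Fin n × Fin n, (t q.1 * t q.2) ^ 2 ≤ ∑ _q : Fin n × Fin n, (1 : ℝ) :=
          Finset.sum_le_sum fun q _ => by
            rw [mul_pow]
            exact mul_le_one₀ (sq1 _ (ht _)) (sq_nonneg _) (sq1 _ (ht _))
      _ = (n : ℝ) ^ 2 := by simp [sq]
  have e3 : ∑ q : Fin n × Fin n, (∑ i, D i q.1 * D i q.2) ^ 2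
      = ∑ i, ∑ j, ∑ k, ∑ l, D i j * D j k * D k l * D l i := by
    rw [Fintype.sum_prod_type]
    have : ∀ j l, (∑ i, D i j * D i l) ^ 2 = ∑ i, ∑ k, D i j * D j k * D k l * D l i := by
      intro j l
      rw [sq, Finset.sum_mul_sum]
      refine Finset.sum_congr rfl fun i _ => Finset.sum_congr rfl fun k _ => ?_
      rw [hD j k, hD l i]; ring
    simp only [this]
    rw [show (∑ j, ∑ l, ∑ i, ∑ k, D i j * D j k * D k l * D l i)
      = ∑ j, ∑ i, ∑ k, ∑ l, D i j * D j k * D k l * D l i from Finset.sum_congr rfl fun j _ => by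
        rw [Finset.sum_comm]
        exact Finset.sum_congr rfl fun i _ => by rw [Finset.sum_comm]]
    rw [Finset.sum_comm]
  have hn : (0 : ℝ) ≤ n := Nat.cast_nonneg n
  calc (∑ i, ∑ j, D i j * (s i * t j)) ^ 4 = ((∑ i, ∑ j, D i j * (s i * t j)) ^ 2) ^ 2 := by ring
    _ ≤ (n * ∑ i, (∑ j, D i j * t j) ^ 2) ^ 2 := pow_le_pow_left₀ (sq_nonneg _) step1' 2
    _ = n ^ 2 * (∑ i, (∑ j, D i j * t j) ^ 2) ^ 2 := by ring
    _ ≤ n ^ 2 * ((n : ℝ) ^ 2 * ∑ q : Fin n × Fin n, (∑ i, D i q.1 * D i q.2) ^ 2) :=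
        mul_le_mul_of_nonneg_left step2' (sq_nonneg _)
    _ = _ := by rw [e3]; ring

lemma rounding {n : ℕ} (p : Fin n → Fin n → ℝ) (hs : ∀ i j, p i j = p j i)
    (h01 : ∀ i j, p i j ∈ Set.Icc (0 : ℝ) 1) : ∃ G : SimpleGraph (Fin n), ∀ s t : Fin n → ℝ,
      (∀ i, s i ∈ Set.Icc (0 : ℝ) 1) → (∀ i, t i ∈ Set.Icc (0 : ℝ) 1) →
      ∃ X : ℝ, X ^ 4 ≤ 2 * (n : ℝ) ^ 7 ∧
        |∑ i, ∑ j, (adj01 G i j - p i j) * (s i * t j)| ≤ |X| + n := by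
  let pS : Sym2 (Fin n) → ℝ := Sym2.lift ⟨p, hs⟩
  have hpS : ∀ i j, pS s(i, j) = p i j := fun i j => rfl
  have hp01 : ∀ e, pS e ∈ Set.Icc (0 : ℝ) 1 := fun e => Sym2.ind (fun i j => h01 i j) e
  obtain ⟨a, ha1, ha2, ha3⟩ := vertex_round (QQ pS) (QQ_affine pS) Finset.univ pS hp01
  rw [QQ_self] at ha3
  let G : SimpleGraph (Fin n) :=
    { Adj := fun i j => i ≠ j ∧ a s(i, j) = 1
      symm := ⟨fun i j h => ⟨h.1.symm, by rw [Sym2.eq_swap]; exact h.2⟩⟩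
      loopless := ⟨fun i h => h.1 rfl⟩ }
  have hG : ∀ i j, adj01 G i j - p i j = dd pS a i j - (if i = j then p i i else 0) := by
    intro i j
    unfold adj01 dd
    by_cases hij : i = j
    · subst hij
      simp
    · rw [if_neg hij, if_neg hij, hpS, sub_zero]
      congr 1
      rcases ha1 s(i, j) (Finset.mem_univ _) with h | h
      · rw [h, if_neg]; intro h'; have := h'.2; rw [h] at this; norm_num at this
      · rw [h, if_pos]; exact ⟨hij, h⟩
  refine ⟨G, fun s t hs ht => ⟨∑ i, ∑ j, dd pS a i j * (s i * t j), ?_, ?_⟩⟩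
  · refine (cs_four _ s t hs ht (dd_symm pS a)).trans ?_
    have := four_total pS a hp01 ha2
    calc _ ≤ (n : ℝ) ^ 4 * (2 * (n : ℝ) ^ 3) := mul_le_mul_of_nonneg_left (by linarith) (by positivity)
      _ = _ := by ring
  · simp only [hG, sub_mul, Finset.sum_sub_distrib]
    refine (abs_sub _ _).trans (add_le_add_right ?_ _)
    simp only [ite_mul, zero_mul, Finset.sum_ite_eq, Finset.mem_univ, if_true]
    refine (Finset.abs_sum_le_sum_abs _ _).trans ?_
    calc _ ≤ ∑ _i : Fin n, (1 : ℝ) := Finset.sum_le_sum fun i _ => by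
          have h1 := h01 i i
          have h2 := hs i
          have h3 := ht i
          rw [abs_of_nonneg (mul_nonneg h1.1 (mul_nonneg h2.1 h3.1))]
          exact mul_le_one₀ h1.2 (mul_nonneg h2.1 h3.1) (mul_le_one₀ h2.2 h3.1 h3.2)
      _ = n := by simp

lemma clamp_avg {a b w : ℝ} (w0 : 0 ≤ w) (w1 : w ≤ 1) :
    |max 0 (min 1 ((a + b) / 2)) - w| ≤ (|a - w| + |b - w|) / 2 := by
  have k1 : |max 0 (min 1 ((a + b) / 2)) - w| ≤ |(a + b) / 2 - w| := by
    rcases le_total 1 ((a + b) / 2) with h | h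
    · rw [min_eq_left h, max_eq_right zero_le_one, abs_of_nonneg (by linarith),
        abs_of_nonneg (by linarith)]; linarith
    · rw [min_eq_right h]
      rcases le_total 0 ((a + b) / 2) with h' | h'
      · rw [max_eq_right h']
      · rw [max_eq_left h', abs_of_nonpos (by linarith), abs_of_nonpos (by linarith)]; linarith
  refine k1.trans ?_
  have e : (a + b) / 2 - w = ((a - w) + (b - w)) / 2 := by ring
  rw [e, abs_div, abs_two]
  have := abs_add_le (a - w) (b - w)
  linarith

lemma step_approx0 {W : ℝ → ℝ → ℝ} (hW : IsGraphon W) {η : ℝ} (hη : 0 < η) :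
    ∃ N : ℕ, ∀ n, N ≤ n → 0 < n → ∃ D : Fin n → Fin n → ℝ,
      l1Norm (fun x y => stepK n D x y - W x y) ≤ η := by
  obtain ⟨g, hgc, hg1, hg2, hgi⟩ := (hW.bk.integrable mu2).exists_hasCompactSupport_integral_sub_le
    (half_pos hη)
  have huc : UniformContinuous g := hgc.uniformContinuous_of_continuous hg2
  rw [Metric.uniformContinuous_iff] at huc
  obtain ⟨δ, hδ, hu⟩ := huc (η / 2) (half_pos hη)
  obtain ⟨N, hN⟩ := exists_nat_one_div_lt hδ
  refine ⟨N + 1, fun n hn hn0 => ?_⟩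
  have hn' : (0 : ℝ) < n := by exact_mod_cast hn0
  have hnδ : 1 / (n : ℝ) < δ := lt_of_le_of_lt
    (one_div_le_one_div_of_le (by positivity) (by exact_mod_cast hn)) hN
  let c : Fin n → ℝ := fun i => (((i : ℕ) : ℝ) + 1) / n
  have hc : ∀ i x, x ∈ J n i → dist x (c i) < δ := by
    intro i x hx
    refine lt_of_le_of_lt ?_ hnδ
    obtain ⟨h1, h2⟩ := hx
    rw [Real.dist_eq, abs_of_nonpos (by simp only [c]; linarith)]
    have : c i = ((i : ℕ) : ℝ) / n + 1 / n := by simp only [c]; ring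
    rw [this]; linarith
  let D : Fin n → Fin n → ℝ := fun i j => g (c i, c j)
  refine ⟨D, ?_⟩
  have bW := hW.bk
  have b1 := stepK_bk n D
  rw [l1Norm_eq (b1.sub bW)]
  have i0 : Integrable (fun q : ℝ × ℝ => ‖W q.1 q.2 - g q‖) mu2 :=
    ((bW.integrable mu2).sub hgi).norm
  have i1 : Integrable (fun q : ℝ × ℝ => ‖W q.1 q.2 - g q‖ + η / 2) mu2 :=
    i0.add (integrable_const _)
  calc ∫ q, |stepK n D q.1 q.2 - W q.1 q.2| ∂mu2 ≤ ∫ q, (‖W q.1 q.2 - g q‖ + η / 2) ∂mu2 := by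
        refine integral_mono_ae ((b1.sub bW).integrable mu2).abs i1 ?_
        have h1 : ∀ᵐ q ∂mu2, ∃ i, q.1 ∈ J n i :=
          Measure.quasiMeasurePreserving_fst.ae (ae_exists_J hn0)
        have h2 : ∀ᵐ q ∂mu2, ∃ i, q.2 ∈ J n i :=
          Measure.quasiMeasurePreserving_snd.ae (ae_exists_J hn0)
        filter_upwards [h1, h2] with q ⟨i, hi⟩ ⟨j, hj⟩
        rw [stepK_mem D hi hj]
        have hd : dist q (c i, c j) < δ := by
          rw [Prod.dist_eq]; exact max_lt (hc i _ hi) (hc j _ hj)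
        have h3 := hu hd
        rw [Real.dist_eq] at h3
        rw [Real.norm_eq_abs]
        have e : D i j - W q.1 q.2 = -(W q.1 q.2 - g q) - (g q - g (c i, c j)) := by
          simp only [D]; ring
        rw [e]
        refine (abs_sub _ _).trans ?_
        rw [abs_neg]; linarith
    _ ≤ η := by
        rw [integral_add i0 (integrable_const _), integral_const]
        simp only [probReal_univ, one_smul]
        linarith

lemma step_approx {W : ℝ → ℝ → ℝ} (hW : IsGraphon W) {η : ℝ} (hη : 0 < η) :
    ∃ N : ℕ, ∀ n, N ≤ n → 0 < n → ∃ p : Fin n → Fin n → ℝ, (∀ i j, p i j = p j i) ∧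
      (∀ i j, p i j ∈ Set.Icc (0 : ℝ) 1) ∧ l1Norm (fun x y => stepK n p x y - W x y) ≤ η := by
  obtain ⟨N, hN⟩ := step_approx0 hW hη
  refine ⟨N, fun n hn hn0 => ?_⟩
  obtain ⟨D, hl1⟩ := hN n hn hn0
  let p : Fin n → Fin n → ℝ := fun i j => max 0 (min 1 ((D i j + D j i) / 2))
  have hps : ∀ i j, p i j = p j i := fun i j => by simp only [p]; rw [add_comm]
  have hp01 : ∀ i j, p i j ∈ Set.Icc (0 : ℝ) 1 := fun i j =>
    ⟨le_max_left _ _, max_le zero_le_one (min_le_left _ _)⟩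
  refine ⟨p, hps, hp01, ?_⟩
  have bW := hW.bk
  have b1 := stepK_bk n D
  have b2 : BK fun x y => stepK n D y x := BK.swap b1
  have hl2 : l1Norm (fun x y => stepK n D y x - W x y) ≤ η := by
    refine le_trans (le_of_eq ?_) hl1
    rw [l1Norm_eq (b1.sub bW), l1Norm_eq (b2.sub bW)]
    have := integral_swap fun q => |stepK n D q.1 q.2 - W q.1 q.2|
    rw [← this]
    refine integral_congr_ae (ae_of_all _ fun q => ?_)
    exact congrArg (fun z => |stepK n D q.2 q.1 - z|) (hW.2.1 q.1 q.2)
  have b3 := stepK_bk n p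
  have hfin : l1Norm (fun x y => stepK n p x y - W x y) ≤
      (l1Norm (fun x y => stepK n D x y - W x y) + l1Norm (fun x y => stepK n D y x - W x y)) / 2 := by
    rw [l1Norm_eq (b1.sub bW), l1Norm_eq (b2.sub bW), l1Norm_eq (b3.sub bW),
      ← integral_add ((b1.sub bW).integrable mu2).abs ((b2.sub bW).integrable mu2).abs,
      ← integral_div]
    refine integral_mono_ae ((b3.sub bW).integrable mu2).abs
      ((((b1.sub bW).integrable mu2).abs.add ((b2.sub bW).integrable mu2).abs).div_const 2) ?_
    have h1 : ∀ᵐ q ∂mu2, ∃ i, q.1 ∈ J n i :=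
      Measure.quasiMeasurePreserving_fst.ae (ae_exists_J hn0)
    have h2 : ∀ᵐ q ∂mu2, ∃ i, q.2 ∈ J n i :=
      Measure.quasiMeasurePreserving_snd.ae (ae_exists_J hn0)
    filter_upwards [h1, h2] with q ⟨i, hi⟩ ⟨j, hj⟩
    simp only [stepK_mem _ hi hj, stepK_mem _ hj hi]
    have hw := hW.2.2 q.1 q.2
    obtain ⟨w0, w1⟩ := hw
    exact clamp_avg w0 w1
  linarith

lemma graph_approx {W : ℝ → ℝ → ℝ} (hW : IsGraphon W) {η : ℝ} (hη : 0 < η) (N : ℕ) :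
    ∃ n, N ≤ n ∧ 0 < n ∧ ∃ G : SimpleGraph (Fin n),
      cutNorm (fun x y => graphonOf G x y - W x y) ≤ η := by
  obtain ⟨N1, h1⟩ := step_approx hW (half_pos hη)
  obtain ⟨N2, hN2⟩ := exists_nat_gt (2 / (η / 4) ^ 4)
  obtain ⟨N3, hN3⟩ := exists_nat_gt (4 / η)
  set n := N + N1 + N2 + N3 + 1 with hndef
  obtain ⟨p, hps, hp01, hp⟩ := h1 n (by omega) (by omega)
  obtain ⟨G, hG⟩ := rounding p hps hp01
  refine ⟨n, by omega, by omega, G, ?_⟩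
  have hn0 : 0 < n := by omega
  have hn' : (0 : ℝ) < n := by exact_mod_cast hn0
  have hn2 : (N2 : ℝ) ≤ n := by exact_mod_cast (by omega : N2 ≤ n)
  have hn3 : (N3 : ℝ) ≤ n := by exact_mod_cast (by omega : N3 ≤ n)
  have hcut : cutNorm (fun x y => graphonOf G x y - stepK n p x y) ≤ η / 2 := by
    rw [graphonOf_eq]
    simp only [stepK_sub]
    refine cutNorm_stepK_le _ (fun s t hs ht => ?_) hn0
    obtain ⟨X, hX, hle⟩ := hG s t hs ht
    refine hle.trans ?_
    have k1 : |X| ≤ η / 4 * (n : ℝ) ^ 2 := by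
      refine le_of_pow_le_pow_left₀ (n := 4) (by norm_num) (by positivity) ?_
      rw [(by decide : Even 4).pow_abs, mul_pow]
      have : 2 < (η / 4) ^ 4 * n := by
        rw [div_lt_iff₀ (by positivity)] at hN2
        nlinarith [pow_pos (show (0 : ℝ) < η / 4 by positivity) 4]
      calc X ^ 4 ≤ 2 * (n : ℝ) ^ 7 := hX
        _ ≤ ((η / 4) ^ 4 * n) * (n : ℝ) ^ 7 := mul_le_mul_of_nonneg_right this.le (by positivity)
        _ = _ := by ring
    have k2 : (n : ℝ) ≤ η / 4 * (n : ℝ) ^ 2 := by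
      have : 4 < η * n := by
        rw [div_lt_iff₀ hη] at hN3
        nlinarith
      nlinarith
    linarith
  have e1 := cutNorm_triangle (graphonOf_graphon G).bk (stepK_bk n p) hW.bk
  have e2 := cutNorm_le_l1 ((stepK_bk n p).sub hW.bk)
  linarith

lemma gc_near {n k : ℕ} (hn : 0 < n) (hkn : k ≤ n) (G : SimpleGraph (Fin n)) {P : GraphProp}
    (hP : IsGraphProperty P) {W : ℝ → ℝ → ℝ} (hW : IsGraphon W) :
    |(goodCount G k P : ℝ) / n.choose k - probIn k W P| ≤
      (k : ℝ) ^ 2 / n + Clip k * cutNorm (fun x y => graphonOf G x y - W x y) := by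
  have h1 := goodCount_avgF hn hkn G hP
  have h2 := probIn_lip k P (graphonOf_graphon G) hW
  rw [probIn_graphonOf hn] at h2
  have h3 := abs_sub_le ((goodCount G k P : ℝ) / n.choose k) (avgF G k P) (probIn k W P)
  linarith

lemma comap_mem {P : GraphProp} (hP : IsGraphProperty P) {n : ℕ} {H : SimpleGraph (Fin n)}
    (h : H ∈ P n) (σ : Equiv.Perm (Fin n)) : H.comap σ ∈ P n :=
  (hP n _ _ ⟨SimpleGraph.Iso.comap σ H⟩).2 h

lemma mem_clos {P : GraphProp} {U : ℝ → ℝ → ℝ} (hU : IsGraphon U) (φ : InvMP) (n : ℕ → ℕ)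
    (H : ∀ t, SimpleGraph (Fin (n t))) (hH : ∀ t, H t ∈ P (n t)) (hn : Tendsto n atTop atTop)
    (hc : Tendsto (fun t => cutNorm fun x y =>
      graphonOf (H t) x y - U (φ.toFun x) (φ.toFun y)) atTop (𝓝 0)) : U ∈ closureP P := by
  refine ⟨hU, n, H, hH, hn, ?_⟩
  exact squeeze_zero (fun t => deltaCut_nonneg (graphonOf_graphon _).bk hU.bk)
    (fun t => deltaCut_le (graphonOf_graphon _).bk hU.bk φ) hc

lemma tend_kn (k : ℕ) {n : ℕ → ℕ} (hn : Tendsto n atTop atTop) :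
    Tendsto (fun m => (k : ℝ) ^ 2 / (n m : ℝ)) atTop (𝓝 0) :=
  (tendsto_natCast_atTop_atTop.comp hn).const_div_atTop _

lemma clos_prob {P P' : GraphProp} (hP' : IsGraphProperty P')
    (ha : ∀ (n : ℕ) (G : SimpleGraph (Fin n)), G ∈ P n → ∀ k, 1 ≤ k → k ≤ n →
      2 * n.choose k ≤ 3 * goodCount G k P') {W : ℝ → ℝ → ℝ} (hW : W ∈ closureP P)
    (k : ℕ) (hk : 1 ≤ k) : (2 : ℝ) / 3 ≤ probIn k W P' := by
  obtain ⟨hWg, n, G, hG, hn, hd⟩ := hW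
  refine le_of_forall_pos_le_add fun ε hε => ?_
  have hC := Clip_pos k
  have e1 : ∀ᶠ m in atTop, deltaCut (graphonOf (G m)) W < ε / 2 / Clip k :=
    hd.eventually (gt_mem_nhds (by positivity))
  have e2 : ∀ᶠ m in atTop, (k : ℝ) ^ 2 / (n m : ℝ) < ε / 2 :=
    (tend_kn k hn).eventually (gt_mem_nhds (by positivity))
  obtain ⟨m, h1, h2, h3⟩ := (e1.and (e2.and (hn.eventually_ge_atTop k))).exists
  obtain ⟨φ, hφ⟩ := exists_of_deltaCut_lt h1
  have hn0 : 0 < n m := by omega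
  have h4 := gc_near hn0 h3 (G m) hP' (hWg.compMP φ)
  rw [probIn_comp k P' hWg φ] at h4
  have h5 := ha _ _ (hG m) k hk h3
  have hch : (0 : ℝ) < (n m).choose k := by exact_mod_cast Nat.choose_pos h3
  have h6 : (2 : ℝ) / 3 ≤ (goodCount (G m) k P' : ℝ) / (n m).choose k := by
    rw [div_le_div_iff₀ (by norm_num) hch]
    have : (2 * (n m).choose k : ℝ) ≤ 3 * goodCount (G m) k P' := by exact_mod_cast h5
    linarith
  have h7 : Clip k * cutNorm (fun x y => graphonOf (G m) x y - W (φ.toFun x) (φ.toFun y)) ≤ ε / 2 := by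
    have := mul_le_mul_of_nonneg_left hφ.le hC.le
    rwa [mul_div_cancel₀ _ hC.ne'] at this
  have := (abs_le.1 h4).2
  linarith

lemma far_prob {P P' : GraphProp} (hP : IsGraphProperty P) (hP' : IsGraphProperty P')
    {ε : ℝ} (hε : 0 < ε) {k : ℕ}
    (hb : ∀ (n : ℕ) (G : SimpleGraph (Fin n)), k ≤ n →
        ENNReal.ofReal (ε / 4) ≤ graphD1P G P → 3 * goodCount G k P' ≤ n.choose k)
    {W : ℝ → ℝ → ℝ} (hW : IsGraphon W) (hd : ENNReal.ofReal ε ≤ d1SetE W (closureP P)) :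
    probIn k W P' ≤ 1 / 3 := by
  by_contra! hcon
  have hC := Clip_pos k
  obtain ⟨δ, hδ⟩ : ∃ δ, δ = probIn k W P' - 1 / 3 := ⟨_, rfl⟩
  have hδ0 : 0 < δ := by linarith
  obtain ⟨N0, hN0⟩ := exists_nat_gt ((k : ℝ) ^ 2 / (δ / 4))
  have hap : ∀ j : ℕ, ∃ n, j ≤ n ∧ 0 < n ∧ ∃ G H : SimpleGraph (Fin n),
      cutNorm (fun x y => graphonOf G x y - W x y) ≤ 1 / ((j : ℝ) + 1) ∧
      H ∈ P n ∧ graphD1 G H < ε / 4 := by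
    intro j
    obtain ⟨n, hNn, hn0, G, hG⟩ := graph_approx hW
      (show 0 < min (1 / ((j : ℝ) + 1)) (δ / 4 / Clip k) by positivity) (N0 + k + j)
    have h4 := gc_near (k := k) hn0 (by omega) G hP' hW
    have hch : (0 : ℝ) < n.choose k := by exact_mod_cast Nat.choose_pos (by omega)
    have h7 : Clip k * cutNorm (fun x y => graphonOf G x y - W x y) ≤ δ / 4 := by
      have := mul_le_mul_of_nonneg_left (hG.trans (min_le_right _ _)) hC.le
      rwa [mul_div_cancel₀ _ hC.ne'] at this
    have h8 : (k : ℝ) ^ 2 / n ≤ δ / 4 := by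
      have hnn : (N0 : ℝ) ≤ n := by exact_mod_cast (by omega : N0 ≤ n)
      have hn0' : (0 : ℝ) < n := by exact_mod_cast hn0
      rw [div_le_iff₀ hn0']
      rw [div_lt_iff₀ (by positivity)] at hN0
      nlinarith
    have h9 : (1 : ℝ) / 3 < goodCount G k P' / n.choose k := by
      have := (abs_le.1 h4).1
      linarith
    rw [div_lt_div_iff₀ (by norm_num) hch] at h9
    have h10 : graphD1P G P < ENNReal.ofReal (ε / 4) := by
      by_contra! hh
      have := hb n G (by omega) hh
      have : (3 * goodCount G k P' : ℝ) ≤ n.choose k := by exact_mod_cast this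
      linarith
    unfold graphD1P at h10
    simp only [iInf_lt_iff] at h10
    obtain ⟨H, hH, hlt⟩ := h10
    exact ⟨n, by omega, hn0, G, H, hG.trans (min_le_left _ _), hH,
      (ENNReal.ofReal_lt_ofReal_iff (by positivity)).1 hlt⟩
  choose n hjn hn0 G H hGW hHP hGH using hap
  obtain ⟨ψ, hψ, σ, W', U, hW', hU, hcW, hcU⟩ := compact_pair n hn0 G H
  have hn : Tendsto (fun t => n (ψ t)) atTop atTop :=
    tendsto_atTop_mono (fun t => (hψ.id_le t).trans (hjn (ψ t))) tendsto_id
  have hl : l1Norm (fun x y => W' x y - U x y) ≤ ε / 2 := by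
    refine l1_lsc (fun t => graphonOf_graphon _) (fun t => graphonOf_graphon _) hW' hU hcW hcU
      fun t => ?_
    simp only [graphonOf_comap (hn0 (ψ t))]
    rw [l1Norm_comp (D := fun x y => graphonOf (G (ψ t)) x y - graphonOf (H (ψ t)) x y)
      ((graphonOf_graphon _).bk.sub (graphonOf_graphon _).bk)]
    have := l1_graph_le (G (ψ t)) (H (ψ t))
    have := hGH (ψ t)
    linarith
  have hcc : Tendsto (fun t => cutNorm fun x y =>
      W ((permMP (hn0 (ψ t)) (σ (ψ t))).toFun x) ((permMP (hn0 (ψ t)) (σ (ψ t))).toFun y)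
        - W' x y) atTop (𝓝 0) := by
    have h0 : Tendsto (fun t : ℕ => 1 / ((t : ℝ) + 1) + cutNorm fun x y =>
        graphonOf ((G (ψ t)).comap (σ (ψ t))) x y - W' x y) atTop (𝓝 0) := by
      simpa using tendsto_one_div_add_atTop_nhds_zero_nat.add hcW
    refine squeeze_zero (fun t => cutNorm_nonneg ((hW.compMP _).bk.sub hW'.bk)) (fun t => ?_) h0
    refine (cutNorm_triangle (hW.compMP _).bk
      (graphonOf_graphon ((G (ψ t)).comap (σ (ψ t)))).bk hW'.bk).trans ?_
    gcongr
    simp only [graphonOf_comap (hn0 (ψ t))]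
    rw [cutNorm_comp (D := fun x y => W x y - graphonOf (G (ψ t)) x y)
      (hW.bk.sub (graphonOf_graphon _).bk), cutNorm_sub_comm]
    refine (hGW (ψ t)).trans ?_
    have : (t : ℝ) ≤ ψ t := by exact_mod_cast hψ.id_le t
    gcongr
  have hll := l1_of_cut hW hW' (fun t => permMP (hn0 (ψ t)) (σ (ψ t))) hcc
  obtain ⟨t, ht⟩ := (hll.eventually (gt_mem_nhds (show (0 : ℝ) < ε / 4 by positivity))).exists
  obtain ⟨φ, hφ⟩ : ∃ φ, φ = permMP (hn0 (ψ t)) (σ (ψ t)) := ⟨_, rfl⟩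
  rw [← hφ] at ht
  have hUc := hU.compMP φ.symm
  have hmem : (fun x y => U (φ.symm.toFun x) (φ.symm.toFun y)) ∈ closureP P := by
    refine mem_clos hUc φ (fun t => n (ψ t)) (fun t => (H (ψ t)).comap (σ (ψ t)))
      (fun t => comap_mem hP (hHP _) _) hn ?_
    refine hcU.congr fun s => cutNorm_congr fun x hx y hy => ?_
    simp only [InvMP.symm, φ.leftInv x hx, φ.leftInv y hy]
  have h1 : d1SetE W (closureP P) ≤ ENNReal.ofReal (l1Norm fun x y =>
      W x y - U (φ.symm.toFun x) (φ.symm.toFun y)) := iInf₂_le (i := fun x y => U (φ.symm.toFun x) (φ.symm.toFun y)) hmem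
  have h2 : l1Norm (fun x y => W x y - U (φ.symm.toFun x) (φ.symm.toFun y)) < ε := by
    rw [← l1Norm_comp (hW.bk.sub hUc.bk) φ]
    rw [l1Norm_congr (D' := fun x y => W (φ.toFun x) (φ.toFun y) - U x y) (fun x hx y hy => by
      simp only [InvMP.symm, φ.leftInv x hx, φ.leftInv y hy])]
    have := l1Norm_triangle (hW.compMP φ).bk hW'.bk hU.bk
    linarith
  exact absurd (hd.trans h1) (not_le.2 ((ENNReal.ofReal_lt_ofReal_iff hε).2 h2))

lemma forward {P : GraphProp} (hP : IsGraphProperty P) (h : GraphTestable P) :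
    Robust P ∧ GraphonTestable (closureP P) := by
  obtain ⟨P', hP', ha, hb⟩ := h
  refine ⟨fun ε hε => ?_, P', hP', fun W hW k hk => clos_prob hP' ha hW k hk, fun ε hε => ?_⟩
  · obtain ⟨k, hk1, hk⟩ := hb ε hε
    have hC := Clip_pos k
    obtain ⟨N0, hN0⟩ := exists_nat_gt ((k : ℝ) ^ 2 * 12)
    refine ⟨N0 + k, 1 / 24 / Clip k, by omega, by positivity, fun n hNn G hG => ?_⟩
    by_contra! hcon
    have h1 := hk n G k le_rfl (by omega) hcon.le
    have h2 : d1SetE (graphonOf G) (closureP P) < ENNReal.ofReal (1 / 12 / Clip k) := by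
      refine hG.trans_lt ((ENNReal.ofReal_lt_ofReal_iff (by positivity)).2 ?_)
      gcongr
      norm_num
    unfold d1SetE at h2
    simp only [iInf_lt_iff] at h2
    obtain ⟨U, hU, hlt⟩ := h2
    replace hlt := (ENNReal.ofReal_lt_ofReal_iff (by positivity)).1 hlt
    have h3 := clos_prob hP' ha hU k hk1
    have hn0 : 0 < n := by omega
    have h4 := gc_near (k := k) hn0 (by omega) G hP' hU.1
    have h5 := cutNorm_le_l1 ((graphonOf_graphon G).bk.sub hU.1.bk)
    have hch : (0 : ℝ) < n.choose k := by exact_mod_cast Nat.choose_pos (by omega)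
    have h7 : Clip k * cutNorm (fun x y => graphonOf G x y - U x y) ≤ 1 / 12 := by
      have := mul_le_mul_of_nonneg_left (h5.trans hlt.le) hC.le
      rwa [mul_div_cancel₀ _ hC.ne'] at this
    have h8 : (k : ℝ) ^ 2 / n ≤ 1 / 12 := by
      have hnn : (N0 : ℝ) ≤ n := by exact_mod_cast (by omega : N0 ≤ n)
      have hn0' : (0 : ℝ) < n := by exact_mod_cast hn0
      rw [div_le_iff₀ hn0']
      linarith
    have h9 : (1 : ℝ) / 3 < goodCount G k P' / n.choose k := by
      have := (abs_le.1 h4).1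
      linarith
    rw [div_lt_div_iff₀ (by norm_num) hch] at h9
    have : (3 * goodCount G k P' : ℝ) ≤ n.choose k := by exact_mod_cast h1
    linarith
  · obtain ⟨k0, hk1, hk⟩ := hb (ε / 4) (by positivity)
    exact ⟨k0, hk1, fun k hkk W hW hd =>
      far_prob hP hP' hε (fun n G hkn hd => hk n G k hkk hkn hd) hW hd⟩

lemma avg_large {P R' : GraphProp} (hP : IsGraphProperty P)
    (ha : ∀ W ∈ closureP P, ∀ k : ℕ, 1 ≤ k → (2 : ℝ) / 3 ≤ probIn k W R') (m : ℕ) (hm : 1 ≤ m) :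
    ∃ K : ℕ, ∀ n, K ≤ n → ∀ G : SimpleGraph (Fin n), G ∈ P n → 6 / 10 ≤ avgF G m R' := by
  by_contra! hcon
  choose n hn G hG hlt using fun j : ℕ => hcon (j + 1)
  have hn0 : ∀ t, 0 < n t := fun t => by have := hn t; omega
  obtain ⟨ψ, hψ, σ, W, U, hW, -, hcW, -⟩ := compact_pair n hn0 G G
  have hmem : W ∈ closureP P := by
    refine mem_clos hW InvMP.id (fun t => n (ψ t)) (fun t => (G (ψ t)).comap (σ (ψ t)))
      (fun t => comap_mem hP (hG _) _) ?_ hcW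
    refine tendsto_atTop_mono (fun t => ?_) tendsto_id
    have h1 := hψ.id_le t
    have h2 := hn (ψ t)
    simp only [id] at h1 ⊢
    omega
  have h1 := ha W hmem m hm
  have hC := Clip_pos m
  obtain ⟨t, ht⟩ := (hcW.eventually
    (gt_mem_nhds (show (0 : ℝ) < 1 / 20 / Clip m by positivity))).exists
  have h2 := probIn_lip m R' (graphonOf_graphon ((G (ψ t)).comap (σ (ψ t)))) hW
  rw [probIn_graphonOf (hn0 _), avgF_comap] at h2
  have h3 := mul_le_mul_of_nonneg_left ht.le hC.le
  rw [mul_div_cancel₀ _ hC.ne'] at h3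
  have h4 := hlt (ψ t)
  have h5 := (abs_le.1 h2).1
  linarith

open Classical in
lemma backward {P : GraphProp} (hP : IsGraphProperty P) (hr : Robust P)
    (h : GraphonTestable (closureP P)) : GraphTestable P := by
  obtain ⟨R', hR', ha, hb⟩ := h
  have hK : ∀ m : ℕ, ∃ K : ℕ, 3600 * m ^ 2 ≤ K ∧ (1 ≤ m → ∀ n, K ≤ n →
      ∀ G : SimpleGraph (Fin n), G ∈ P n → 6 / 10 ≤ avgF G m R') := by
    intro m
    by_cases hm : 1 ≤ m
    · obtain ⟨K, hK⟩ := avg_large hP ha m hm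
      exact ⟨K + 3600 * m ^ 2, by omega, fun _ n hn G hG => hK n (by omega) G hG⟩
    · exact ⟨3600 * m ^ 2, le_rfl, fun h => absurd h hm⟩
  choose K hK1 hK2 using hK
  obtain ⟨M, hM1, hM2⟩ : ∃ M : ℕ → ℕ, (∀ k, M k ≠ 0 → K (M k) ≤ k) ∧
      ∀ m k, m ≤ k → K m ≤ k → m ≤ M k :=
    ⟨fun k => Nat.findGreatest (fun m => K m ≤ k) k,
      fun k hk => Nat.findGreatest_of_ne_zero (P := fun m => K m ≤ k) rfl hk,
      fun m k h1 h2 => Nat.le_findGreatest h1 h2⟩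
  obtain ⟨P', hP'⟩ : ∃ P' : GraphProp, ∀ k F, F ∈ P' k ↔ (M k = 0 ∨ 1 / 2 ≤ avgF F (M k) R') :=
    ⟨fun k => {F | M k = 0 ∨ 1 / 2 ≤ avgF F (M k) R'}, fun k F => Iff.rfl⟩
  have hP'P : IsGraphProperty P' := by
    rintro n G H ⟨e⟩
    have : G = H.comap e.toEquiv := by
      ext a b
      simp only [SimpleGraph.comap_adj]
      exact e.map_rel_iff.symm
    rw [hP', hP', this, avgF_comap]
  refine ⟨P', hP'P, fun n G hG k hk hkn => ?_, fun ε hε => ?_⟩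
  · have hch : (0 : ℝ) < n.choose k := by exact_mod_cast Nat.choose_pos hkn
    have hc : (1 : ℝ) - goodCount G k P' / n.choose k ≤ 1 / 3 := by
      rw [goodCount_eq hkn G hP'P]
      by_cases hM : M k = 0
      · simp [hP', hM]
      · have hKk := hM1 k hM
        have h6 := hK2 (M k) (by omega) n (by omega) G hG
        have hch := cheb (by omega) hkn ((hK1 (M k)).trans hKk) G R'
          (fun π => ¬ G.comap (fun a => π (Fin.castLE hkn a)) ∈ P' k) (fun π hπ => by
            rw [hP'] at hπ
            push Not at hπ
            rw [abs_sub_comm]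
            refine le_trans ?_ (le_abs_self _)
            linarith [hπ.2])
        refine le_trans (le_of_eq ?_) hch
        rw [sub_eq_iff_eq_add, ← Finset.expect_add_distrib]
        rw [Finset.expect_congr rfl (g := fun _ => (1 : ℝ)) (fun π _ => by
          split_ifs <;> simp_all)]
        simp
    rw [sub_le_comm, le_div_iff₀ hch] at hc
    have : (2 * n.choose k : ℝ) ≤ 3 * goodCount G k P' := by linarith
    exact_mod_cast this
  · obtain ⟨N, ε', hN, hε', hrob⟩ := hr (ε / 2) (by positivity)
    obtain ⟨m0, hm0, hm⟩ := hb ε' hε'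
    refine ⟨N + m0 + K m0, by omega, fun n G k hk hkn hd => ?_⟩
    have hch : (0 : ℝ) < n.choose k := by exact_mod_cast Nat.choose_pos hkn
    have hMk : m0 ≤ M k := hM2 m0 k (by omega) (by omega)
    have hKk := hM1 k (by omega)
    have hfar : ENNReal.ofReal ε' ≤ d1SetE (graphonOf G) (closureP P) := by
      by_contra! hlt
      have h1 := hrob n (by omega) G hlt.le
      have h2 : ENNReal.ofReal (ε / 2) < ENNReal.ofReal ε :=
        (ENNReal.ofReal_lt_ofReal_iff hε).2 (by linarith)
      exact absurd (hd.trans h1) (not_le.2 h2)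
    have h1 := hm (M k) hMk (graphonOf G) (graphonOf_graphon G) hfar
    rw [probIn_graphonOf (by omega)] at h1
    have hc := cheb (by omega) hkn ((hK1 (M k)).trans hKk) G R'
      (fun π => G.comap (fun a => π (Fin.castLE hkn a)) ∈ P' k) (fun π hπ => by
        rw [hP'] at hπ
        refine le_trans ?_ (le_abs_self _)
        have := hπ.resolve_left (by omega)
        linarith)
    rw [← goodCount_eq hkn G hP'P, div_le_iff₀ hch] at hc
    have : (3 * goodCount G k P' : ℝ) ≤ n.choose k := by linarith
    exact_mod_cast this

theorem graph_testable_iff_robust_and_closure_testable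
    (P : GraphProp) (hP : IsGraphProperty P) :
    GraphTestable P ↔ Robust P ∧ GraphonTestable (closureP P) := by
  exact ⟨fun h => forward hP h, fun h => backward hP h.1 h.2⟩

end
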